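/- The Hamilton–Jacobi–Isaacs equation ∂_t W(t,x) + sup_{μ ∈ ΔU} inf_{ν ∈ ΔV} f̃(t,x,μ,ν)·∇W(t,x) = 0 on [0,T] × ℝ^d with terminal condition W(T,·) = g possesses, in the class of bounded continuous functions, a unique viscosity solution V. Moreover, for any sequence of partitions (Π_n)_{n≥1} of [0,T] with mesh |Π_n| → 0 as n → ∞, both the lower value functions V^{Π_n} and the upper value functions U^{Π_n} converge uniformly on compact subsets of [0,T] × ℝ^d to the function V. -/

import Mathlib

open MeasureTheory Set Filter Topology
open scoped unitInterval RealInnerProductSpace ENNReal NNReal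

noncomputable section

namespace DGameFormal

/-! ### The canonical sample space `Ω = ([0,1]²)^ℕ` -/

/-- The sample space `Ω = ([0,1]²)^ℕ`.  The `j`-th coordinate mapping `ζ_{j+1}` of the paper is
`ω ↦ ω j` (we use `0`-based indexing, so the paper's `ζ_j`, `j ≥ 1`, is `ω ↦ ω (j-1)`). -/
abbrev Omega : Type := ℕ → (I × I)

/-- `𝓕_j`: the σ-field generated by the first `j` coordinate mappings `ζ_1, …, ζ_j`. -/
def Fsig (j : ℕ) : MeasurableSpace Omega :=
  MeasurableSpace.comap (fun ω (i : Fin j) => ω (i : ℕ)) inferInstance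

/-- `𝓖_{j+1}`: the σ-field generated by the first component of the coordinate `ζ_{j+1}`. -/
def Gsig (j : ℕ) : MeasurableSpace Omega :=
  MeasurableSpace.comap (fun ω => (ω j).1) inferInstance

/-- `𝓗_{j+1}`: the σ-field generated by the second component of the coordinate `ζ_{j+1}`. -/
def Hsig (j : ℕ) : MeasurableSpace Omega :=
  MeasurableSpace.comap (fun ω => (ω j).2) inferInstance

/-- `P` is the countable product `λ₂^{⊗ℕ}` of the two-dimensional Lebesgue (Borel) measure on the
unit square: it has the prescribed finite-dimensional distributions. -/
def IsProductMeasure (P : Measure Omega) : Prop :=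
  ∀ m : ℕ, P.map (fun ω (i : Fin m) => ω (i : ℕ))
      = Measure.pi (fun _ : Fin m => (volume : Measure (I × I)))

/-! ### Partitions of `[0,T]` -/

/-- A partition `0 = t_0 < t_1 < ⋯ < t_n = T` of the interval `[0,T]`. -/
structure Partition (T : ℝ) where
  n : ℕ
  npos : 0 < n
  t : ℕ → ℝ
  map_zero : t 0 = 0
  map_last : t n = T
  mono : ∀ i < n, t i < t (i + 1)

/-- The mesh `|Π|`: the maximal distance between two neighbouring points of the partition. -/
def Partition.mesh {T : ℝ} (π : Partition T) : ℝ :=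
  (Finset.range π.n).sup' (Finset.nonempty_range_iff.2 π.npos.ne') fun i => π.t (i + 1) - π.t i

open scoped Classical in
/-- For `t ∈ [t_i, t_{i+1})` the index `i` (and `n - 1` for `t ≥ t_{n-1}`). -/
def Partition.idx {T : ℝ} (π : Partition T) (s : ℝ) : ℕ :=
  Nat.findGreatest (fun i => π.t i ≤ s) (π.n - 1)

/-! ### Admissible controls along a partition -/

variable (U V : Type) [MeasurableSpace U] [MeasurableSpace V]

/-- Admissible controls for Player 1 along the partition `π`: measurable processes `u` such that on
each interval `[t_{j-1}, t_j)` of the partition, `u` is a countable sum `Σ_k 1_{Γ_{j,k}} u^{j,k}`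
where `(Γ_{j,k})_k ⊆ 𝓕_{j-1}` is a partition of `Ω` and each `u^{j,k}` is `𝓖_j`-measurable. -/
def AdmControl1 {T : ℝ} (π : Partition T) : Set (ℝ → Omega → U) :=
  {u | Measurable (Function.uncurry u) ∧
    ∀ j < π.n, ∃ (Γ : ℕ → Set Omega) (w : ℕ → ℝ → Omega → U),
      (∀ k, MeasurableSet[Fsig j] (Γ k)) ∧
      Pairwise (Function.onFun Disjoint Γ) ∧
      (⋃ k, Γ k) = univ ∧
      (∀ k s, Measurable[Gsig j] (w k s)) ∧
      (∀ k, ∀ ω ∈ Γ k, ∀ s ∈ Ico (π.t j) (π.t (j + 1)), u s ω = w k s ω)}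

/-- Admissible controls for Player 2 along the partition `π` (with `𝓗_j` in place of `𝓖_j`). -/
def AdmControl2 {T : ℝ} (π : Partition T) : Set (ℝ → Omega → V) :=
  {v | Measurable (Function.uncurry v) ∧
    ∀ j < π.n, ∃ (Γ : ℕ → Set Omega) (w : ℕ → ℝ → Omega → V),
      (∀ k, MeasurableSet[Fsig j] (Γ k)) ∧
      Pairwise (Function.onFun Disjoint Γ) ∧
      (⋃ k, Γ k) = univ ∧
      (∀ k s, Measurable[Hsig j] (w k s)) ∧
      (∀ k, ∀ ω ∈ Γ k, ∀ s ∈ Ico (π.t j) (π.t (j + 1)), v s ω = w k s ω)}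

/-! ### Nonanticipative strategies with delay (NAD strategies) -/

/-- A stopping time `τ : Ω → {0, 1, …, n-1}` of the discrete filtration `(𝓕_j)_j`. -/
def IsStoppingIdx {T : ℝ} (π : Partition T) (τ : Omega → ℕ) : Prop :=
  (∀ ω, τ ω < π.n) ∧ ∀ j, MeasurableSet[Fsig j] {ω | τ ω = j}

variable {U V}

/-- `u = u'`, `ds⊗dP`-a.e. on the stochastic interval `[[t, b]] = {(s,ω) | t ≤ s ≤ b ω}`. -/
def aeStEq {α : Type*} (P : Measure Omega) (t : ℝ) (b : Omega → ℝ)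
    (u u' : ℝ → Omega → α) : Prop :=
  ∀ᵐ p ∂((volume : Measure ℝ).prod P), t ≤ p.1 → p.1 ≤ b p.2 → u p.1 p.2 = u' p.1 p.2

/-- `u = u'`, `ds⊗dP`-a.e. on `[a,b] × Ω`. -/
def aeEqIcc {α : Type*} (P : Measure Omega) (a b : ℝ) (u u' : ℝ → Omega → α) : Prop :=
  ∀ᵐ p ∂((volume : Measure ℝ).prod P), p.1 ∈ Icc a b → u p.1 p.2 = u' p.1 p.2

variable (U V)

/-- NAD strategies for Player 1 on `[t,T]` along `π`: maps from admissible controls of Player 2 to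
admissible controls of Player 1 such that controls agreeing `ds⊗dP`-a.e. on `[[t, t_τ]]`, for a
stopping time `τ`, are mapped to controls agreeing `ds⊗dP`-a.e. on `[[t, t_{τ+1}]]`. -/
def IsNAD1 {T : ℝ} (P : Measure Omega) (π : Partition T) (t : ℝ)
    (α : (ℝ → Omega → V) → (ℝ → Omega → U)) : Prop :=
  (∀ v ∈ AdmControl2 V π, α v ∈ AdmControl1 U π) ∧
  ∀ τ : Omega → ℕ, IsStoppingIdx π τ →
    ∀ v v', v ∈ AdmControl2 V π → v' ∈ AdmControl2 V π →
      aeStEq P t (fun ω => π.t (τ ω)) v v' →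
      aeStEq P t (fun ω => π.t (τ ω + 1)) (α v) (α v')

/-- NAD strategies for Player 2 on `[t,T]` along `π`. -/
def IsNAD2 {T : ℝ} (P : Measure Omega) (π : Partition T) (t : ℝ)
    (β : (ℝ → Omega → U) → (ℝ → Omega → V)) : Prop :=
  (∀ u ∈ AdmControl1 U π, β u ∈ AdmControl2 V π) ∧
  ∀ τ : Omega → ℕ, IsStoppingIdx π τ →
    ∀ u u', u ∈ AdmControl1 U π → u' ∈ AdmControl1 U π →
      aeStEq P t (fun ω => π.t (τ ω)) u u' →
      aeStEq P t (fun ω => π.t (τ ω + 1)) (β u) (β u')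

/-! ### The controlled dynamics -/

variable {U V}
variable {d : ℕ}

/-- `X` is the (continuous) solution on `[t,T]` of `X_s = x + ∫_t^s f(r, X_r, u_r, v_r) dr`. -/
def IsSol (f : ℝ → EuclideanSpace ℝ (Fin d) → U → V → EuclideanSpace ℝ (Fin d)) (T t : ℝ)
    (x : EuclideanSpace ℝ (Fin d)) (u : ℝ → U) (v : ℝ → V)
    (X : ℝ → EuclideanSpace ℝ (Fin d)) : Prop :=
  ContinuousOn X (Icc t T) ∧ ∀ s ∈ Icc t T, X s = x + ∫ r in t..s, f r (X r) (u r) (v r)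

/-- The solution `X^{t,x,u,v}` (chosen via the axiom of choice; under the standing assumptions it
is the unique continuous solution). -/
def sol (f : ℝ → EuclideanSpace ℝ (Fin d) → U → V → EuclideanSpace ℝ (Fin d)) (T t : ℝ)
    (x : EuclideanSpace ℝ (Fin d)) (u : ℝ → U) (v : ℝ → V) : ℝ → EuclideanSpace ℝ (Fin d) :=
  Classical.epsilon (IsSol f T t x u v)

/-- `(u,v)` is the couple of admissible controls associated with the couple of NAD strategies
`(α,β)` on `[t, tl]`:  `α(v) = u` and `β(u) = v`, `ds⊗dP`-a.e. on `[t,tl] × Ω`. -/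
def IsFixPair {T : ℝ} (P : Measure Omega) (π : Partition T) (t tl : ℝ)
    (α : (ℝ → Omega → V) → (ℝ → Omega → U)) (β : (ℝ → Omega → U) → (ℝ → Omega → V))
    (u : ℝ → Omega → U) (v : ℝ → Omega → V) : Prop :=
  u ∈ AdmControl1 U π ∧ v ∈ AdmControl2 V π ∧ aeEqIcc P t tl (α v) u ∧ aeEqIcc P t tl (β u) v

variable [Nonempty U] [Nonempty V]

/-- The couple of admissible controls associated with a couple of NAD strategies on `[t,tl]`
(chosen via the axiom of choice; by Lemma 2.1 it exists and is `ds⊗dP`-a.e. unique). -/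
def fixPair {T : ℝ} (P : Measure Omega) (π : Partition T) (t tl : ℝ)
    (α : (ℝ → Omega → V) → (ℝ → Omega → U)) (β : (ℝ → Omega → U) → (ℝ → Omega → V)) :
    (ℝ → Omega → U) × (ℝ → Omega → V) :=
  Classical.epsilon fun p => IsFixPair P π t tl α β p.1 p.2

/-- The state process `X^{t,x,α,β}` associated with a couple of NAD strategies on `[t,tl]`. -/
def solStrat (f : ℝ → EuclideanSpace ℝ (Fin d) → U → V → EuclideanSpace ℝ (Fin d)) {T : ℝ}
    (P : Measure Omega) (π : Partition T) (t tl : ℝ) (x : EuclideanSpace ℝ (Fin d))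
    (α : (ℝ → Omega → V) → (ℝ → Omega → U)) (β : (ℝ → Omega → U) → (ℝ → Omega → V))
    (s : ℝ) (ω : Omega) : EuclideanSpace ℝ (Fin d) :=
  sol f T t x (fun r => (fixPair P π t tl α β).1 r ω) (fun r => (fixPair P π t tl α β).2 r ω) s

/-- The terminal pay-off `g(X_T^{t,x,α,β})`. -/
def payoff (f : ℝ → EuclideanSpace ℝ (Fin d) → U → V → EuclideanSpace ℝ (Fin d))
    (g : EuclideanSpace ℝ (Fin d) → ℝ) {T : ℝ} (P : Measure Omega) (π : Partition T)
    (t : ℝ) (x : EuclideanSpace ℝ (Fin d))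
    (α : (ℝ → Omega → V) → (ℝ → Omega → U)) (β : (ℝ → Omega → U) → (ℝ → Omega → V)) :
    Omega → ℝ :=
  fun ω => g (solStrat f P π t T x α β T ω)

/-! ### Essential suprema/infima of families of random variables -/

/-- `S` is the `P`-a.s. least upper bound of the family `(ξ_i)_{i}` of random variables. -/
def IsEssSupFam {ι : Sort*} (P : Measure Omega) (ξ : ι → Omega → ℝ) (S : Omega → ℝ) : Prop :=
  (∀ i, ξ i ≤ᵐ[P] S) ∧ ∀ W : Omega → ℝ, (∀ i, ξ i ≤ᵐ[P] W) → S ≤ᵐ[P] W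

/-- `S` is the `P`-a.s. greatest lower bound of the family `(ξ_i)_{i}` of random variables. -/
def IsEssInfFam {ι : Sort*} (P : Measure Omega) (ξ : ι → Omega → ℝ) (S : Omega → ℝ) : Prop :=
  (∀ i, S ≤ᵐ[P] ξ i) ∧ ∀ W : Omega → ℝ, (∀ i, W ≤ᵐ[P] ξ i) → W ≤ᵐ[P] S

/-! ### Value functions along a partition -/

variable (U V)

/-- The defining property of the lower value function along `π`:
`S = esssup_{α} essinf_{β} E[g(X_T^{t,x,α,β}) | 𝓕_i]` for `t_i ≤ t < t_{i+1}`. -/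
def IsLowerVal (f : ℝ → EuclideanSpace ℝ (Fin d) → U → V → EuclideanSpace ℝ (Fin d))
    (g : EuclideanSpace ℝ (Fin d) → ℝ) {T : ℝ} (P : Measure Omega) (π : Partition T)
    (t : ℝ) (x : EuclideanSpace ℝ (Fin d)) (S : Omega → ℝ) : Prop :=
  ∃ J : {α // IsNAD1 U V P π t α} → Omega → ℝ,
    (∀ α, IsEssInfFam P
      (fun β : {β // IsNAD2 U V P π t β} => P[payoff f g P π t x α.1 β.1 | Fsig (π.idx t)])
      (J α)) ∧
    IsEssSupFam P J S

/-- The defining property of the upper value function along `π`. -/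
def IsUpperVal (f : ℝ → EuclideanSpace ℝ (Fin d) → U → V → EuclideanSpace ℝ (Fin d))
    (g : EuclideanSpace ℝ (Fin d) → ℝ) {T : ℝ} (P : Measure Omega) (π : Partition T)
    (t : ℝ) (x : EuclideanSpace ℝ (Fin d)) (S : Omega → ℝ) : Prop :=
  ∃ J : {β // IsNAD2 U V P π t β} → Omega → ℝ,
    (∀ β, IsEssSupFam P
      (fun α : {α // IsNAD1 U V P π t α} => P[payoff f g P π t x α.1 β.1 | Fsig (π.idx t)])
      (J β)) ∧
    IsEssInfFam P J S

/-- The lower value function along `π` seen as a random variable. -/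
def lowerVal (f : ℝ → EuclideanSpace ℝ (Fin d) → U → V → EuclideanSpace ℝ (Fin d))
    (g : EuclideanSpace ℝ (Fin d) → ℝ) {T : ℝ} (P : Measure Omega) (π : Partition T)
    (t : ℝ) (x : EuclideanSpace ℝ (Fin d)) : Omega → ℝ :=
  Classical.epsilon (IsLowerVal U V f g P π t x)

/-- The upper value function along `π` seen as a random variable. -/
def upperVal (f : ℝ → EuclideanSpace ℝ (Fin d) → U → V → EuclideanSpace ℝ (Fin d))
    (g : EuclideanSpace ℝ (Fin d) → ℝ) {T : ℝ} (P : Measure Omega) (π : Partition T)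
    (t : ℝ) (x : EuclideanSpace ℝ (Fin d)) : Omega → ℝ :=
  Classical.epsilon (IsUpperVal U V f g P π t x)

/-- The (deterministic) lower value function along `π`: the expectation of `lowerVal`. -/
def lowerValD (f : ℝ → EuclideanSpace ℝ (Fin d) → U → V → EuclideanSpace ℝ (Fin d))
    (g : EuclideanSpace ℝ (Fin d) → ℝ) {T : ℝ} (P : Measure Omega) (π : Partition T)
    (t : ℝ) (x : EuclideanSpace ℝ (Fin d)) : ℝ :=
  ∫ ω, lowerVal U V f g P π t x ω ∂P

/-- The (deterministic) upper value function along `π`: the expectation of `upperVal`. -/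
def upperValD (f : ℝ → EuclideanSpace ℝ (Fin d) → U → V → EuclideanSpace ℝ (Fin d))
    (g : EuclideanSpace ℝ (Fin d) → ℝ) {T : ℝ} (P : Measure Omega) (π : Partition T)
    (t : ℝ) (x : EuclideanSpace ℝ (Fin d)) : ℝ :=
  ∫ ω, upperVal U V f g P π t x ω ∂P

/-! ### The Hamiltonian and viscosity solutions -/

section Hamiltonian

variable (U V : Type) [MetricSpace U] [MetricSpace V] [MeasurableSpace U] [MeasurableSpace V]

/-- `f̃(t,x,μ,ν) = ∫_U ∫_V f(t,x,u,v) μ(du) ν(dv)` for mixed actions `μ ∈ Δ(U)`, `ν ∈ Δ(V)`. -/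
def ftilde (f : ℝ → EuclideanSpace ℝ (Fin d) → U → V → EuclideanSpace ℝ (Fin d))
    (t : ℝ) (x : EuclideanSpace ℝ (Fin d)) (μ : ProbabilityMeasure U) (ν : ProbabilityMeasure V) :
    EuclideanSpace ℝ (Fin d) :=
  ∫ u, ∫ v, f t x u v ∂(ν : Measure V) ∂(μ : Measure U)

/-- The Hamiltonian `sup_{μ ∈ ΔU} inf_{ν ∈ ΔV} f̃(t,x,μ,ν)·p`. -/
def ham (f : ℝ → EuclideanSpace ℝ (Fin d) → U → V → EuclideanSpace ℝ (Fin d))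
    (t : ℝ) (x p : EuclideanSpace ℝ (Fin d)) : ℝ :=
  ⨆ μ : ProbabilityMeasure U, ⨅ ν : ProbabilityMeasure V, ⟪ftilde U V f t x μ ν, p⟫

/-- Viscosity subsolution of `∂_t W + sup_μ inf_ν f̃(t,x,μ,ν)·∇W = 0`, `W(T,·) = g`, on
`[0,T] × ℝ^d`. -/
def IsViscSubsol (f : ℝ → EuclideanSpace ℝ (Fin d) → U → V → EuclideanSpace ℝ (Fin d))
    (g : EuclideanSpace ℝ (Fin d) → ℝ) (T : ℝ) (W : ℝ → EuclideanSpace ℝ (Fin d) → ℝ) : Prop :=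
  (∀ x, W T x ≤ g x) ∧
  ∀ φ : ℝ → EuclideanSpace ℝ (Fin d) → ℝ,
    ContDiff ℝ 1 (fun q : ℝ × EuclideanSpace ℝ (Fin d) => φ q.1 q.2) →
    ∀ t x, t ∈ Ico (0 : ℝ) T →
      IsLocalMaxOn (fun q : ℝ × EuclideanSpace ℝ (Fin d) => W q.1 q.2 - φ q.1 q.2)
        (Icc (0 : ℝ) T ×ˢ univ) (t, x) →
      0 ≤ deriv (fun s => φ s x) t + ham U V f t x (gradient (fun y => φ t y) x)

/-- Viscosity supersolution of `∂_t W + sup_μ inf_ν f̃(t,x,μ,ν)·∇W = 0`, `W(T,·) = g`, on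
`[0,T] × ℝ^d`. -/
def IsViscSupersol (f : ℝ → EuclideanSpace ℝ (Fin d) → U → V → EuclideanSpace ℝ (Fin d))
    (g : EuclideanSpace ℝ (Fin d) → ℝ) (T : ℝ) (W : ℝ → EuclideanSpace ℝ (Fin d) → ℝ) : Prop :=
  (∀ x, g x ≤ W T x) ∧
  ∀ φ : ℝ → EuclideanSpace ℝ (Fin d) → ℝ,
    ContDiff ℝ 1 (fun q : ℝ × EuclideanSpace ℝ (Fin d) => φ q.1 q.2) →
    ∀ t x, t ∈ Ico (0 : ℝ) T →
      IsLocalMinOn (fun q : ℝ × EuclideanSpace ℝ (Fin d) => W q.1 q.2 - φ q.1 q.2)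
        (Icc (0 : ℝ) T ×ˢ univ) (t, x) →
      deriv (fun s => φ s x) t + ham U V f t x (gradient (fun y => φ t y) x) ≤ 0

end Hamiltonian


set_option linter.unusedSectionVars false

/-! ### Values of continuous games in mixed actions -/

section GameValue

variable {A B : Type} [MetricSpace A] [CompactSpace A] [MeasurableSpace A] [BorelSpace A]
  [MetricSpace B] [CompactSpace B] [MeasurableSpace B] [BorelSpace B]

/-- The lower value in mixed actions of the zero-sum game with pay-off `F`. -/
def gval (F : A → B → ℝ) : ℝ :=
  ⨆ μ : ProbabilityMeasure A, ⨅ ν : ProbabilityMeasure B,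
    ∫ a, ∫ b, F a b ∂(ν : Measure B) ∂(μ : Measure A)

theorem integrable_of_continuous_compact {E : Type*} [NormedAddCommGroup E]
    {f : A → E} (hf : Continuous f) (μ : Measure A) [IsFiniteMeasure μ] : Integrable f μ :=
  hf.integrable_of_hasCompactSupport (HasCompactSupport.of_compactSpace f)

theorem exists_bound_of_continuous_uncurry {F : A → B → ℝ}
    (hF : Continuous (Function.uncurry F)) : ∃ C, 0 ≤ C ∧ ∀ a b, |F a b| ≤ C := by
  obtain ⟨C, hC⟩ := isCompact_univ.exists_bound_of_continuousOn hF.continuousOn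
  refine ⟨max C 0, le_max_right _ _, fun a b => ?_⟩
  exact (hC (a, b) (mem_univ _)).trans (le_max_left _ _)

theorem integrable_inner_integral {F : A → B → ℝ} (hF : Continuous (Function.uncurry F))
    (μ : Measure A) [IsProbabilityMeasure μ] (ν : Measure B) [IsProbabilityMeasure ν] :
    Integrable (fun a => ∫ b, F a b ∂ν) μ :=
  (integrable_of_continuous_compact (A := A × B) hF (μ.prod ν)).integral_prod_left

theorem integral_integral_le {F G : A → B → ℝ} (hF : Continuous (Function.uncurry F))
    (hG : Continuous (Function.uncurry G)) {c : ℝ} (h : ∀ a b, F a b ≤ G a b + c)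
    (μ : Measure A) [IsProbabilityMeasure μ] (ν : Measure B) [IsProbabilityMeasure ν] :
    ∫ a, ∫ b, F a b ∂ν ∂μ ≤ ∫ a, ∫ b, G a b ∂ν ∂μ + c := by
  have h1 : ∀ a, ∫ b, F a b ∂ν ≤ ∫ b, G a b ∂ν + c := fun a => by
    have hFa : Integrable (F a) ν := integrable_of_continuous_compact (by fun_prop) ν
    have hGa : Integrable (G a) ν := integrable_of_continuous_compact (by fun_prop) ν
    calc ∫ b, F a b ∂ν ≤ ∫ b, (G a b + c) ∂ν :=
          integral_mono hFa (hGa.add (integrable_const c)) (h a)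
      _ = _ := by rw [integral_add hGa (integrable_const c)]; simp
  calc ∫ a, ∫ b, F a b ∂ν ∂μ ≤ ∫ a, (∫ b, G a b ∂ν + c) ∂μ :=
        integral_mono (integrable_inner_integral hF μ ν)
          ((integrable_inner_integral hG μ ν).add (integrable_const c)) h1
    _ = _ := by
      rw [integral_add (integrable_inner_integral hG μ ν) (integrable_const c)]; simp

theorem abs_integral_integral_le {F : A → B → ℝ} {C : ℝ} (h : ∀ a b, |F a b| ≤ C)
    (μ : Measure A) [IsProbabilityMeasure μ] (ν : Measure B) [IsProbabilityMeasure ν] :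
    |∫ a, ∫ b, F a b ∂ν ∂μ| ≤ C := by
  have h1 : ∀ a, ‖∫ b, F a b ∂ν‖ ≤ C := fun a => by
    simpa using norm_integral_le_of_norm_le_const (μ := ν) (f := F a) (ae_of_all _ (h a))
  simpa using norm_integral_le_of_norm_le_const (μ := μ) (ae_of_all _ h1)

theorem bddBelow_payoff {F : A → B → ℝ} (hF : Continuous (Function.uncurry F))
    (μ : ProbabilityMeasure A) :
    BddBelow (range fun ν : ProbabilityMeasure B =>
      ∫ a, ∫ b, F a b ∂(ν : Measure B) ∂(μ : Measure A)) := by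
  obtain ⟨C, -, hC⟩ := exists_bound_of_continuous_uncurry hF
  refine ⟨-C, ?_⟩
  rintro _ ⟨ν, rfl⟩
  exact (abs_le.1 (abs_integral_integral_le hC _ _)).1

variable [Nonempty A] [Nonempty B]

instance : Nonempty (ProbabilityMeasure A) :=
  ⟨⟨Measure.dirac (Classical.arbitrary A), inferInstance⟩⟩

theorem bddAbove_inf_payoff {F : A → B → ℝ} (hF : Continuous (Function.uncurry F)) :
    BddAbove (range fun μ : ProbabilityMeasure A => ⨅ ν : ProbabilityMeasure B,
      ∫ a, ∫ b, F a b ∂(ν : Measure B) ∂(μ : Measure A)) := by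
  obtain ⟨C, -, hC⟩ := exists_bound_of_continuous_uncurry hF
  refine ⟨C, ?_⟩
  rintro _ ⟨μ, rfl⟩
  exact (ciInf_le (bddBelow_payoff hF μ) (Classical.arbitrary _)).trans
    (abs_le.1 (abs_integral_integral_le hC _ _)).2

theorem le_gval {F : A → B → ℝ} (hF : Continuous (Function.uncurry F)) {c : ℝ}
    (μ : ProbabilityMeasure A)
    (h : ∀ ν : ProbabilityMeasure B, c ≤ ∫ a, ∫ b, F a b ∂(ν : Measure B) ∂(μ : Measure A)) :
    c ≤ gval F :=
  (le_ciInf h).trans (le_ciSup (bddAbove_inf_payoff hF) μ)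

/-- An action that is good against all pure actions of the opponent is good against all mixed
actions. -/
theorem le_gval_of_pure {F : A → B → ℝ} (hF : Continuous (Function.uncurry F)) {c : ℝ}
    (μ : ProbabilityMeasure A) (h : ∀ b, c ≤ ∫ a, F a b ∂(μ : Measure A)) : c ≤ gval F := by
  refine le_gval hF μ fun ν => ?_
  rw [integral_integral_swap (integrable_of_continuous_compact (A := A × B) hF _)]
  have h2 := integral_mono (μ := (ν : Measure B)) (integrable_const c)
    (integrable_inner_integral (F := fun b a => F a b) (hF.comp continuous_swap)
      (ν : Measure B) (μ : Measure A)) h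
  simpa using h2

/-- Nearly optimal mixed actions of the maximizer. -/
theorem exists_lower_optimal {F : A → B → ℝ} (hF : Continuous (Function.uncurry F)) {ε : ℝ}
    (hε : 0 < ε) : ∃ μ : ProbabilityMeasure A, ∀ b, gval F - ε ≤ ∫ a, F a b ∂(μ : Measure A) := by
  obtain ⟨μ, hμ⟩ := exists_lt_of_lt_ciSup (show gval F - ε < gval F by linarith)
  refine ⟨μ, fun b => hμ.le.trans ?_⟩
  refine (ciInf_le (bddBelow_payoff hF μ) ⟨Measure.dirac b, inferInstance⟩).trans ?_
  simp

theorem gval_le_gval_add {F G : A → B → ℝ} (hF : Continuous (Function.uncurry F))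
    (hG : Continuous (Function.uncurry G)) {c : ℝ} (h : ∀ a b, F a b ≤ G a b + c) :
    gval F ≤ gval G + c := by
  refine ciSup_le fun μ => ?_
  rw [← sub_le_iff_le_add]
  refine le_gval hG μ fun ν => ?_
  rw [sub_le_iff_le_add]
  exact (ciInf_le (bddBelow_payoff hF μ) ν).trans (integral_integral_le hF hG h _ _)

theorem abs_gval_sub_le {F G : A → B → ℝ} (hF : Continuous (Function.uncurry F))
    (hG : Continuous (Function.uncurry G)) {c : ℝ} (h : ∀ a b, |F a b - G a b| ≤ c) :
    |gval F - gval G| ≤ c := by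
  rw [abs_le]
  constructor
  · have := gval_le_gval_add hG hF (c := c) fun a b => by
      have := (abs_le.1 (h a b)).1; linarith
    linarith
  · have := gval_le_gval_add hF hG (c := c) fun a b => by
      have := (abs_le.1 (h a b)).2; linarith
    linarith

theorem gval_const_mul (F : A → B → ℝ) {h : ℝ} (hh : 0 ≤ h) :
    gval (fun a b => h * F a b) = h * gval F := by
  simp only [gval, integral_const_mul, Real.mul_iSup_of_nonneg hh, Real.mul_iInf_of_nonneg hh]

theorem exists_finite_net {F : A → B → ℝ} (hF : Continuous (Function.uncurry F)) {ε : ℝ}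
    (hε : 0 < ε) : ∃ s : Finset A, s.Nonempty ∧ ∀ a, ∃ a' ∈ s, ∀ b, |F a b - F a' b| ≤ ε := by
  have hu := CompactSpace.uniformContinuous_of_continuous hF
  obtain ⟨δ, hδ, h⟩ := Metric.uniformContinuous_iff.1 hu ε hε
  obtain ⟨t, -, htf, ht⟩ := (isCompact_univ (X := A)).finite_cover_balls hδ
  refine ⟨htf.toFinset, ?_, fun a => ?_⟩
  · obtain ⟨a', ha', -⟩ := mem_iUnion₂.1 (ht (mem_univ (Classical.arbitrary A)))
    exact ⟨a', by simpa using ha'⟩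
  · obtain ⟨a', ha', haa⟩ := mem_iUnion₂.1 (ht (mem_univ a))
    refine ⟨a', by simpa using ha', fun b => ?_⟩
    have := h (a := (a, b)) (b := (a', b)) (by
      rw [Prod.dist_eq, dist_self]; exact max_lt haa hδ)
    exact (Real.dist_eq _ _ ▸ this).le

/-- The finitely supported probability measure with weights `w`. -/
def finMix (s : Finset A) (w : s → ℝ) (hw : w ∈ stdSimplex ℝ s) : ProbabilityMeasure A :=
  ⟨∑ i : s, ENNReal.ofReal (w i) • Measure.dirac (i : A), ⟨by
    simp only [Measure.coe_finsetSum, Finset.sum_apply, Measure.smul_apply, measure_univ,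
      smul_eq_mul, mul_one]
    rw [← ENNReal.ofReal_sum_of_nonneg fun i _ => hw.1 i, hw.2, ENNReal.ofReal_one]⟩⟩

theorem integral_finMix (s : Finset A) (w : s → ℝ) (hw : w ∈ stdSimplex ℝ s) {φ : A → ℝ}
    (hφ : Continuous φ) : ∫ a, φ a ∂(finMix s w hw : Measure A) = ∑ i : s, w i * φ i := by
  change ∫ a, φ a ∂(∑ i : s, ENNReal.ofReal (w i) • Measure.dirac (i : A)) = _
  rw [integral_finsetSum_measure fun i _ =>
    (integrable_of_continuous_compact hφ _).smul_measure ENNReal.ofReal_ne_top]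
  refine Finset.sum_congr rfl fun i _ => ?_
  rw [integral_smul_measure, integral_dirac, ENNReal.toReal_ofReal (hw.1 i), smul_eq_mul]

/-- Minimax theorem: nearly optimal mixed actions of the minimizer. -/
theorem exists_upper_optimal {F : A → B → ℝ} (hF : Continuous (Function.uncurry F)) {ε : ℝ}
    (hε : 0 < ε) : ∃ ν : ProbabilityMeasure B, ∀ a, ∫ b, F a b ∂(ν : Measure B) ≤ gval F + ε := by
  obtain ⟨s, hs, hsA⟩ := exists_finite_net hF (half_pos hε)
  obtain ⟨t, ht, htB⟩ := exists_finite_net (F := fun b a => F a b) (hF.comp continuous_swap)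
    (half_pos hε)
  have : Nonempty s := hs.to_subtype
  have : Nonempty t := ht.to_subtype
  let M : (t → ℝ) → (s → ℝ) → ℝ := fun x y => ∑ j : t, ∑ i : s, x j * y i * F i j
  have hsimp : ∀ (r : Type) [Fintype r] [Nonempty r], (stdSimplex ℝ r).Nonempty := by
    intro r _ _
    classical
    exact ⟨_, single_mem_stdSimplex ℝ (Classical.arbitrary r)⟩
  obtain ⟨x, hx, y, hy, hxy⟩ := Sion.exists_isSaddlePointOn (X := stdSimplex ℝ t)
    (Y := stdSimplex ℝ s) (f := M) (hsimp _) (convex_stdSimplex ℝ t) (isCompact_stdSimplex ℝ t)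
    (fun y _ => (Continuous.lowerSemicontinuous (by fun_prop)).lowerSemicontinuousOn _)
    (fun y _ => by
      refine ConvexOn.quasiconvexOn ⟨convex_stdSimplex ℝ t, fun p _ q _ a b _ _ _ => le_of_eq ?_⟩
      simp only [M, Pi.add_apply, Pi.smul_apply, smul_eq_mul, Finset.mul_sum,
        ← Finset.sum_add_distrib]
      exact Finset.sum_congr rfl fun _ _ => Finset.sum_congr rfl fun _ _ => by ring)
    (convex_stdSimplex ℝ s) (hsimp _) (isCompact_stdSimplex ℝ s)
    (fun y _ => (Continuous.upperSemicontinuous (by fun_prop)).upperSemicontinuousOn _)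
    (fun y _ => by
      refine ConcaveOn.quasiconcaveOn ⟨convex_stdSimplex ℝ s, fun p _ q _ a b _ _ _ => le_of_eq ?_⟩
      simp only [M, Pi.add_apply, Pi.smul_apply, smul_eq_mul, Finset.mul_sum,
        ← Finset.sum_add_distrib]
      exact Finset.sum_congr rfl fun _ _ => Finset.sum_congr rfl fun _ _ => by ring)
  have hμ : ∀ b, M x y - ε / 2 ≤ ∫ a, F a b ∂(finMix s y hy : Measure A) := by
    intro b
    obtain ⟨b', hb', hbb⟩ := htB b
    have h1 : M x y ≤ ∑ i : s, y i * F i b' := by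
      classical
      have := hxy _ (single_mem_stdSimplex ℝ (⟨b', hb'⟩ : t)) y hy
      simpa [M, Pi.single_apply] using this
    rw [integral_finMix s y hy (by fun_prop)]
    have h2 : ∑ i : s, y i * F i b' ≤ ∑ i : s, (y i * F i b + y i * (ε / 2)) := by
      refine Finset.sum_le_sum fun i _ => ?_
      rw [← mul_add]
      refine mul_le_mul_of_nonneg_left ?_ (hy.1 i)
      have := (abs_le.1 (hbb i)).1
      linarith
    rw [Finset.sum_add_distrib, ← Finset.sum_mul, hy.2] at h2
    linarith
  refine ⟨finMix t x hx, fun a => ?_⟩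
  obtain ⟨a', ha', haa⟩ := hsA a
  have h1 : ∑ j : t, x j * F a' j ≤ M x y := by
    classical
    have := hxy x hx _ (single_mem_stdSimplex ℝ (⟨a', ha'⟩ : s))
    simpa [M, Pi.single_apply] using this
  rw [integral_finMix t x hx (by fun_prop)]
  have h2 : ∑ j : t, x j * F a j ≤ ∑ j : t, (x j * F a' j + x j * (ε / 2)) := by
    refine Finset.sum_le_sum fun i _ => ?_
    rw [← mul_add]
    refine mul_le_mul_of_nonneg_left ?_ (hx.1 i)
    have := (abs_le.1 (haa i)).2
    linarith
  rw [Finset.sum_add_distrib, ← Finset.sum_mul, hx.2] at h2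
  have := le_gval_of_pure hF _ hμ
  linarith

theorem neg_gval_le_gval_swap {F : A → B → ℝ} (hF : Continuous (Function.uncurry F)) :
    - gval F ≤ gval fun (b : B) (a : A) => - F a b := by
  refine le_of_forall_pos_sub_le fun ε hε => ?_
  obtain ⟨ν, hν⟩ := exists_upper_optimal hF hε
  refine le_gval_of_pure (hF.comp continuous_swap).neg ν fun a => ?_
  rw [integral_neg]
  linarith [hν a]

theorem gval_neg_swap {F : A → B → ℝ} (hF : Continuous (Function.uncurry F)) :
    (gval fun (b : B) (a : A) => - F a b) = - gval F := by
  refine le_antisymm ?_ (neg_gval_le_gval_swap hF)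
  have h : Continuous (Function.uncurry fun (b : B) (a : A) => - F a b) :=
    (hF.comp continuous_swap).neg
  refine le_of_forall_pos_le_add fun ε hε => ?_
  obtain ⟨ν, hν⟩ := exists_lower_optimal h (half_pos hε)
  obtain ⟨μ, hμ⟩ := exists_lower_optimal hF (half_pos hε)
  have h1 := integral_mono (μ := (μ : Measure A)) (integrable_const _)
    (integrable_inner_integral hF (μ : Measure A) (ν : Measure B)).neg fun a => by
      have := hν a
      rw [integral_neg] at this
      exact this
  have h2 := integral_mono (μ := (ν : Measure B)) (integrable_const _)
    (integrable_inner_integral (F := fun b a => F a b) (hF.comp continuous_swap)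
      (ν : Measure B) (μ : Measure A)) hμ
  rw [integral_integral_swap (f := fun b a => F a b) (integrable_of_continuous_compact
    (A := B × A) (f := Function.uncurry fun b a => F a b) (hF.comp continuous_swap) _)] at h2
  simp only [integral_const, probReal_univ, one_smul, Pi.neg_apply, integral_neg] at h1 h2
  linarith

end GameValue

/-! ### The Hamiltonian and semiconvex approximation of subsolutions -/

section Hamiltonian

/-- The state space. -/
abbrev Euc (d : ℕ) : Type := EuclideanSpace ℝ (Fin d)

variable {d : ℕ} {A B : Type} [MetricSpace A] [CompactSpace A] [MeasurableSpace A] [BorelSpace A]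
  [MetricSpace B] [CompactSpace B] [MeasurableSpace B] [BorelSpace B]
  [Nonempty A] [Nonempty B]

/-- The standing assumptions on the dynamics. -/
structure Dyn (f : ℝ → Euc d → A → B → Euc d) (T C : ℝ) (K : ℝ≥0) : Prop where
  pos : 0 < T
  bdd : ∀ t x a b, ‖f t x a b‖ ≤ C
  cont : ContinuousOn (fun q : ℝ × Euc d × A × B => f q.1 q.2.1 q.2.2.1 q.2.2.2)
      (Icc (0 : ℝ) T ×ˢ univ)
  lip : ∀ t a b, LipschitzWith K fun x => f t x a b

variable {f : ℝ → Euc d → A → B → Euc d} {T C : ℝ} {K : ℝ≥0}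

theorem Dyn.swap (hf : Dyn f T C K) : Dyn (fun t x b a => f t x a b) T C K where
  pos := hf.pos
  bdd t x b a := hf.bdd t x a b
  cont := hf.cont.comp (f := fun q : ℝ × Euc d × B × A => (q.1, q.2.1, q.2.2.2, q.2.2.1))
    (Continuous.continuousOn (by fun_prop)) fun q hq => ⟨hq.1, mem_univ _⟩
  lip t b a := hf.lip t a b

theorem Dyn.nonneg (hf : Dyn f T C K) : 0 ≤ C :=
  (norm_nonneg _).trans
    (hf.bdd 0 0 (Classical.arbitrary A) (Classical.arbitrary B))

theorem Dyn.norm_sub_le (hf : Dyn f T C K) (t : ℝ) (x y : Euc d) (a : A) (b : B) :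
    ‖f t x a b - f t y a b‖ ≤ K * ‖x - y‖ := by
  simpa [dist_eq_norm] using (hf.lip t a b).dist_le_mul x y

theorem Dyn.continuous_actions (hf : Dyn f T C K) {t : ℝ} (ht : t ∈ Icc 0 T) (x : Euc d) :
    Continuous fun q : A × B => f t x q.1 q.2 := by
  have h := hf.cont.comp (f := fun q : A × B => (t, x, q.1, q.2)) (s := univ)
    (Continuous.continuousOn (by fun_prop)) fun q _ => ⟨ht, mem_univ _⟩
  exact continuousOn_univ.1 h

theorem Dyn.continuous_inner (hf : Dyn f T C K) {t : ℝ} (ht : t ∈ Icc 0 T) (x p : Euc d) :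
    Continuous (Function.uncurry fun a b => ⟪f t x a b, p⟫) :=
  (hf.continuous_actions ht x).inner continuous_const

theorem ham_eq_gval (hf : Dyn f T C K) {t : ℝ} (ht : t ∈ Icc 0 T) (x p : Euc d) :
    ham A B f t x p = gval fun a b => ⟪f t x a b, p⟫ := by
  have hc := hf.continuous_actions ht x
  unfold ham gval ftilde
  refine congrArg _ (funext fun μ => congrArg _ (funext fun ν => ?_))
  have h1 : ∀ a, Integrable (fun b => f t x a b) (ν : Measure B) := fun a =>
    integrable_of_continuous_compact (by fun_prop) _
  have h2 : Integrable (fun a => ∫ b, f t x a b ∂(ν : Measure B)) (μ : Measure A) :=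
    (integrable_of_continuous_compact (A := A × B) hc
      ((μ : Measure A).prod (ν : Measure B))).integral_prod_left
  rw [real_inner_comm, ← integral_inner h2]
  refine integral_congr_ae (ae_of_all _ fun a => ?_)
  simp only
  rw [← integral_inner (h1 a)]
  exact integral_congr_ae (ae_of_all _ fun b => real_inner_comm _ _)

theorem ham_swap (hf : Dyn f T C K) {t : ℝ} (ht : t ∈ Icc 0 T) (x p : Euc d) :
    ham B A (fun t x b a => f t x a b) t x p = - ham A B f t x (-p) := by
  rw [ham_eq_gval hf ht, ham_eq_gval hf.swap ht, ← gval_neg_swap (hf.continuous_inner ht x _)]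
  simp only [inner_neg_right, neg_neg]

/-- Continuity of the dynamics in time, uniformly in the actions and locally uniformly in the
state. -/
theorem Dyn.exists_time_modulus (hf : Dyn f T C K) (R : ℝ) {κ : ℝ} (hκ : 0 < κ) :
    ∃ θ > 0, ∀ t ∈ Icc 0 T, ∀ t' ∈ Icc 0 T, |t - t'| < θ → ∀ x, ‖x‖ ≤ R → ∀ a b,
      ‖f t x a b - f t' x a b‖ ≤ κ := by
  have hcpt : IsCompact (Icc (0 : ℝ) T ×ˢ (Metric.closedBall (0 : Euc d) R ×ˢ
      (univ : Set (A × B)))) :=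
    isCompact_Icc.prod ((isCompact_closedBall _ _).prod isCompact_univ)
  have hu := hcpt.uniformContinuousOn_of_continuous
    (hf.cont.mono (prod_mono subset_rfl (subset_univ _)))
  obtain ⟨θ, hθ, h⟩ := Metric.uniformContinuousOn_iff.1 hu κ hκ
  refine ⟨θ, hθ, fun t ht t' ht' htt x hx a b => ?_⟩
  have := h (t, x, a, b) ⟨ht, by simpa using hx, mem_univ _⟩ (t', x, a, b)
    ⟨ht', by simpa using hx, mem_univ _⟩ (by
      rw [Prod.dist_eq, dist_self, Real.dist_eq]; exact max_lt htt hθ)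
  rw [dist_eq_norm] at this
  exact this.le

theorem abs_ham_sub_le (hf : Dyn f T C K) {t t' : ℝ} (ht : t ∈ Icc 0 T) (ht' : t' ∈ Icc 0 T)
    (x x' p : Euc d) {c : ℝ} (h : ∀ a b, ‖f t x a b - f t' x' a b‖ ≤ c) :
    |ham A B f t x p - ham A B f t' x' p| ≤ c * ‖p‖ := by
  rw [ham_eq_gval hf ht, ham_eq_gval hf ht']
  refine abs_gval_sub_le (hf.continuous_inner ht x p) (hf.continuous_inner ht' x' p) fun a b => ?_
  rw [← inner_sub_left]
  exact (abs_real_inner_le_norm _ _).trans (mul_le_mul_of_nonneg_right (h a b) (norm_nonneg _))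

/-- The supersolution property is the subsolution property of the game with exchanged players. -/
theorem IsViscSupersol.neg_swap (hf : Dyn f T C K) {g : Euc d → ℝ} {W : ℝ → Euc d → ℝ}
    (hW : IsViscSupersol A B f g T W) :
    IsViscSubsol B A (fun t x b a => f t x a b) (fun x => - g x) T (fun t x => - W t x) := by
  refine ⟨fun x => neg_le_neg (hW.1 x), fun φ hφ t x ht hmax => ?_⟩
  have h := hW.2 (fun t x => - φ t x) hφ.neg t x ht (by
    filter_upwards [hmax] with q hq
    simp only [sub_neg_eq_add] at hq ⊢
    linarith)
  rw [ham_swap hf ⟨ht.1, ht.2.le⟩]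
  have hg : gradient (fun y => - φ t y) x = - gradient (fun y => φ t y) x := by
    simp only [gradient]
    rw [← map_neg]
    congr 1
    exact fderiv_fun_neg
  have hd : deriv (fun s => - φ s x) t = - deriv (fun s => φ s x) t := deriv.fun_neg
  rw [hg, hd] at h
  linarith

theorem exists_maximizer {W : ℝ → Euc d → ℝ}
    (hWc : ContinuousOn (fun q : ℝ × Euc d => W q.1 q.2) (Icc (0 : ℝ) T ×ˢ univ))
    {M : ℝ} (hWM : ∀ t ∈ Icc (0 : ℝ) T, ∀ x, |W t x| ≤ M) {r δ : ℝ} (hr : 0 < r)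
    (hδ : 0 < δ) (hM : 0 < M) {t : ℝ} (ht : t ∈ Icc 0 T) (x : Euc d) :
    ∃ s ∈ Icc 0 T, ∃ y, ∀ s' ∈ Icc 0 T, ∀ y',
      W s' y' - (t - s') ^ 2 / (2 * δ) - ‖x - y'‖ ^ 2 / (2 * (r ^ 2 / (4 * M))) ≤
        W s y - (t - s) ^ 2 / (2 * δ) - ‖x - y‖ ^ 2 / (2 * (r ^ 2 / (4 * M))) := by
  have hcpt : IsCompact (Icc (0 : ℝ) T ×ˢ Metric.closedBall x r) :=
    isCompact_Icc.prod (isCompact_closedBall _ _)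
  obtain ⟨⟨s, y⟩, hsy, hmax⟩ := hcpt.exists_isMaxOn
    ⟨(t, x), ht, Metric.mem_closedBall_self hr.le⟩
    (f := fun q : ℝ × Euc d => W q.1 q.2 - (t - q.1) ^ 2 / (2 * δ) -
      ‖x - q.2‖ ^ 2 / (2 * (r ^ 2 / (4 * M))))
    (((hWc.mono (prod_mono subset_rfl (subset_univ _))).sub
      (Continuous.continuousOn (by fun_prop))).sub (Continuous.continuousOn (by fun_prop)))
  refine ⟨s, hsy.1, y, fun s' hs' y' => ?_⟩
  by_cases hy : ‖x - y'‖ ≤ r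
  · exact hmax (show (s', y') ∈ _ from ⟨hs', by rwa [mem_closedBall_iff_norm, norm_sub_rev]⟩)
  · have h1 := hmax (show (t, x) ∈ _ from ⟨ht, Metric.mem_closedBall_self hr.le⟩)
    simp only [mem_ofPred_eq, sub_self, norm_zero] at h1
    refine le_trans ?_ h1
    have h2 : 2 * M ≤ ‖x - y'‖ ^ 2 / (2 * (r ^ 2 / (4 * M))) := by
      rw [le_div_iff₀ (by positivity)]
      have : 2 * M * (2 * (r ^ 2 / (4 * M))) = r ^ 2 := by field_simp; ring
      rw [this]
      push Not at hy
      exact pow_le_pow_left₀ hr.le hy.le 2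
    have h3 := (abs_le.1 (hWM s' hs' y')).2
    have h4 := (abs_le.1 (hWM t ht x)).1
    have h5 : 0 ≤ (t - s') ^ 2 / (2 * δ) := by positivity
    norm_num
    linarith

theorem gradient_quadratic (c ε : ℝ) (x y : Euc d) :
    gradient (fun y' : Euc d => c + ‖x - y'‖ ^ 2 / (2 * ε)) y = ε⁻¹ • (y - x) := by
  have h1 : HasFDerivAt (fun y' : Euc d => ‖x - y'‖ ^ 2)
      (2 • (innerSL ℝ (x - y)).comp (-(ContinuousLinearMap.id ℝ (Euc d)))) y :=
    ((hasFDerivAt_id y).const_sub x).norm_sq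
  have h2 : HasGradientAt (fun y' : Euc d => c + ‖x - y'‖ ^ 2 / (2 * ε)) (ε⁻¹ • (y - x)) y := by
    rw [hasGradientAt_iff_hasFDerivAt]
    refine ((h1.mul_const (2 * ε)⁻¹).const_add c).congr_fderiv ?_
    ext v
    simp
    ring
  exact h2.gradient

theorem deriv_quadratic (c δ t s : ℝ) :
    deriv (fun s' : ℝ => (t - s') ^ 2 / (2 * δ) + c) s = (s - t) / δ := by
  have h1 : HasDerivAt (fun s' : ℝ => (t - s') ^ 2 / (2 * δ) + c)
      ((2 * (t - s) ^ (2 - 1) * (-1)) / (2 * δ)) s := by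
    have := ((((hasDerivAt_id s).const_sub t).pow 2).div_const (2 * δ)).add_const c
    simpa using this
  rw [h1.deriv]
  have : (2 * (t - s) ^ (2 - 1) * (-1)) = 2 * (s - t) := by norm_num; ring
  rw [this, mul_div_mul_left _ _ two_ne_zero]

theorem norm_sub_sq_expand (x y x' : Euc d) (ε : ℝ) :
    ‖x' - y‖ ^ 2 / (2 * ε) = ‖x - y‖ ^ 2 / (2 * ε) - ⟪ε⁻¹ • (y - x), x' - x⟫
      + ‖x' - x‖ ^ 2 / (2 * ε) := by
  have : x' - y = (x - y) + (x' - x) := by abel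
  rw [this, norm_add_sq_real, inner_smul_left]
  have h : ⟪y - x, x' - x⟫ = - ⟪x - y, x' - x⟫ := by rw [← inner_neg_left, neg_sub]
  rw [h]
  simp
  ring

/-- Approximation of a subsolution from above by a function that has, at each point, a quadratic
lower tangent whose slope satisfies the subsolution inequality up to a small error. -/
theorem exists_semiconvex_approx (hf : Dyn f T C K) {g : Euc d → ℝ} {W : ℝ → Euc d → ℝ}
    (hWc : ContinuousOn (fun q : ℝ × Euc d => W q.1 q.2) (Icc (0 : ℝ) T ×ˢ univ))
    {M : ℝ} (hM : 0 < M) (hWM : ∀ t ∈ Icc (0 : ℝ) T, ∀ x, |W t x| ≤ M)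
    (hW : IsViscSubsol A B f g T W) (R : ℝ) {κ : ℝ} (hκ : 0 < κ) :
    ∃ (Z : ℝ → Euc d → ℝ) (Λ η : ℝ), 0 < Λ ∧ 0 < η ∧ η ≤ κ ∧
      (∀ t ∈ Icc 0 T, ∀ x, W t x ≤ Z t x ∧ Z t x ≤ M) ∧
      (∀ t ∈ Icc 0 T, T - η ≤ t → ∀ x, ‖x‖ ≤ R → Z t x ≤ g x + κ) ∧
      (∀ t ∈ Icc 0 T, ∀ x, ∃ (q : ℝ) (p : Euc d), |q| ≤ Λ ∧ ‖p‖ ≤ Λ ∧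
        (∀ t' ∈ Icc 0 T, ∀ x', Z t x + q * (t' - t) + ⟪p, x' - x⟫
          - Λ * ((t' - t) ^ 2 + ‖x' - x‖ ^ 2) ≤ Z t' x') ∧
        (t < T - η → ‖x‖ ≤ R → -κ ≤ q + ham A B f t x p)) := by
  have hcpt : IsCompact (Icc (0 : ℝ) T ×ˢ Metric.closedBall (0 : Euc d) (R + 1)) :=
    isCompact_Icc.prod (isCompact_closedBall _ _)
  have hu := hcpt.uniformContinuousOn_of_continuous
    (hWc.mono (prod_mono subset_rfl (subset_univ _)))
  have hκ1 : 0 < κ / (4 * (K + 1)) := by positivity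
  obtain ⟨θ, hθ, hWθ⟩ := Metric.uniformContinuousOn_iff.1 hu _ hκ1
  obtain ⟨r, hr, hrθ, hr1⟩ : ∃ r : ℝ, 0 < r ∧ r < θ ∧ r ≤ 1 :=
    ⟨min (θ / 2) 1, by positivity, (min_le_left _ _).trans_lt (by linarith), min_le_right _ _⟩
  set ε := r ^ 2 / (4 * M) with hε
  have hε0 : 0 < ε := by positivity
  obtain ⟨θ', hθ', hfθ⟩ := hf.exists_time_modulus R
    (show 0 < κ / (2 * (r / ε + 1)) by positivity)
  obtain ⟨ρ, hρ, hρθ, hρθ', hρκ⟩ : ∃ ρ : ℝ, 0 < ρ ∧ 2 * ρ < θ ∧ ρ < θ' ∧ ρ ≤ κ := by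
    refine ⟨min (min (θ / 4) (θ' / 2)) κ, by positivity, ?_, ?_, min_le_right _ _⟩
    · have : min (min (θ / 4) (θ' / 2)) κ ≤ θ / 4 := (min_le_left _ _).trans (min_le_left _ _)
      linarith
    · have : min (min (θ / 4) (θ' / 2)) κ ≤ θ' / 2 := (min_le_left _ _).trans (min_le_right _ _)
      linarith
  set δ := ρ ^ 2 / (4 * M) with hδ
  have hδ0 : 0 < δ := by positivity
  have hex : ∀ t x, ∃ s y, t ∈ Icc 0 T → (s ∈ Icc 0 T ∧ ∀ s' ∈ Icc 0 T, ∀ y',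
      W s' y' - (t - s') ^ 2 / (2 * δ) - ‖x - y'‖ ^ 2 / (2 * ε) ≤
        W s y - (t - s) ^ 2 / (2 * δ) - ‖x - y‖ ^ 2 / (2 * ε)) := by
    intro t x
    by_cases ht : t ∈ Icc 0 T
    · obtain ⟨s, hs, y, h⟩ := exists_maximizer hWc hWM hr hδ0 hM ht x
      exact ⟨s, y, fun _ => ⟨hs, h⟩⟩
    · exact ⟨0, 0, fun h => absurd h ht⟩
  choose S Y hSY using hex
  -- elementary bounds
  have hle : ∀ t ∈ Icc 0 T, ∀ x,
      W t x ≤ W (S t x) (Y t x) - (t - S t x) ^ 2 / (2 * δ) - ‖x - Y t x‖ ^ 2 / (2 * ε) := by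
    intro t ht x
    simpa using (hSY t x ht).2 t ht x
  have hb : ∀ t ∈ Icc 0 T, ∀ x, |t - S t x| ≤ ρ ∧ ‖x - Y t x‖ ≤ r := by
    intro t ht x
    have h1 := hle t ht x
    have h2 := (abs_le.1 (hWM t ht x)).1
    have h3 := (abs_le.1 (hWM _ (hSY t x ht).1 (Y t x))).2
    have h4 : 0 ≤ (t - S t x) ^ 2 / (2 * δ) := by positivity
    have h5 : 0 ≤ ‖x - Y t x‖ ^ 2 / (2 * ε) := by positivity
    constructor
    · have h6 : (t - S t x) ^ 2 / (2 * δ) ≤ 2 * M := by linarith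
      rw [div_le_iff₀ (by positivity)] at h6
      have : 2 * M * (2 * δ) = ρ ^ 2 := by rw [hδ]; field_simp; ring
      rw [this] at h6
      exact abs_le_of_sq_le_sq h6 hρ.le
    · have h6 : ‖x - Y t x‖ ^ 2 / (2 * ε) ≤ 2 * M := by linarith
      rw [div_le_iff₀ (by positivity)] at h6
      have : 2 * M * (2 * ε) = r ^ 2 := by rw [hε]; field_simp; ring
      rw [this] at h6
      exact (sq_le_sq₀ (norm_nonneg _) hr.le).1 h6
  have hYball : ∀ t ∈ Icc 0 T, ∀ x, ‖x‖ ≤ R → ‖Y t x‖ ≤ R + 1 := by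
    intro t ht x hx
    have h1 := (hb t ht x).2
    have h2 := norm_sub_norm_le (Y t x) x
    rw [norm_sub_rev] at h2
    linarith
  refine ⟨fun t x => W (S t x) (Y t x) - (t - S t x) ^ 2 / (2 * δ) - ‖x - Y t x‖ ^ 2 / (2 * ε),
    r / ε + ρ / δ + (2 * ε)⁻¹ + (2 * δ)⁻¹, ρ, by positivity, hρ, hρκ, ?_, ?_, ?_⟩
  · intro t ht x
    refine ⟨hle t ht x, ?_⟩
    have h3 := (abs_le.1 (hWM _ (hSY t x ht).1 (Y t x))).2
    have h4 : 0 ≤ (t - S t x) ^ 2 / (2 * δ) := by positivity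
    have h5 : 0 ≤ ‖x - Y t x‖ ^ 2 / (2 * ε) := by positivity
    linarith
  · intro t ht hTt x hx
    have h4 : 0 ≤ (t - S t x) ^ 2 / (2 * δ) := by positivity
    have h5 : 0 ≤ ‖x - Y t x‖ ^ 2 / (2 * ε) := by positivity
    obtain ⟨h6, h7⟩ := hb t ht x
    have h8 := hWθ (S t x, Y t x) ⟨(hSY t x ht).1, by simpa using hYball t ht x hx⟩ (T, x)
      ⟨⟨hf.pos.le, le_rfl⟩, by simp; linarith⟩ (by
        rw [Prod.dist_eq]
        refine max_lt ?_ ?_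
        · have := (hSY t x ht).1.2
          rw [Real.dist_eq, abs_lt]
          have := (abs_le.1 h6)
          constructor <;> linarith
        · rw [dist_eq_norm, norm_sub_rev]; linarith)
    rw [Real.dist_eq] at h8
    have h9 := (abs_lt.1 h8).2
    have h10 : κ / (4 * (K + 1)) ≤ κ := div_le_self hκ.le (by
      have : (0 : ℝ) ≤ K := K.2
      linarith)
    have := hW.1 x
    simp only at h9
    linarith
  · intro t ht x
    obtain ⟨h6, h7⟩ := hb t ht x
    have hp : ‖ε⁻¹ • (Y t x - x)‖ = ‖x - Y t x‖ / ε := by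
      rw [norm_smul, norm_sub_rev, Real.norm_of_nonneg (by positivity)]; ring
    have hpr : ‖ε⁻¹ • (Y t x - x)‖ ≤ r / ε := by
      rw [hp]; gcongr
    refine ⟨(S t x - t) / δ, ε⁻¹ • (Y t x - x), ?_, ?_, ?_, ?_⟩
    · rw [abs_div, abs_of_pos hδ0, abs_sub_comm]
      have : |t - S t x| / δ ≤ ρ / δ := by gcongr
      have : 0 < r / ε + (2 * ε)⁻¹ + (2 * δ)⁻¹ := by positivity
      linarith
    · have : 0 < ρ / δ + (2 * ε)⁻¹ + (2 * δ)⁻¹ := by positivity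
      linarith
    · intro t' ht' x'
      refine le_trans ?_ ((hSY t' x' ht').2 (S t x) (hSY t x ht).1 (Y t x))
      rw [norm_sub_sq_expand x (Y t x) x' ε]
      have e1 : (t' - S t x) ^ 2 / (2 * δ) = (t - S t x) ^ 2 / (2 * δ)
          - (S t x - t) / δ * (t' - t) + (t' - t) ^ 2 / (2 * δ) := by
        field_simp; ring
      rw [e1]
      have e2 : (t' - t) ^ 2 / (2 * δ) + ‖x' - x‖ ^ 2 / (2 * ε) ≤
          (r / ε + ρ / δ + (2 * ε)⁻¹ + (2 * δ)⁻¹) * ((t' - t) ^ 2 + ‖x' - x‖ ^ 2) := by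
        rw [mul_add]
        have a1 : (t' - t) ^ 2 / (2 * δ) ≤
            (r / ε + ρ / δ + (2 * ε)⁻¹ + (2 * δ)⁻¹) * (t' - t) ^ 2 := by
          rw [div_eq_inv_mul]
          refine mul_le_mul_of_nonneg_right ?_ (by positivity)
          have : 0 < r / ε + ρ / δ + (2 * ε)⁻¹ := by positivity
          linarith
        have a2 : ‖x' - x‖ ^ 2 / (2 * ε) ≤
            (r / ε + ρ / δ + (2 * ε)⁻¹ + (2 * δ)⁻¹) * ‖x' - x‖ ^ 2 := by
          rw [div_eq_inv_mul]
          refine mul_le_mul_of_nonneg_right ?_ (by positivity)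
          have : 0 < r / ε + ρ / δ + (2 * δ)⁻¹ := by positivity
          linarith
        linarith
      linarith
    · intro htη hx
      have hsT : S t x < T := by
        have := (abs_le.1 h6).1
        linarith
      have hv := hW.2 (fun s' y' => (t - s') ^ 2 / (2 * δ) + ‖x - y'‖ ^ 2 / (2 * ε)) (by
          have h1 : ContDiff ℝ 1 fun q : ℝ × Euc d => ‖x - q.2‖ ^ 2 :=
            (contDiff_const.sub contDiff_snd).norm_sq ℝ
          have h2 : ContDiff ℝ 1 fun q : ℝ × Euc d => (t - q.1) ^ 2 := by fun_prop
          exact (h2.div_const _).add (h1.div_const _)) (S t x) (Y t x)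
        ⟨(hSY t x ht).1.1, hsT⟩ (by
          refine IsMaxOn.localize fun q hq => ?_
          have := (hSY t x ht).2 q.1 hq.1 q.2
          simp only [mem_ofPred_eq]
          linarith)
      rw [deriv_quadratic, gradient_quadratic] at hv
      have hmod : ∀ a b, ‖f t x a b - f (S t x) (Y t x) a b‖ ≤
          κ / (2 * (r / ε + 1)) + K * ‖x - Y t x‖ := by
        intro a b
        have e1 := hfθ t ht (S t x) (hSY t x ht).1 (h6.trans_lt hρθ') x hx a b
        have e2 := hf.norm_sub_le (S t x) x (Y t x) a b
        have e3 := norm_add_le (f t x a b - f (S t x) x a b)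
          (f (S t x) x a b - f (S t x) (Y t x) a b)
        rw [sub_add_sub_cancel] at e3
        linarith
      have hH := abs_ham_sub_le hf ht (hSY t x ht).1 x (Y t x) (ε⁻¹ • (Y t x - x)) hmod
      have hH' := (abs_le.1 hH).1
      have b1 : κ / (2 * (r / ε + 1)) * ‖ε⁻¹ • (Y t x - x)‖ ≤ κ / 2 := by
        calc κ / (2 * (r / ε + 1)) * ‖ε⁻¹ • (Y t x - x)‖ ≤ κ / (2 * (r / ε + 1)) * (r / ε + 1) := by
              gcongr; linarith
          _ = κ / 2 := by field_simp
      have b2 : K * ‖x - Y t x‖ * ‖ε⁻¹ • (Y t x - x)‖ ≤ κ / 2 := by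
        have c1 := hWθ (S t x, Y t x) ⟨(hSY t x ht).1, by simpa using hYball t ht x hx⟩ (t, x)
          ⟨ht, by simp; linarith⟩ (by
            rw [Prod.dist_eq]
            refine max_lt ?_ ?_
            · rw [Real.dist_eq, abs_sub_comm]; linarith
            · rw [dist_eq_norm, norm_sub_rev]; linarith)
        rw [Real.dist_eq] at c1
        have c2 := (abs_lt.1 c1).2
        simp only at c2
        have c3 := hle t ht x
        have h4 : 0 ≤ (t - S t x) ^ 2 / (2 * δ) := by positivity
        have c4 : ‖x - Y t x‖ * (‖x - Y t x‖ / ε) ≤ 2 * (κ / (4 * (K + 1))) := by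
          have : ‖x - Y t x‖ * (‖x - Y t x‖ / ε) = 2 * (‖x - Y t x‖ ^ 2 / (2 * ε)) := by
            field_simp
          rw [this]
          linarith
        rw [hp, mul_assoc]
        calc (K : ℝ) * (‖x - Y t x‖ * (‖x - Y t x‖ / ε)) ≤ (K + 1) * (2 * (κ / (4 * (K + 1)))) := by
              gcongr
              linarith
          _ = κ / 2 := by
            have : (0 : ℝ) ≤ K := K.2
            field_simp
            norm_num
      rw [add_mul] at hH'
      linarith

end Hamiltonian

/-! ### Solutions of the controlled equation -/

section Picard

variable {E : Type*} [NormedAddCommGroup E] [NormedSpace ℝ E] [CompleteSpace E]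
  [MeasurableSpace E] [BorelSpace E] [SecondCountableTopology E]

/-- Picard iterates for a bounded measurable time-dependent vector field. -/
def picard (Φ : ℝ → E → E) (t : ℝ) (x : E) : ℕ → ℝ → E
  | 0, _ => x
  | m + 1, s => x + ∫ r in Ioc t s, Φ r (picard Φ t x m r)

/-- The limit of the Picard iterates. -/
def picardLim (Φ : ℝ → E → E) (t : ℝ) (x : E) (s : ℝ) : E :=
  limUnder atTop fun m => picard Φ t x m s

theorem measurable_picard {Ω : Type*} [MeasurableSpace Ω] {Φ : Ω → ℝ → E → E}
    (hΦ : Measurable fun q : Ω × ℝ × E => Φ q.1 q.2.1 q.2.2) (t : ℝ) (x : E) (m : ℕ) :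
    Measurable fun q : Ω × ℝ => picard (Φ q.1) t x m q.2 := by
  induction m with
  | zero => exact measurable_const
  | succ m ih =>
    have h1 : Measurable fun p : (Ω × ℝ) × ℝ => Φ p.1.1 p.2 (picard (Φ p.1.1) t x m p.2) := by
      have h2 : Measurable fun p : (Ω × ℝ) × ℝ => picard (Φ p.1.1) t x m p.2 :=
        ih.comp (f := fun p : (Ω × ℝ) × ℝ => (p.1.1, p.2)) (by fun_prop)
      exact hΦ.comp ((measurable_fst.comp measurable_fst).prodMk (measurable_snd.prodMk h2))
    have hS : MeasurableSet {p : (Ω × ℝ) × ℝ | p.2 ∈ Ioc t p.1.2} :=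
      (measurableSet_lt measurable_const measurable_snd).inter
        (measurableSet_le measurable_snd (measurable_snd.comp measurable_fst))
    have h3 := (h1.indicator hS).stronglyMeasurable.integral_prod_right' (ν := (volume : Measure ℝ))
    have h4 : (fun q : Ω × ℝ => picard (Φ q.1) t x (m + 1) q.2) = fun q : Ω × ℝ =>
        x + ∫ r, {p : (Ω × ℝ) × ℝ | p.2 ∈ Ioc t p.1.2}.indicator
          (fun p : (Ω × ℝ) × ℝ => Φ p.1.1 p.2 (picard (Φ p.1.1) t x m p.2)) (q, r) := by
      ext q
      simp only [picard]
      rw [← integral_indicator measurableSet_Ioc]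
      rfl
    rw [h4]
    exact measurable_const.add h3.measurable

theorem measurable_picard_of_measurable {Φ : ℝ → E → E} (hΦ : Measurable (Function.uncurry Φ))
    (t : ℝ) (x : E) (m : ℕ) : Measurable (picard Φ t x m) :=
  (measurable_picard (Ω := Unit) (Φ := fun _ => Φ)
    (hΦ.comp measurable_snd) t x m).comp (f := fun s => ((), s)) (by fun_prop)

theorem setIntegral_exp_le {t s c : ℝ} (hts : t ≤ s) (hc : 0 < c) :
    ∫ r in Ioc t s, Real.exp (c * (r - t)) ≤ c⁻¹ * Real.exp (c * (s - t)) := by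
  rw [← intervalIntegral.integral_of_le hts]
  have h : ∀ r ∈ uIcc t s, HasDerivAt (fun r => c⁻¹ * Real.exp (c * (r - t)))
      (Real.exp (c * (r - t))) r := by
    intro r _
    have h1 : HasDerivAt (fun r => c * (r - t)) c r := by
      simpa using ((hasDerivAt_id r).sub_const t).const_mul c
    have h2 := (h1.exp).const_mul c⁻¹
    refine h2.congr_deriv ?_
    rw [mul_comm (Real.exp _), inv_mul_cancel_left₀ hc.ne']
  rw [intervalIntegral.integral_eq_sub_of_hasDerivAt h
    (Continuous.intervalIntegrable (by fun_prop) _ _)]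
  have : 0 < c⁻¹ * Real.exp (c * (t - t)) := by positivity
  linarith

variable {Φ : ℝ → E → E} {C : ℝ} {K : ℝ≥0}

theorem integrableOn_comp (hΦ : Measurable (Function.uncurry Φ)) (hC : ∀ r y, ‖Φ r y‖ ≤ C)
    {X : ℝ → E} (hX : Measurable X) (t s : ℝ) : IntegrableOn (fun r => Φ r (X r)) (Ioc t s) := by
  refine Measure.integrableOn_of_bounded (M := C) (by simp)
    (hΦ.comp (measurable_id.prodMk hX)).aestronglyMeasurable (ae_of_all _ fun r => hC _ _)

theorem norm_picard_succ_sub_le (hΦ : Measurable (Function.uncurry Φ))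
    (hC : ∀ r y, ‖Φ r y‖ ≤ C) (hK : ∀ r, LipschitzWith K (Φ r)) {t T : ℝ} (x : E) (m : ℕ) :
    ∀ s ∈ Icc t T, ‖picard Φ t x (m + 1) s - picard Φ t x m s‖ ≤
      C * (T - t) * Real.exp (2 * (K + 1) * (s - t)) * (1 / 2) ^ m := by
  have hC0 : 0 ≤ C := (norm_nonneg _).trans (hC 0 0)
  induction m with
  | zero =>
    intro s hs
    simp only [picard, add_sub_cancel_left, pow_zero, mul_one]
    have h1 : ‖∫ r in Ioc t s, Φ r x‖ ≤ C * (s - t) := by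
      have := norm_setIntegral_le_of_norm_le_const (μ := volume) (s := Ioc t s) (C := C)
        (f := fun r => Φ r x) (by simp) (fun r _ => hC r x)
      simpa [Measure.real, Real.volume_Ioc, hs.1] using this
    have h2 : 1 ≤ Real.exp (2 * (K + 1) * (s - t)) := by
      rw [Real.one_le_exp_iff]
      have : 0 ≤ s - t := by linarith [hs.1]
      positivity
    have h3 : C * (s - t) ≤ C * (T - t) := by gcongr; exact hs.2
    have h4 : 0 ≤ C * (T - t) := mul_nonneg hC0 (by linarith [hs.1, hs.2])
    nlinarith
  | succ m ih =>
    intro s hs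
    have hi : ∀ k, IntegrableOn (fun r => Φ r (picard Φ t x k r)) (Ioc t s) := fun k =>
      integrableOn_comp hΦ hC (measurable_picard_of_measurable hΦ t x k) t s
    have h0 : picard Φ t x (m + 1 + 1) s - picard Φ t x (m + 1) s =
        ∫ r in Ioc t s, (Φ r (picard Φ t x (m + 1) r) - Φ r (picard Φ t x m r)) := by
      rw [integral_sub (hi _) (hi _)]
      change (x + _) - (x + _) = _
      rw [add_sub_add_left_eq_sub]
    rw [h0]
    have h1 : ‖∫ r in Ioc t s, (Φ r (picard Φ t x (m + 1) r) - Φ r (picard Φ t x m r))‖ ≤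
        ∫ r in Ioc t s, K * (C * (T - t) * (1 / 2) ^ m) * Real.exp (2 * (K + 1) * (r - t)) := by
      refine norm_integral_le_of_norm_le ?_ ?_
      · exact (Continuous.integrableOn_Ioc (by fun_prop))
      · refine (ae_restrict_iff' measurableSet_Ioc).2 (ae_of_all _ fun r hr => ?_)
        have h2 := (hK r).dist_le_mul (picard Φ t x (m + 1) r) (picard Φ t x m r)
        rw [dist_eq_norm, dist_eq_norm] at h2
        have h3 := ih r ⟨hr.1.le, hr.2.trans hs.2⟩
        calc _ ≤ _ := h2
          _ ≤ K * (C * (T - t) * Real.exp (2 * (K + 1) * (r - t)) * (1 / 2) ^ m) := by gcongr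
          _ = _ := by ring
    refine h1.trans ?_
    rw [integral_const_mul]
    have h5 : 0 ≤ C * (T - t) * (1 / 2) ^ m :=
      mul_nonneg (mul_nonneg hC0 (by linarith [hs.1, hs.2])) (by positivity)
    have h6 := setIntegral_exp_le (c := 2 * ((K : ℝ) + 1)) hs.1 (by positivity)
    have h7 : (K : ℝ) * (2 * ((K : ℝ) + 1))⁻¹ ≤ 1 / 2 := by
      rw [mul_inv_le_iff₀ (by positivity)]
      linarith
    calc (K : ℝ) * (C * (T - t) * (1 / 2) ^ m) * ∫ r in Ioc t s, Real.exp (2 * (K + 1) * (r - t))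
        ≤ (K : ℝ) * (C * (T - t) * (1 / 2) ^ m) *
          ((2 * ((K : ℝ) + 1))⁻¹ * Real.exp (2 * (K + 1) * (s - t))) := by gcongr
      _ = (K : ℝ) * (2 * ((K : ℝ) + 1))⁻¹ *
          (C * (T - t) * (1 / 2) ^ m * Real.exp (2 * (K + 1) * (s - t))) := by ring
      _ ≤ 1 / 2 * (C * (T - t) * (1 / 2) ^ m * Real.exp (2 * (K + 1) * (s - t))) := by gcongr
      _ = _ := by ring

theorem tendsto_picard (hΦ : Measurable (Function.uncurry Φ))
    (hC : ∀ r y, ‖Φ r y‖ ≤ C) (hK : ∀ r, LipschitzWith K (Φ r)) {t T : ℝ} (x : E)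
    {s : ℝ} (hs : s ∈ Icc t T) :
    Tendsto (fun m => picard Φ t x m s) atTop (𝓝 (picardLim Φ t x s)) := by
  refine CauchySeq.tendsto_limUnder (cauchySeq_of_le_geometric (1 / 2)
    (C * (T - t) * Real.exp (2 * (K + 1) * (s - t))) (by norm_num) fun m => ?_)
  rw [dist_comm, dist_eq_norm]
  exact norm_picard_succ_sub_le hΦ hC hK x m s hs

theorem picardLim_eq (hΦ : Measurable (Function.uncurry Φ))
    (hC : ∀ r y, ‖Φ r y‖ ≤ C) (hK : ∀ r, LipschitzWith K (Φ r)) {t T : ℝ} (x : E)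
    {s : ℝ} (hs : s ∈ Icc t T) :
    picardLim Φ t x s = x + ∫ r in t..s, Φ r (picardLim Φ t x r) := by
  have h1 := (tendsto_picard hΦ hC hK x hs).comp (tendsto_add_atTop_nat 1)
  refine tendsto_nhds_unique h1 ?_
  rw [intervalIntegral.integral_of_le hs.1]
  refine tendsto_const_nhds.add ?_
  refine tendsto_integral_of_dominated_convergence (fun _ => C) (fun m => ?_)
    (by simp) (fun m => ae_of_all _ fun r => hC _ _) ?_
  · exact (hΦ.comp (measurable_id.prodMk
      (measurable_picard_of_measurable hΦ t x m))).aestronglyMeasurable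
  · refine (ae_restrict_iff' measurableSet_Ioc).2 (ae_of_all _ fun r hr => ?_)
    exact ((hK r).continuous.tendsto _).comp
      (tendsto_picard hΦ hC hK x ⟨hr.1.le, hr.2.trans hs.2⟩)

theorem measurable_picardLim {Ω : Type*} [MeasurableSpace Ω] {Φ : Ω → ℝ → E → E}
    (hΦ : Measurable fun q : Ω × ℝ × E => Φ q.1 q.2.1 q.2.2) (t : ℝ) (x : E) :
    Measurable fun q : Ω × ℝ => picardLim (Φ q.1) t x q.2 :=
  (StronglyMeasurable.limUnder fun m =>
    (measurable_picard hΦ t x m).stronglyMeasurable).measurable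

theorem continuousOn_picardLim (hΦ : Measurable (Function.uncurry Φ))
    (hC : ∀ r y, ‖Φ r y‖ ≤ C) (hK : ∀ r, LipschitzWith K (Φ r)) {t T : ℝ} (htT : t ≤ T) (x : E) :
    ContinuousOn (picardLim Φ t x) (Icc t T) := by
  have hm : Measurable (picardLim Φ t x) :=
    (measurable_picardLim (Ω := Unit) (Φ := fun _ => Φ)
      (hΦ.comp measurable_snd) t x).comp (f := fun s => ((), s)) (by fun_prop)
  refine (continuousOn_const.add ?_).congr fun s hs => picardLim_eq hΦ hC hK x hs
  have := intervalIntegral.continuousOn_primitive_interval (μ := volume) (a := t) (b := T)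
    (f := fun r => Φ r (picardLim Φ t x r)) (by
      rw [uIcc_of_le htT, integrableOn_Icc_iff_integrableOn_Ioc]
      exact integrableOn_comp hΦ hC hm t T)
  rwa [uIcc_of_le htT] at this

end Picard

section Sol

variable {d : ℕ} {A B : Type} [MetricSpace A] [CompactSpace A] [MeasurableSpace A] [BorelSpace A]
  [MetricSpace B] [CompactSpace B] [MeasurableSpace B] [BorelSpace B]
  [Nonempty A] [Nonempty B]

variable {f : ℝ → Euc d → A → B → Euc d} {T C : ℝ} {K : ℝ≥0}

/-- The dynamics with time clamped to `[0,T]`. -/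
def clampDyn (f : ℝ → Euc d → A → B → Euc d) (T : ℝ) (r : ℝ) : Euc d → A → B → Euc d :=
  f (max 0 (min r T))

theorem clamp_mem (hT : 0 < T) (r : ℝ) : max 0 (min r T) ∈ Icc 0 T :=
  ⟨le_max_left _ _, max_le hT.le (min_le_right _ _)⟩

theorem clampDyn_of_mem {r : ℝ} (hr : r ∈ Icc 0 T) : clampDyn f T r = f r := by
  rw [clampDyn, min_eq_left hr.2, max_eq_right hr.1]

theorem Dyn.continuous_clampDyn (hf : Dyn f T C K) :
    Continuous fun q : ℝ × Euc d × A × B => clampDyn f T q.1 q.2.1 q.2.2.1 q.2.2.2 :=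
  continuousOn_univ.1 (hf.cont.comp (s := univ)
    (f := fun q : ℝ × Euc d × A × B => (max 0 (min q.1 T), q.2)) (Continuous.continuousOn
      (by fun_prop)) fun q _ => ⟨clamp_mem hf.pos _, mem_univ _⟩)

theorem IsSol.intervalIntegrable (hf : Dyn f T C K) {t : ℝ} (ht : 0 ≤ t) (htT : t ≤ T) {x : Euc d}
    {u : ℝ → A} {v : ℝ → B} (hu : Measurable u) (hv : Measurable v) {Z : ℝ → Euc d}
    (hZ : IsSol f T t x u v Z) :
    IntervalIntegrable (fun r => f r (Z r) (u r) (v r)) volume t T := by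
  rw [intervalIntegrable_iff_integrableOn_Ioc_of_le htT]
  have h1 : AEStronglyMeasurable (fun r => clampDyn f T r (Z r) (u r) (v r))
      (volume.restrict (Ioc t T)) := by
    have h2 : AEMeasurable Z (volume.restrict (Ioc t T)) :=
      (hZ.1.mono Ioc_subset_Icc_self).aemeasurable measurableSet_Ioc
    exact (hf.continuous_clampDyn.measurable.comp_aemeasurable
      (aemeasurable_id.prodMk (h2.prodMk (hu.aemeasurable.prodMk
        hv.aemeasurable)))).aestronglyMeasurable
  refine Integrable.of_bound ?_ C (ae_of_all _ fun r => hf.bdd _ _ _ _)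
  refine h1.congr ((ae_restrict_iff' measurableSet_Ioc).2 (ae_of_all _ fun r hr => ?_))
  simp only
  rw [clampDyn_of_mem ⟨ht.trans hr.1.le, hr.2⟩]

theorem IsSol.unique (hf : Dyn f T C K) {t : ℝ} (ht : 0 ≤ t) {x : Euc d} {u : ℝ → A} {v : ℝ → B}
    (hu : Measurable u) (hv : Measurable v) {X Y : ℝ → Euc d} (hX : IsSol f T t x u v X)
    (hY : IsSol f T t x u v Y) {s : ℝ} (hs : s ∈ Icc t T) : X s = Y s := by
  have htT : t ≤ T := hs.1.trans hs.2
  have hcl := fun (Z : ℝ → Euc d) (hZ : IsSol f T t x u v Z) =>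
    hZ.intervalIntegrable hf ht htT hu hv
  set h : ℝ → ℝ := fun r => ‖X (projIcc t T htT r) - Y (projIcc t T htT r)‖ with hh
  have hcont : Continuous h :=
    ((hX.1.sub hY.1).domRestrict.comp (continuous_projIcc (h := htT))).norm
  have hproj : ∀ r ∈ Icc t T, h r = ‖X r - Y r‖ := fun r hr => by
    simp only [hh, projIcc_of_mem htT hr]
  have hle : ∀ r ∈ Icc t T, h r ≤ K * ∫ r' in t..r, h r' := by
    intro r hr
    have hsub : uIcc t r ⊆ uIcc t T := by
      rw [uIcc_of_le hr.1, uIcc_of_le htT]; exact Icc_subset_Icc_right hr.2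
    rw [hproj r hr, hX.2 r hr, hY.2 r hr, add_sub_add_left_eq_sub,
      ← intervalIntegral.integral_sub ((hcl X hX).mono_set hsub) ((hcl Y hY).mono_set hsub),
      ← intervalIntegral.integral_const_mul]
    refine intervalIntegral.norm_integral_le_of_norm_le hr.1 (ae_of_all _ fun r' hr' => ?_)
      ((continuous_const.mul hcont).intervalIntegrable _ _)
    rw [hproj r' ⟨hr'.1.le, hr'.2.trans hr.2⟩]
    exact hf.norm_sub_le _ _ _ _ _
  have hH := norm_le_gronwallBound_of_norm_deriv_right_le (f := fun r => ∫ r' in t..r, h r')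
    (f' := h) (δ := 0) (K := K) (ε := 0) (a := t) (b := T)
    (Continuous.continuousOn (intervalIntegral.continuous_primitive
      (fun a b => hcont.intervalIntegrable a b) t))
    (fun r _ => (hcont.integral_hasStrictDerivAt t r).hasDerivAt.hasDerivWithinAt)
    (by simp) (fun r hr => by
      have h1 := hle r ⟨hr.1, hr.2.le⟩
      have h2 : 0 ≤ ∫ r' in t..r, h r' :=
        intervalIntegral.integral_nonneg hr.1 fun r' _ => norm_nonneg _
      rw [Real.norm_of_nonneg h2, add_zero, Real.norm_of_nonneg (norm_nonneg _)]
      exact h1) s hs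
  rw [gronwallBound_ε0_δ0] at hH
  have h3 := hle s hs
  rw [norm_le_zero_iff.1 hH, mul_zero, hproj s hs] at h3
  exact sub_eq_zero.1 (norm_le_zero_iff.1 h3)

theorem IsSol.congr_ae {t : ℝ} {x : Euc d} {u u' : ℝ → A} {v v' : ℝ → B}
    {X : ℝ → Euc d} (hX : IsSol f T t x u v X)
    (hu : ∀ᵐ r, r ∈ Icc t T → u r = u' r) (hv : ∀ᵐ r, r ∈ Icc t T → v r = v' r) :
    IsSol f T t x u' v' X := by
  refine ⟨hX.1, fun s hs => (hX.2 s hs).trans ?_⟩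
  congr 1
  refine intervalIntegral.integral_congr_ae ?_
  filter_upwards [hu, hv] with r h1 h2 hr
  rw [uIoc_of_le hs.1] at hr
  rw [h1 ⟨hr.1.le, hr.2.trans hs.2⟩, h2 ⟨hr.1.le, hr.2.trans hs.2⟩]

/-- Existence of solutions, and measurability in the scenario of the terminal state. -/
theorem isSol_sol_and_measurable (hf : Dyn f T C K) {Ω : Type*} [MeasurableSpace Ω]
    {u : ℝ → Ω → A} {v : ℝ → Ω → B} (hu : Measurable (Function.uncurry u))
    (hv : Measurable (Function.uncurry v)) {t : ℝ} (ht : t ∈ Icc 0 T) (x : Euc d) :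
    (∀ ω, IsSol f T t x (fun r => u r ω) (fun r => v r ω)
      (sol f T t x (fun r => u r ω) (fun r => v r ω))) ∧
    Measurable fun ω => sol f T t x (fun r => u r ω) (fun r => v r ω) T := by
  set Φ : Ω → ℝ → Euc d → Euc d := fun ω r y => clampDyn f T r y (u r ω) (v r ω) with hΦdef
  have hΦ : Measurable fun q : Ω × ℝ × Euc d => Φ q.1 q.2.1 q.2.2 := by
    have h1 : Measurable fun q : Ω × ℝ × Euc d => u q.2.1 q.1 :=
      hu.comp (f := fun q : Ω × ℝ × Euc d => (q.2.1, q.1)) (by fun_prop)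
    have h2 : Measurable fun q : Ω × ℝ × Euc d => v q.2.1 q.1 :=
      hv.comp (f := fun q : Ω × ℝ × Euc d => (q.2.1, q.1)) (by fun_prop)
    exact hf.continuous_clampDyn.measurable.comp (f := fun q : Ω × ℝ × Euc d =>
      (q.2.1, q.2.2, u q.2.1 q.1, v q.2.1 q.1)) (by fun_prop)
  have hΦω : ∀ ω, Measurable (Function.uncurry (Φ ω)) := fun ω =>
    hΦ.comp (f := fun q : ℝ × Euc d => (ω, q.1, q.2)) (by fun_prop)
  have hb : ∀ ω r y, ‖Φ ω r y‖ ≤ C := fun ω r y => hf.bdd _ _ _ _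
  have hl : ∀ ω r, LipschitzWith K (Φ ω r) := fun ω r => hf.lip _ _ _
  have hsol : ∀ ω, IsSol f T t x (fun r => u r ω) (fun r => v r ω) (picardLim (Φ ω) t x) := by
    intro ω
    refine ⟨continuousOn_picardLim (hΦω ω) (hb ω) (hl ω) ht.2 x, fun s hs => ?_⟩
    rw [picardLim_eq (hΦω ω) (hb ω) (hl ω) x hs]
    congr 1
    refine intervalIntegral.integral_congr fun r hr => ?_
    rw [uIcc_of_le hs.1] at hr
    simp only [hΦdef]
    rw [clampDyn_of_mem ⟨ht.1.trans hr.1, hr.2.trans hs.2⟩]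
  have hsol' : ∀ ω, IsSol f T t x (fun r => u r ω) (fun r => v r ω)
      (sol f T t x (fun r => u r ω) (fun r => v r ω)) := fun ω =>
    Classical.epsilon_spec (p := IsSol f T t x (fun r => u r ω) (fun r => v r ω)) ⟨_, hsol ω⟩
  refine ⟨hsol', ?_⟩
  have h3 : (fun ω => sol f T t x (fun r => u r ω) (fun r => v r ω) T) =
      fun ω => picardLim (Φ ω) t x T := by
    ext1 ω
    exact (hsol' ω).unique hf ht.1 (hu.comp (f := fun r => (r, ω)) (by fun_prop))
      (hv.comp (f := fun r => (r, ω)) (by fun_prop)) (hsol ω) ⟨ht.2, le_rfl⟩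
  rw [h3]
  exact (measurable_picardLim hΦ t x).comp (f := fun ω => (ω, T)) (by fun_prop)

end Sol

/-! ### Existence of a viscosity solution by a semi-discrete scheme -/

section Existence

variable {d : ℕ} {A B : Type} [MetricSpace A] [CompactSpace A] [MeasurableSpace A] [BorelSpace A]
  [MetricSpace B] [CompactSpace B] [MeasurableSpace B] [BorelSpace B]
  [Nonempty A] [Nonempty B]

variable {f : ℝ → Euc d → A → B → Euc d} {T C : ℝ} {K : ℝ≥0}

theorem gval_const (c : ℝ) : gval (fun (_ : A) (_ : B) => c) = c := by
  simp [gval]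

/-- The semi-discrete scheme: `scheme f g T h k` approximates the value at time `T - k * h`. -/
def scheme (f : ℝ → Euc d → A → B → Euc d) (g : Euc d → ℝ) (T h : ℝ) : ℕ → Euc d → ℝ
  | 0 => g
  | k + 1 => fun x => gval fun a b => scheme f g T h k (x + h • f (T - (k + 1) * h) x a b)

theorem sub_mul_mem {h : ℝ} (hh : 0 ≤ h) {k : ℕ} (hk : (k : ℝ) * h ≤ T) :
    T - k * h ∈ Icc 0 T :=
  ⟨by linarith, by have : 0 ≤ (k : ℝ) * h := by positivity
                   linarith⟩

theorem scheme_bounds (hf : Dyn f T C K) {g : Euc d → ℝ} {M : ℝ} (hgM : ∀ x, |g x| ≤ M) {L : ℝ≥0}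
    (hgL : LipschitzWith L g) {h : ℝ} (hh : 0 ≤ h) (k : ℕ) (hk : (k : ℝ) * h ≤ T) :
    (∀ x, |scheme f g T h k x| ≤ M) ∧
      ∀ x y, |scheme f g T h k x - scheme f g T h k y| ≤ L * (1 + K * h) ^ k * ‖x - y‖ := by
  induction k with
  | zero =>
    refine ⟨hgM, fun x y => ?_⟩
    have := hgL.dist_le_mul x y
    rw [Real.dist_eq, dist_eq_norm] at this
    simpa [scheme] using this
  | succ k ih =>
    have hk' : (k : ℝ) * h ≤ T := le_trans (by gcongr; simp) hk
    obtain ⟨ih1, ih2⟩ := ih hk'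
    have hmem := sub_mul_mem hh hk
    push_cast at hmem
    have hcont : Continuous (scheme f g T h k) := by
      refine (LipschitzWith.of_dist_le_mul (K := L * (1 + K * h.toNNReal) ^ k)
        fun x y => ?_).continuous
      rw [Real.dist_eq, dist_eq_norm]
      simpa [hh] using ih2 x y
    have hF : ∀ x, Continuous (Function.uncurry fun a b =>
        scheme f g T h k (x + h • f (T - (k + 1) * h) x a b)) := fun x =>
      hcont.comp (continuous_const.add ((hf.continuous_actions hmem x).const_smul h))
    constructor
    · intro x
      have := abs_gval_sub_le (hF x) (G := fun _ _ => 0) continuous_const (c := M)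
        fun a b => by simpa using ih1 _
      simpa [gval_const, scheme] using this
    · intro x y
      refine abs_gval_sub_le (hF x) (hF y) fun a b => (ih2 _ _).trans ?_
      have h1 := hf.norm_sub_le (T - (k + 1) * h) x y a b
      have h2 : ‖x + h • f (T - (k + 1) * h) x a b - (y + h • f (T - (k + 1) * h) y a b)‖ ≤
          (1 + K * h) * ‖x - y‖ := by
        rw [add_sub_add_comm, ← smul_sub]
        refine (norm_add_le _ _).trans ?_
        rw [norm_smul, Real.norm_of_nonneg hh]
        have := mul_le_mul_of_nonneg_left h1 hh
        linarith
      calc _ ≤ L * (1 + K * h) ^ k * ((1 + K * h) * ‖x - y‖) := by gcongr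
        _ = _ := by ring

theorem one_add_pow_le_exp {h : ℝ} (hh : 0 ≤ h) {k : ℕ} (hk : (k : ℝ) * h ≤ T) :
    (1 + K * h) ^ k ≤ Real.exp (K * T) := by
  have h1 : 1 + K * h ≤ Real.exp (K * h) := by
    have := Real.add_one_le_exp (K * h); linarith
  calc (1 + K * h) ^ k ≤ Real.exp (K * h) ^ k := by gcongr
    _ = Real.exp (K * (k * h)) := by rw [← Real.exp_nat_mul]; ring_nf
    _ ≤ _ := by gcongr

theorem scheme_lipschitz (hf : Dyn f T C K) {g : Euc d → ℝ} {M : ℝ} (hgM : ∀ x, |g x| ≤ M)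
    {L : ℝ≥0} (hgL : LipschitzWith L g) {h : ℝ} (hh : 0 ≤ h) (k : ℕ) (hk : (k : ℝ) * h ≤ T)
    (x y : Euc d) : |scheme f g T h k x - scheme f g T h k y| ≤
      L * Real.exp (K * T) * ‖x - y‖ := by
  refine ((scheme_bounds hf hgM hgL hh k hk).2 x y).trans ?_
  gcongr
  exact one_add_pow_le_exp hh hk

theorem continuous_scheme (hf : Dyn f T C K) {g : Euc d → ℝ} {M : ℝ} (hgM : ∀ x, |g x| ≤ M)
    {L : ℝ≥0} (hgL : LipschitzWith L g) {h : ℝ} (hh : 0 ≤ h) (k : ℕ) (hk : (k : ℝ) * h ≤ T) :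
    Continuous (scheme f g T h k) := by
  refine (LipschitzWith.of_dist_le_mul (K := L * (Real.exp (K * T)).toNNReal)
    fun x y => ?_).continuous
  rw [Real.dist_eq, dist_eq_norm]
  simpa [(Real.exp_pos _).le] using scheme_lipschitz hf hgM hgL hh k hk x y

theorem continuous_scheme_step (hf : Dyn f T C K) {g : Euc d → ℝ} {M : ℝ} (hgM : ∀ x, |g x| ≤ M)
    {L : ℝ≥0} (hgL : LipschitzWith L g) {h : ℝ} (hh : 0 ≤ h) (k : ℕ)
    (hk : ((k + 1 : ℕ) : ℝ) * h ≤ T) (x : Euc d) :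
    Continuous (Function.uncurry fun a b =>
      scheme f g T h k (x + h • f (T - (k + 1) * h) x a b)) := by
  have hmem := sub_mul_mem hh hk
  push_cast at hmem
  exact (continuous_scheme hf hgM hgL hh k (le_trans (by gcongr; simp) hk)).comp
    (continuous_const.add ((hf.continuous_actions hmem x).const_smul h))

theorem abs_scheme_succ_sub_le (hf : Dyn f T C K) {g : Euc d → ℝ} {M : ℝ} (hgM : ∀ x, |g x| ≤ M)
    {L : ℝ≥0} (hgL : LipschitzWith L g) {h : ℝ} (hh : 0 ≤ h) (k : ℕ)
    (hk : ((k + 1 : ℕ) : ℝ) * h ≤ T) (x : Euc d) :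
    |scheme f g T h (k + 1) x - scheme f g T h k x| ≤ L * Real.exp (K * T) * (C * h) := by
  have h1 := abs_gval_sub_le (continuous_scheme_step hf hgM hgL hh k hk x)
    (G := fun _ _ => scheme f g T h k x) continuous_const (c := L * Real.exp (K * T) * (C * h))
    fun a b => by
      refine (scheme_lipschitz hf hgM hgL hh k (le_trans (by gcongr; simp) hk) _ _).trans ?_
      rw [add_sub_cancel_left, norm_smul, Real.norm_of_nonneg hh, mul_comm h]
      have := hf.bdd (T - (k + 1) * h) x a b
      gcongr
  rwa [gval_const] at h1

theorem abs_scheme_sub_le (hf : Dyn f T C K) {g : Euc d → ℝ} {M : ℝ} (hgM : ∀ x, |g x| ≤ M)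
    {L : ℝ≥0} (hgL : LipschitzWith L g) {h : ℝ} (hh : 0 ≤ h) (k j : ℕ)
    (hk : ((k + j : ℕ) : ℝ) * h ≤ T) (x : Euc d) :
    |scheme f g T h (k + j) x - scheme f g T h k x| ≤ L * Real.exp (K * T) * (C * (j * h)) := by
  induction j with
  | zero => simp
  | succ j ih =>
    have h1 := abs_scheme_succ_sub_le hf hgM hgL hh (k + j) hk x
    have h2 := ih (le_trans (by gcongr; simp) hk)
    have h3 := abs_sub_le (scheme f g T h (k + j + 1) x) (scheme f g T h (k + j) x)
      (scheme f g T h k x)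
    rw [← add_assoc]
    push_cast
    linarith

theorem scheme_swap (hf : Dyn f T C K) {g : Euc d → ℝ} {M : ℝ} (hgM : ∀ x, |g x| ≤ M)
    {L : ℝ≥0} (hgL : LipschitzWith L g) {h : ℝ} (hh : 0 ≤ h) (k : ℕ) (hk : (k : ℝ) * h ≤ T) :
    scheme (fun t x b a => f t x a b) (fun x => - g x) T h k = fun x => - scheme f g T h k x := by
  induction k with
  | zero => rfl
  | succ k ih =>
    ext1 x
    simp only [scheme]
    rw [ih (le_trans (by gcongr; simp) hk)]
    exact gval_neg_swap (continuous_scheme_step hf hgM hgL hh k hk x)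

/-- The piecewise constant in time interpolation of the scheme with `n + 1` steps. -/
def approx (f : ℝ → Euc d → A → B → Euc d) (g : Euc d → ℝ) (T : ℝ) (n : ℕ) (t : ℝ) : Euc d → ℝ :=
  scheme f g T (T / (n + 1)) ⌊(T - t) / (T / (n + 1))⌋₊

theorem floor_mul_le {h s : ℝ} (hh : 0 < h) (hs : 0 ≤ s) : (⌊s / h⌋₊ : ℝ) * h ≤ s := by
  have := Nat.floor_le (div_nonneg hs hh.le)
  rwa [le_div_iff₀ hh] at this

theorem lt_floor_add_one_mul {h s : ℝ} (hh : 0 < h) : s < (⌊s / h⌋₊ + 1 : ℝ) * h := by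
  have := Nat.lt_floor_add_one (s / h)
  rwa [div_lt_iff₀ hh] at this

theorem abs_approx_le (hf : Dyn f T C K) {g : Euc d → ℝ} {M : ℝ} (hgM : ∀ x, |g x| ≤ M)
    {L : ℝ≥0} (hgL : LipschitzWith L g) (n : ℕ) {t : ℝ} (ht : t ∈ Icc 0 T) (x : Euc d) :
    |approx f g T n t x| ≤ M := by
  have hh : 0 < T / ((n : ℝ) + 1) := div_pos hf.pos (by positivity)
  exact (scheme_bounds hf hgM hgL hh.le _ ((floor_mul_le hh (by linarith [ht.2])).trans
    (by linarith [ht.1]))).1 x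

theorem abs_approx_sub_le (hf : Dyn f T C K) {g : Euc d → ℝ} {M : ℝ} (hgM : ∀ x, |g x| ≤ M)
    {L : ℝ≥0} (hgL : LipschitzWith L g) (n : ℕ) {t t' : ℝ} (ht : t ∈ Icc 0 T)
    (ht' : t' ∈ Icc 0 T) (x x' : Euc d) :
    |approx f g T n t x - approx f g T n t' x'| ≤
      L * Real.exp (K * T) * (‖x - x'‖ + C * (|t - t'| + T / (n + 1))) := by
  wlog htt : t ≤ t' generalizing t t' x x'
  · rw [abs_sub_comm, norm_sub_rev x x', abs_sub_comm t t']
    exact this ht' ht x' x (le_of_not_ge htt)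
  have hh : 0 < T / ((n : ℝ) + 1) := div_pos hf.pos (by positivity)
  unfold approx
  set h := T / ((n : ℝ) + 1)
  obtain ⟨j, hj⟩ := Nat.exists_eq_add_of_le
    (Nat.floor_mono (div_le_div_of_nonneg_right (show T - t' ≤ T - t by linarith) hh.le))
  have h1 := floor_mul_le (s := T - t) hh (by linarith [ht.2])
  have h2 := floor_mul_le (s := T - t') hh (by linarith [ht'.2])
  have h3 := lt_floor_add_one_mul (s := T - t') hh
  rw [hj] at h1 ⊢
  set k := ⌊(T - t') / h⌋₊
  have h4 := abs_scheme_sub_le hf hgM hgL hh.le k j (h1.trans (by linarith [ht.1])) x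
  have h5 := scheme_lipschitz hf hgM hgL hh.le k (h2.trans (by linarith [ht'.1])) x x'
  have h6 := abs_sub_le (scheme f g T h (k + j) x) (scheme f g T h k x) (scheme f g T h k x')
  have h7 : (j : ℝ) * h ≤ |t - t'| + h := by
    push_cast at h1
    rw [abs_of_nonpos (by linarith)]
    linarith
  have hC := hf.nonneg
  have h8 : L * Real.exp (K * T) * (C * (j * h)) ≤ L * Real.exp (K * T) * (C * (|t - t'| + h)) := by
    gcongr
  rw [mul_add]
  linarith

end Existence

section Existence

variable {d : ℕ} {A B : Type} [MetricSpace A] [CompactSpace A] [MeasurableSpace A] [BorelSpace A]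
  [MetricSpace B] [CompactSpace B] [MeasurableSpace B] [BorelSpace B]
  [Nonempty A] [Nonempty B]

variable {f : ℝ → Euc d → A → B → Euc d} {T C : ℝ} {K : ℝ≥0}

theorem abs_lim_approx_sub_le (hf : Dyn f T C K) {g : Euc d → ℝ} {M : ℝ} (hgM : ∀ x, |g x| ≤ M)
    {L : ℝ≥0} (hgL : LipschitzWith L g) {l : Filter ℕ} [NeBot l] (hl : l ≤ atTop)
    {W : ℝ → Euc d → ℝ}
    (hW : ∀ t ∈ Icc 0 T, ∀ x, Tendsto (fun n => approx f g T n t x) l (𝓝 (W t x)))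
    {t t' : ℝ} (ht : t ∈ Icc 0 T) (ht' : t' ∈ Icc 0 T) (x x' : Euc d) :
    |W t x - W t' x'| ≤ L * Real.exp (K * T) * (‖x - x'‖ + C * |t - t'|) := by
  have h1 := ((hW t ht x).sub (hW t' ht' x')).abs
  have h2 : Tendsto (fun n : ℕ => T / ((n : ℝ) + 1)) l (𝓝 0) :=
    ((tendsto_const_div_atTop_nhds_zero_nat T).comp (tendsto_add_atTop_nat 1)).mono_left hl |>.congr
      fun n => by simp
  have h3 : Tendsto (fun n : ℕ => L * Real.exp (K * T) * (‖x - x'‖ + C * (|t - t'| + T / (n + 1))))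
      l (𝓝 (L * Real.exp (K * T) * (‖x - x'‖ + C * (|t - t'| + 0)))) :=
    ((h2.const_add _).const_mul _ |>.const_add _).const_mul _
  rw [add_zero] at h3
  exact le_of_tendsto_of_tendsto' h1 h3 fun n => abs_approx_sub_le hf hgM hgL n ht ht' x _

/-- The scheme converges locally uniformly. -/
theorem eventually_approx_le (hf : Dyn f T C K) {g : Euc d → ℝ} {M : ℝ} (hgM : ∀ x, |g x| ≤ M)
    {L : ℝ≥0} (hgL : LipschitzWith L g) {l : Filter ℕ} [NeBot l] (hl : l ≤ atTop)
    {W : ℝ → Euc d → ℝ}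
    (hW : ∀ t ∈ Icc 0 T, ∀ x, Tendsto (fun n => approx f g T n t x) l (𝓝 (W t x)))
    (x₀ : Euc d) (r : ℝ) {ε : ℝ} (hε : 0 < ε) :
    ∀ᶠ n in l, ∀ t ∈ Icc 0 T, ∀ x ∈ Metric.closedBall x₀ r, approx f g T n t x ≤ W t x + ε := by
  have hC := hf.nonneg
  set D : ℝ := L * Real.exp (K * T) with hD
  have hD0 : 0 ≤ D := by positivity
  have hcpt : IsCompact (Icc (0 : ℝ) T ×ˢ Metric.closedBall x₀ r) :=
    isCompact_Icc.prod (isCompact_closedBall _ _)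
  set η : ℝ := ε / (4 * (D + 1) * (1 + C)) with hη
  have hη0 : 0 < η := by positivity
  have hηε : D * (η + C * η) ≤ ε / 4 := by
    have : D * (η + C * η) = D / (D + 1) * (ε / 4) := by
      rw [hη]; field_simp
    rw [this]
    have h1 : D / (D + 1) ≤ 1 := (div_le_one (by positivity)).2 (by linarith)
    nlinarith
  obtain ⟨s, hs, hsf, hcov⟩ := hcpt.finite_cover_balls hη0
  have h2 : Tendsto (fun n : ℕ => T / ((n : ℝ) + 1)) l (𝓝 0) :=
    ((tendsto_const_div_atTop_nhds_zero_nat T).comp (tendsto_add_atTop_nat 1)).mono_left hl |>.congr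
      fun n => by simp
  have e1 : ∀ᶠ n : ℕ in l, D * (C * (T / ((n : ℝ) + 1))) < ε / 4 :=
    ((h2.const_mul C).const_mul D).eventually_lt_const (by simpa using hε)
  have e2 : ∀ᶠ n in l, ∀ q ∈ s, approx f g T n q.1 q.2 < W q.1 q.2 + ε / 4 := by
    rw [Set.Finite.eventually_all hsf] 
    intro q hq
    exact (hW q.1 (hs hq).1 q.2).eventually_lt_const (by linarith)
  filter_upwards [e1, e2] with n h3 h4 t ht x hx
  obtain ⟨q, hq, hqd⟩ := mem_iUnion₂.1 (hcov (show (t, x) ∈ _ from ⟨ht, hx⟩))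
  have h5 := h4 q hq
  have hqt : |t - q.1| ≤ η := (le_max_left _ _).trans (Metric.mem_ball.1 hqd).le
  have hqx : ‖x - q.2‖ ≤ η := by
    rw [← dist_eq_norm]
    exact (le_max_right _ _).trans (Metric.mem_ball.1 hqd).le
  have h6 := (abs_le.1 (abs_approx_sub_le hf hgM hgL n ht (hs hq).1 x q.2)).2
  have h7 := (abs_le.1 (abs_lim_approx_sub_le hf hgM hgL hl hW ht (hs hq).1 x q.2)).1
  have h8 : D * (‖x - q.2‖ + C * |t - q.1|) ≤ D * (η + C * η) := by gcongr
  rw [← hD] at h6 h7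
  have h9 : D * (‖x - q.2‖ + C * (|t - q.1| + T / (n + 1))) =
    D * (‖x - q.2‖ + C * |t - q.1|) + D * (C * (T / ((n : ℝ) + 1))) := by ring
  linarith

end Existence

section Existence

variable {d : ℕ} {A B : Type} [MetricSpace A] [CompactSpace A] [MeasurableSpace A] [BorelSpace A]
  [MetricSpace B] [CompactSpace B] [MeasurableSpace B] [BorelSpace B]
  [Nonempty A] [Nonempty B]

variable {f : ℝ → Euc d → A → B → Euc d} {T C : ℝ} {K : ℝ≥0}

theorem approx_grid {g : Euc d → ℝ} {n : ℕ} (hT : 0 < T) (k : ℕ) :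
    approx f g T n (T - k * (T / (n + 1))) = scheme f g T (T / (n + 1)) k := by
  have hh : T / ((n : ℝ) + 1) ≠ 0 := (div_pos hT (by positivity)).ne'
  rw [approx, sub_sub_cancel, mul_div_cancel_right₀ _ hh, Nat.floor_natCast]

/-- A strict smooth supersolution is decreased by one step of the scheme. -/
theorem scheme_succ_le (hf : Dyn f T C K) {g : Euc d → ℝ} {M : ℝ} (hgM : ∀ x, |g x| ≤ M) {L : ℝ≥0}
    (hgL : LipschitzWith L g) {h : ℝ} (hh : 0 ≤ h) (k : ℕ) (hk : ((k + 1 : ℕ) : ℝ) * h ≤ T)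
    {x p : Euc d} {y b : ℝ}
    (h1 : ∀ u v, scheme f g T h k (x + h • f (T - (k + 1) * h) x u v) ≤
      y + h * (b + ⟪p, f (T - (k + 1) * h) x u v⟫))
    (h2 : b + ham A B f (T - (k + 1) * h) x p ≤ 0) :
    scheme f g T h (k + 1) x ≤ y := by
  have hmem := sub_mul_mem hh hk
  push_cast at hmem
  have h3 := gval_le_gval_add (continuous_scheme_step hf hgM hgL hh k hk x)
    (G := fun u v => h * ⟪f (T - (k + 1) * h) x u v, p⟫)
    ((hf.continuous_inner hmem x p).const_mul h |>.congr fun q => rfl) (c := y + h * b)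
    fun u v => by
      rw [real_inner_comm]
      linarith [h1 u v]
  rw [gval_const_mul _ hh, ← ham_eq_gval hf hmem] at h3
  have h4 := mul_nonpos_of_nonneg_of_nonpos hh h2
  simp only [scheme]
  linarith

set_option maxHeartbeats 1000000 in
theorem isViscSubsol_of_tendsto (hf : Dyn f T C K) {g : Euc d → ℝ} {M : ℝ}
    (hgM : ∀ x, |g x| ≤ M) {L : ℝ≥0} (hgL : LipschitzWith L g) {l : Filter ℕ} [NeBot l]
    (hl : l ≤ atTop) {W : ℝ → Euc d → ℝ}
    (hW : ∀ t ∈ Icc 0 T, ∀ x, Tendsto (fun n => approx f g T n t x) l (𝓝 (W t x))) :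
    IsViscSubsol A B f g T W := by
  constructor
  · intro x
    refine le_of_eq (tendsto_nhds_unique (hW T ⟨hf.pos.le, le_rfl⟩ x) ?_)
    simp only [approx, sub_self, zero_div, Nat.floor_zero, scheme]
    exact tendsto_const_nhds
  intro φ hφ t₀ x₀ ht₀ hmax
  by_contra! hneg
  have hC := hf.nonneg
  have ht₀' : t₀ ∈ Icc 0 T := ⟨ht₀.1, ht₀.2.le⟩
  have hstrict := (hφ.contDiffAt (x := (t₀, x₀))).hasStrictFDerivAt (by norm_num)
  set D := fderiv ℝ (fun q : ℝ × Euc d => φ q.1 q.2) (t₀, x₀) with hD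
  set b := deriv (fun s => φ s x₀) t₀ with hb
  set p := gradient (fun y => φ t₀ y) x₀ with hp
  have hDt : D (1, 0) = b := by
    have h1 : HasDerivAt (fun s : ℝ => (s, x₀)) (1, 0) t₀ :=
      (hasDerivAt_id t₀).prodMk (hasDerivAt_const t₀ x₀)
    exact (hstrict.hasFDerivAt.comp_hasDerivAt (f := fun s : ℝ => (s, x₀)) t₀ h1).deriv.symm
  have hDx : ∀ w, D (0, w) = ⟪p, w⟫ := by
    intro w
    have h1 : HasFDerivAt (fun y : Euc d => (t₀, y)) (ContinuousLinearMap.inr ℝ ℝ (Euc d)) x₀ :=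
      hasFDerivAt_prodMk_right t₀ x₀
    have h2 := (hstrict.hasFDerivAt.comp (f := fun y : Euc d => (t₀, y)) x₀ h1).fderiv
    have h3 : fderiv ℝ (fun y => φ t₀ y) x₀ w = ⟪p, w⟫ := by
      rw [hp, gradient, InnerProductSpace.toDual_symm_apply]
    rw [← h3]
    exact (congrArg (fun l => l w) h2).symm
  obtain ⟨κ, hκ0, hκ⟩ : ∃ κ > 0, b + ham A B f t₀ x₀ p + 2 * κ ≤ 0 :=
    ⟨-(b + ham A B f t₀ x₀ p) / 2, by linarith, by linarith⟩
  set ψ : ℝ × Euc d → ℝ := fun q => φ q.1 q.2 - φ t₀ x₀ + W t₀ x₀ +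
    ((q.1 - t₀) ^ 2 + ‖q.2 - x₀‖ ^ 2) with hψ
  have hψs : HasStrictFDerivAt ψ D (t₀, x₀) := by
    have h1 : HasStrictFDerivAt (fun q : ℝ × Euc d => (q.1 - t₀) ^ 2 + ‖q.2 - x₀‖ ^ 2)
        (0 : ℝ × Euc d →L[ℝ] ℝ) (t₀, x₀) := by
      have h2 : ContDiff ℝ 1 fun q : ℝ × Euc d => (q.1 - t₀) ^ 2 + ‖q.2 - x₀‖ ^ 2 :=
        ContDiff.add (by fun_prop) ((contDiff_snd.sub contDiff_const).norm_sq ℝ)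
      have h3 := (h2.contDiffAt (x := (t₀, x₀))).hasStrictFDerivAt (by norm_num)
      have h4 : fderiv ℝ (fun q : ℝ × Euc d => (q.1 - t₀) ^ 2 + ‖q.2 - x₀‖ ^ 2) (t₀, x₀) = 0 := by
        refine IsLocalMin.fderiv_eq_zero (Eventually.of_forall fun q => ?_)
        have h5 : 0 ≤ (q.1 - t₀) ^ 2 + ‖q.2 - x₀‖ ^ 2 := by positivity
        simpa using h5
      rwa [h4] at h3
    have h2 := ((hstrict.sub_const (φ t₀ x₀)).add_const (W t₀ x₀)).add h1
    rw [add_zero] at h2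
    exact h2
  have hψc : ContinuousAt ψ (t₀, x₀) := hψs.hasFDerivAt.continuousAt
  have hψ0 : ψ (t₀, x₀) = W t₀ x₀ := by simp [hψ]
  -- local radii
  have hε : 0 < κ / (1 + C) := by positivity
  obtain ⟨ρ₁, hρ₁, H1⟩ := Metric.eventually_nhds_iff.1 (hψs.isLittleO.def hε)
  obtain ⟨ρ₂, hρ₂, H2⟩ := Metric.eventually_nhds_iff.1 (eventually_nhdsWithin_iff.1 hmax)
  obtain ⟨θ, hθ, H3⟩ := hf.exists_time_modulus ‖x₀‖ (κ := κ / (2 * (‖p‖ + 1))) (by positivity)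
  obtain ⟨r, hr0, hr⟩ : ∃ r : ℝ, 0 < r ∧ r < ρ₁ ∧ r < ρ₂ ∧ r < θ ∧ r ≤ T - t₀ ∧
      K * r ≤ κ / (2 * (‖p‖ + 1)) := by
    have hq : 0 < κ / (2 * (‖p‖ + 1)) / (K + 1) := by positivity
    refine ⟨min (min (ρ₁ / 2) (ρ₂ / 2)) (min (min (θ / 2) (T - t₀)) (κ / (2 * (‖p‖ + 1)) / (K + 1))),
      ?_, ?_, ?_, ?_, ?_, ?_⟩
    · have := ht₀.2
      simp only [lt_min_iff]
      refine ⟨⟨?_, ?_⟩, ⟨?_, ?_⟩, ?_⟩ <;> first | assumption | linarith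
    · exact lt_of_le_of_lt ((min_le_left _ _).trans (min_le_left _ _)) (by linarith)
    · exact lt_of_le_of_lt ((min_le_left _ _).trans (min_le_right _ _)) (by linarith)
    · exact lt_of_le_of_lt ((min_le_right _ _).trans ((min_le_left _ _).trans (min_le_left _ _)))
        (by linarith)
    · exact (min_le_right _ _).trans ((min_le_left _ _).trans (min_le_right _ _))
    · calc (K : ℝ) * _ ≤ K * (κ / (2 * (‖p‖ + 1)) / (K + 1)) := by
            gcongr
            exact (min_le_right _ _).trans (min_le_right _ _)
        _ = K / (K + 1) * (κ / (2 * (‖p‖ + 1))) := by ring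
        _ ≤ 1 * (κ / (2 * (‖p‖ + 1))) := by
            gcongr
            exact (div_le_one (by positivity)).2 (by linarith)
        _ = _ := one_mul _
  obtain ⟨hr1, hr2, hr3, hr4, hr5⟩ := hr
  obtain ⟨ρ₄, hρ₄, H4⟩ := Metric.eventually_nhds_iff.1
    (hψc.eventually_lt_const (show ψ (t₀, x₀) < W t₀ x₀ + r ^ 2 / 16 by
      rw [hψ0]; nlinarith))
  have htend : Tendsto (fun n : ℕ => T / ((n : ℝ) + 1)) l (𝓝 0) :=
    ((tendsto_const_div_atTop_nhds_zero_nat T).comp (tendsto_add_atTop_nat 1)).mono_left hl |>.congr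
      fun n => by simp
  have hWψ : ∀ t ∈ Icc 0 T, |t - t₀| ≤ r → ∀ x ∈ Metric.closedBall x₀ r,
      W t x ≤ ψ (t, x) - ((t - t₀) ^ 2 + ‖x - x₀‖ ^ 2) := by
    intro t ht htr x hx
    have := H2 (show dist (t, x) (t₀, x₀) < ρ₂ from
      max_lt (by rw [Real.dist_eq]; linarith) ((Metric.mem_closedBall.1 hx).trans_lt hr2))
      ⟨ht, mem_univ _⟩
    simp only [hψ]
    simp only at this
    linarith
  obtain ⟨n, hn1, hn2, hn3, hn4, hn5⟩ := ((eventually_approx_le hf hgM hgL hl hW x₀ r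
    (ε := r ^ 2 / 8) (by positivity)).and
    ((htend.eventually_lt_const (show 0 < r / 2 by positivity)).and
    (((htend.const_mul C).eventually_lt_const (show C * 0 < r / 2 by simpa using hr0)).and
    ((htend.eventually_lt_const hρ₄).and ((hW t₀ ht₀' x₀).eventually_const_lt
      (show W t₀ x₀ - r ^ 2 / 16 < W t₀ x₀ by nlinarith)))))).exists
  have hh : 0 < T / ((n : ℝ) + 1) := div_pos hf.pos (by positivity)
  have hgrid : ∀ k : ℕ, (approx f g T n (T - k * (T / (n + 1)))) = _ := fun k =>
    approx_grid (f := f) (g := g) (n := n) hf.pos k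
  have f5 : approx f g T n t₀ x₀ =
    scheme f g T (T / ((n : ℝ) + 1)) ⌊(T - t₀) / (T / ((n : ℝ) + 1))⌋₊ x₀ := rfl
  set h := T / ((n : ℝ) + 1)
  clear_value ψ D b p h
  have key : ∀ k : ℕ, k * h ≤ T - t₀ → T - k * h ≤ t₀ + r → ∀ x ∈ Metric.closedBall x₀ r,
      scheme f g T h k x ≤ ψ (T - k * h, x) - r ^ 2 / 8 := by
    intro k
    induction k with
    | zero =>
      intro _ hk2 x hx
      simp only [Nat.cast_zero, zero_mul, sub_zero] at hk2 ⊢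
      have hT := hn1 T ⟨hf.pos.le, le_rfl⟩ x hx
      have h0 := hgrid 0
      simp only [Nat.cast_zero, zero_mul, sub_zero] at h0
      rw [h0] at hT
      have h1 := hWψ T ⟨hf.pos.le, le_rfl⟩ (by rw [abs_of_nonneg (by linarith)]; linarith) x hx
      have h2 : r ^ 2 ≤ (T - t₀) ^ 2 := by gcongr
      have h3 : 0 ≤ ‖x - x₀‖ ^ 2 := by positivity
      have h4 : 0 ≤ r ^ 2 := by positivity
      linarith
    | succ k ih =>
      intro hk1 hk2 x hx
      have hkT : ((k + 1 : ℕ) : ℝ) * h ≤ T := by linarith [ht₀.1]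
      have hmem := sub_mul_mem hh.le hkT
      have htr : |T - (k + 1 : ℕ) * h - t₀| ≤ r := by
        rw [abs_of_nonneg (by linarith)]; linarith
      by_cases hout : r / 2 ≤ T - (k + 1 : ℕ) * h - t₀ ∨ r / 2 ≤ ‖x - x₀‖
      · have h1 := hn1 _ hmem x hx
        rw [hgrid] at h1
        have h2 := hWψ _ hmem htr x hx
        have h3 : (r / 2) ^ 2 ≤ (T - (k + 1 : ℕ) * h - t₀) ^ 2 + ‖x - x₀‖ ^ 2 := by
          rcases hout with h3 | h3
          · have : (r / 2) ^ 2 ≤ (T - (k + 1 : ℕ) * h - t₀) ^ 2 := by gcongr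
            nlinarith [sq_nonneg ‖x - x₀‖]
          · have : (r / 2) ^ 2 ≤ ‖x - x₀‖ ^ 2 := by gcongr
            nlinarith [sq_nonneg (T - (k + 1 : ℕ) * h - t₀)]
        linarith
      · push Not at hout
        obtain ⟨ho1, ho2⟩ := hout
        have hk' : (k : ℝ) * h = (k + 1 : ℕ) * h - h := by push_cast; ring
        have hk1' : (k : ℝ) * h ≤ T - t₀ := by linarith
        have hs : (T - (k + 1) * h : ℝ) = T - (k + 1 : ℕ) * h := by push_cast; ring
        refine scheme_succ_le hf hgM hgL hh.le k hkT (p := p) (b := b + κ) (fun u v => ?_) ?_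
        · rw [hs]
          set w := f (T - (k + 1 : ℕ) * h) x u v
          have hw : ‖w‖ ≤ C := hf.bdd _ _ _ _
          have hhw : ‖h • w‖ ≤ C * h := by
            rw [norm_smul, Real.norm_of_nonneg hh.le, mul_comm]; gcongr
          have hxw : ‖x + h • w - x₀‖ ≤ r := by
            have := norm_add_le (x - x₀) (h • w)
            rw [add_sub_right_comm]
            linarith
          have h1 := ih hk1' (by linarith) (x + h • w) (by simpa [dist_eq_norm] using hxw)
          have h2 := H1 (y := ((T - k * h, x + h • w), (T - (k + 1 : ℕ) * h, x))) (by
            rw [Prod.dist_eq, Prod.dist_eq, Prod.dist_eq]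
            simp only [dist_eq_norm, Real.norm_eq_abs]
            refine max_lt (max_lt ?_ (by linarith)) (max_lt (by linarith) (by linarith))
            rw [abs_of_nonneg (by linarith)]; linarith)
          simp only at h2
          have e1 : ((T - k * h, x + h • w) : ℝ × Euc d) - (T - (k + 1 : ℕ) * h, x) =
              h • ((1 : ℝ), (0 : Euc d)) + h • ((0 : ℝ), w) := by
            ext1
            · simp; ring
            · simp
          have e2 : ‖h • ((1 : ℝ), (0 : Euc d)) + h • ((0 : ℝ), w)‖ ≤ h * (1 + C) := by
            refine (norm_add_le _ _).trans ?_
            rw [norm_smul, norm_smul, Real.norm_of_nonneg hh.le, Prod.norm_def, Prod.norm_def]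
            simp only [norm_one, norm_zero, zero_le_one, sup_of_le_left, norm_nonneg,
              sup_of_le_right]
            rw [mul_add]
            gcongr
          rw [e1, map_add, map_smul, map_smul, hDt, hDx] at h2
          simp only [smul_eq_mul, Real.norm_eq_abs] at h2
          have h3 := (abs_le.1 h2).2
          have h4 : κ / (1 + C) * ‖h • ((1 : ℝ), (0 : Euc d)) + h • ((0 : ℝ), w)‖ ≤ κ * h := by
            calc _ ≤ κ / (1 + C) * (h * (1 + C)) := by gcongr
              _ = κ * h := by field_simp
          linarith
        · rw [hs]
          have h1 := (abs_le.1 (abs_ham_sub_le hf hmem ht₀' x x₀ p (c := κ / (‖p‖ + 1))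
            fun u v => ?_)).2
          · have h2 : κ / (‖p‖ + 1) * ‖p‖ ≤ κ := by
              rw [div_mul_eq_mul_div, div_le_iff₀ (by positivity)]
              nlinarith [norm_nonneg p]
            linarith
          · have g1 := H3 _ hmem t₀ ht₀' (htr.trans_lt hr3) x₀ le_rfl u v
            have g2 := hf.norm_sub_le (T - (k + 1 : ℕ) * h) x x₀ u v
            have g3 := norm_sub_le_norm_sub_add_norm_sub (f (T - (k + 1 : ℕ) * h) x u v)
              (f (T - (k + 1 : ℕ) * h) x₀ u v) (f t₀ x₀ u v)
            have g4 : K * ‖x - x₀‖ ≤ K * r := by gcongr; linarith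
            have g5 : κ / (2 * (‖p‖ + 1)) + κ / (2 * (‖p‖ + 1)) = κ / (‖p‖ + 1) := by
              field_simp; norm_num
            linarith
  have f1 := floor_mul_le (s := T - t₀) hh (by linarith [ht₀.2])
  have f2 := lt_floor_add_one_mul (s := T - t₀) hh
  have f3 := key ⌊(T - t₀) / h⌋₊ f1 (by linarith) x₀ (Metric.mem_closedBall_self hr0.le)
  have f4 := H4 (y := (T - ⌊(T - t₀) / h⌋₊ * h, x₀)) (by
    rw [Prod.dist_eq, dist_self, Real.dist_eq, abs_of_nonneg (by linarith)]
    exact max_lt (by linarith) hρ₄)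
  linarith

end Existence

section ExistenceConclusion

variable {d : ℕ} {A B : Type} [MetricSpace A] [CompactSpace A] [MeasurableSpace A] [BorelSpace A]
  [MetricSpace B] [CompactSpace B] [MeasurableSpace B] [BorelSpace B]
  [Nonempty A] [Nonempty B]

variable {f : ℝ → Euc d → A → B → Euc d} {T C : ℝ} {K : ℝ≥0}

theorem IsViscSubsol.supersol_of_neg_swap (hf : Dyn f T C K) {g : Euc d → ℝ}
    {W : ℝ → Euc d → ℝ}
    (hW : IsViscSubsol B A (fun t x b a => f t x a b) (fun x => - g x) T (fun t x => - W t x)) :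
    IsViscSupersol A B f g T W := by
  refine ⟨fun x => neg_le_neg_iff.1 (hW.1 x), fun φ hφ t x ht hmin => ?_⟩
  have h := hW.2 (fun t x => - φ t x) hφ.neg t x ht (by
    filter_upwards [hmin] with q hq
    simp only [sub_neg_eq_add] at hq ⊢
    linarith)
  rw [ham_swap hf ⟨ht.1, ht.2.le⟩] at h
  have hg : gradient (fun y => - φ t y) x = - gradient (fun y => φ t y) x := by
    simp only [gradient]
    rw [← map_neg]
    congr 1
    exact fderiv_fun_neg
  rw [hg, neg_neg, deriv.fun_neg] at h
  linarith

theorem approx_swap (hf : Dyn f T C K) {g : Euc d → ℝ} {M : ℝ} (hgM : ∀ x, |g x| ≤ M)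
    {L : ℝ≥0} (hgL : LipschitzWith L g) (n : ℕ) {t : ℝ} (ht : t ∈ Icc 0 T) (x : Euc d) :
    approx (fun t x b a => f t x a b) (fun x => - g x) T n t x = - approx f g T n t x := by
  have hh : 0 < T / ((n : ℝ) + 1) := div_pos hf.pos (by positivity)
  exact congrFun (scheme_swap hf hgM hgL hh.le _
    ((floor_mul_le hh (by linarith [ht.2])).trans (by linarith [ht.1]))) x

theorem exists_viscosity_solution (hf : Dyn f T C K) {g : Euc d → ℝ} {M : ℝ}
    (hgM : ∀ x, |g x| ≤ M) {L : ℝ≥0} (hgL : LipschitzWith L g) :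
    ∃ W : ℝ → Euc d → ℝ,
      ContinuousOn (fun q : ℝ × Euc d => W q.1 q.2) (Icc (0 : ℝ) T ×ˢ univ) ∧
      (∀ t ∈ Icc (0 : ℝ) T, ∀ x, |W t x| ≤ M) ∧
      IsViscSubsol A B f g T W ∧ IsViscSupersol A B f g T W := by
  have hl : (hyperfilter ℕ : Filter ℕ) ≤ atTop := by
    rw [← Nat.cofinite_eq_atTop]; exact hyperfilter_le_cofinite
  have hex : ∀ t ∈ Icc (0 : ℝ) T, ∀ x, ∃ w ∈ Icc (-M) M,
      Tendsto (fun n : ℕ => approx f g T n t x) (hyperfilter ℕ : Filter ℕ) (𝓝 w) := fun t ht x =>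
    isCompact_Icc.ultrafilter_le_nhds ((hyperfilter ℕ).map fun n : ℕ => approx f g T n t x) (by
      rw [le_principal_iff, Ultrafilter.mem_coe, Ultrafilter.mem_map]
      exact Filter.univ_mem' fun n => abs_le.1 (abs_approx_le hf hgM hgL n ht x))
  choose! W hWM hW using hex
  refine ⟨W, ?_, fun t ht x => abs_le.2 (hWM t ht x), isViscSubsol_of_tendsto hf hgM hgL hl hW,
    IsViscSubsol.supersol_of_neg_swap hf ?_⟩
  · intro q hq
    have hF : Tendsto (fun q' : ℝ × Euc d => L * Real.exp (K * T) *
        (‖q'.2 - q.2‖ + C * |q'.1 - q.1|)) (𝓝[Icc 0 T ×ˢ univ] q) (𝓝 0) := by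
      have hc : Continuous fun q' : ℝ × Euc d => L * Real.exp (K * T) *
        (‖q'.2 - q.2‖ + C * |q'.1 - q.1|) := by fun_prop
      have := hc.tendsto q
      simp only [sub_self, norm_zero, abs_zero, mul_zero, add_zero] at this
      exact this.mono_left nhdsWithin_le_nhds
    refine tendsto_iff_dist_tendsto_zero.2 (squeeze_zero' (.of_forall fun _ => dist_nonneg) ?_ hF)
    filter_upwards [self_mem_nhdsWithin] with q' hq'
    exact abs_lim_approx_sub_le hf hgM hgL hl hW hq'.1 hq.1 _ _
  · refine isViscSubsol_of_tendsto hf.swap (M := M) (by simpa using hgM)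
      (L := L) hgL.neg hl fun t ht x => ?_
    exact (hW t ht x).neg.congr fun n => (approx_swap hf hgM hgL n ht x).symm

end ExistenceConclusion

section Coordinates

/-- `cA` and `cB` are the two coordinate projections of the unit square, in some order. -/
structure Coord (cA cB : I × I → I) : Prop where
  mp : MeasurePreserving (fun z => (cA z, cB z)) volume volume
  diag_left : ∀ b, cA (b, b) = b
  diag_right : ∀ b, cB (b, b) = b

theorem coord_fst_snd : Coord Prod.fst Prod.snd :=
  ⟨MeasurePreserving.id _, fun _ => rfl, fun _ => rfl⟩

theorem coord_snd_fst : Coord Prod.snd Prod.fst :=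
  ⟨Measure.measurePreserving_swap, fun _ => rfl, fun _ => rfl⟩

theorem Coord.swap {cA cB : I × I → I} (hc : Coord cA cB) : Coord cB cA :=
  ⟨Measure.measurePreserving_swap.comp hc.mp, hc.diag_right, hc.diag_left⟩

theorem Coord.measurable_left {cA cB : I × I → I} (hc : Coord cA cB) : Measurable cA :=
  measurable_fst.comp hc.mp.measurable

theorem Coord.measurable_right {cA cB : I × I → I} (hc : Coord cA cB) : Measurable cB :=
  measurable_snd.comp hc.mp.measurable

theorem measurable_restr (j : ℕ) : Measurable fun (ω : Omega) (i : Fin j) => ω (i : ℕ) :=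
  measurable_pi_lambda _ fun _ => measurable_pi_apply _

theorem Fsig_le (j : ℕ) : Fsig j ≤ (inferInstance : MeasurableSpace Omega) :=
  (measurable_restr j).comap_le

theorem Fsig_mono {i j : ℕ} (h : i ≤ j) : Fsig i ≤ Fsig j := by
  have hm : Measurable fun (ξ : Fin j → I × I) (k : Fin i) => ξ (Fin.castLE h k) :=
    measurable_pi_lambda _ fun _ => measurable_pi_apply _
  rintro _ ⟨S, hS, rfl⟩
  exact ⟨_, hm hS, rfl⟩

theorem mem_iff_of_Fsig {j : ℕ} {S : Set Omega} (hS : MeasurableSet[Fsig j] S) {ω ω' : Omega}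
    (h : ∀ i < j, ω i = ω' i) : ω ∈ S ↔ ω' ∈ S := by
  obtain ⟨S, -, rfl⟩ := hS
  have : (fun i : Fin j => ω (i : ℕ)) = fun i : Fin j => ω' (i : ℕ) := funext fun i => h i i.2
  simp only [mem_preimage, this]

/-- Extend a finite sequence of samples by a constant sequence. -/
def extend (j : ℕ) (z : I × I) (ξ : Fin j → I × I) : Omega :=
  fun i => if h : i < j then ξ ⟨i, h⟩ else z

theorem measurable_extend (j : ℕ) :
    Measurable fun p : (Fin j → I × I) × (I × I) => extend j p.2 p.1 := by
  refine measurable_pi_lambda _ fun i => ?_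
  by_cases h : i < j
  · simp only [extend, h, dif_pos]
    exact (measurable_pi_apply _).comp measurable_fst
  · simp only [extend, h, dif_neg, not_false_iff]
    exact measurable_snd

/-- A measurable function of the first `j` samples is measurable for `Fsig j`. -/
theorem measurable_Fsig {Ψ : Type*} [MeasurableSpace Ψ] {j : ℕ} {Y : Omega → Ψ} (hY : Measurable Y)
    (h : ∀ ω ω', (∀ i < j, ω i = ω' i) → Y ω = Y ω') : Measurable[Fsig j] Y := by
  have h1 : Y = (fun ξ => Y (extend j (0, 0) ξ)) ∘
      fun (ω : Omega) (i : Fin j) => ω (i : ℕ) := by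
    ext1 ω
    refine h _ _ fun i hi => ?_
    simp [extend, hi]
  rw [h1]
  refine Measurable.comp (hY.comp ((measurable_extend j).comp
    (measurable_id.prodMk measurable_const))) (comap_measurable _)

variable {P : Measure Omega} [IsProbabilityMeasure P]

theorem map_restr_prod (hP : IsProductMeasure P) (j : ℕ) :
    P.map (fun ω => ((fun i : Fin j => ω (i : ℕ)), ω j)) =
      (Measure.pi fun _ : Fin j => (volume : Measure (I × I))).prod volume := by
  have h1 := (measurePreserving_piFinSuccAbove
    (fun _ : Fin (j + 1) => (volume : Measure (I × I))) (Fin.last j)).map_eq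
  rw [← hP (j + 1), Measure.map_map (MeasurableEquiv.measurable _) (measurable_restr _)] at h1
  rw [← Measure.prod_swap, ← h1, Measure.map_map measurable_swap
    ((MeasurableEquiv.measurable _).comp (measurable_restr _))]
  congr 1
  ext ω <;> simp [MeasurableEquiv.piFinSuccAbove, Fin.insertNthEquiv, Fin.init]

theorem map_restr_coord (hP : IsProductMeasure P) {cA cB : I × I → I} (hc : Coord cA cB) (j : ℕ) :
    P.map (fun ω => (((fun i : Fin j => ω (i : ℕ)), cB (ω j)), cA (ω j))) =
      ((Measure.pi fun _ : Fin j => (volume : Measure (I × I))).prod volume).prod volume := by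
  have h2 : MeasurePreserving (fun p : (Fin j → I × I) × (I × I) => (p.1, (cB p.2, cA p.2)))
      ((Measure.pi fun _ : Fin j => (volume : Measure (I × I))).prod volume)
      ((Measure.pi fun _ : Fin j => (volume : Measure (I × I))).prod
        ((volume : Measure I).prod volume)) :=
    (MeasurePreserving.id _).prod hc.swap.mp
  have h3 := (measurePreserving_prodAssoc (Measure.pi fun _ : Fin j => (volume : Measure (I × I)))
    (volume : Measure I) (volume : Measure I)).symm _
  have h4 := (h3.comp h2).map_eq
  rw [← map_restr_prod hP j, Measure.map_map (h3.comp h2).measurable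
    ((measurable_restr j).prodMk (measurable_pi_apply _))] at h4
  exact h4

/-- A player who samples a mixed action with fresh randomness secures its value against an
opponent who does not observe the sample. -/
theorem le_setIntegral_of_fresh (hP : IsProductMeasure P) {cA cB : I × I → I} (hc : Coord cA cB)
    {j : ℕ} {S : Set Omega} (hS : MeasurableSet[Fsig j] S) {Ψ : Type*} [MeasurableSpace Ψ]
    {ψ : Omega → Ψ} (hψ : Measurable ψ)
    (hψ' : ∀ ω ω', (∀ i < j, ω i = ω' i) → cB (ω j) = cB (ω' j) → ψ ω = ψ ω')
    {H : I → Ψ → ℝ} (hH : Measurable (Function.uncurry H)) {N : ℝ} (hN : ∀ z y, |H z y| ≤ N)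
    {c : ℝ} (hcH : ∀ y, c ≤ ∫ z, H z y) :
    c * P.real S ≤ ∫ ω in S, H (cA (ω j)) (ψ ω) ∂P := by
  obtain ⟨S, hS, rfl⟩ := hS
  set Q := (Measure.pi fun _ : Fin j => (volume : Measure (I × I))).prod (volume : Measure I)
  set m : Omega → ((Fin j → I × I) × I) × I :=
    fun ω => (((fun i : Fin j => ω (i : ℕ)), cB (ω j)), cA (ω j)) with hm
  have hmm : Measurable m := ((measurable_restr j).prodMk
    (hc.measurable_right.comp (measurable_pi_apply _))).prodMk
    (hc.measurable_left.comp (measurable_pi_apply _))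
  have hQ : P.map m = Q.prod volume := map_restr_coord hP hc j
  set ψ' : (Fin j → I × I) × I → Ψ := fun q => ψ (extend j (q.2, q.2) q.1) with hψ'def
  have hψ'm : Measurable ψ' := hψ.comp ((measurable_extend j).comp
    (measurable_fst.prodMk (measurable_snd.prodMk measurable_snd)))
  have hψψ' : ∀ ω, ψ ω = ψ' (m ω).1 := fun ω => by
    refine hψ' _ _ (fun i hi => ?_) ?_
    · simp [extend, hi, hm]
    · simp [extend, hm, hc.diag_right]
  set S' : Set (((Fin j → I × I) × I) × I) := (S ×ˢ univ) ×ˢ univ with hS'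
  have hS'm : MeasurableSet S' := (hS.prod .univ).prod .univ
  have hpre : (fun (ω : Omega) (i : Fin j) => ω (i : ℕ)) ⁻¹' S = m ⁻¹' S' := by
    ext ω; simp [hS', hm]
  have hHm : Measurable fun q : ((Fin j → I × I) × I) × I => H q.2 (ψ' q.1) :=
    hH.comp (measurable_snd.prodMk (hψ'm.comp measurable_fst))
  have h_int : Integrable (fun q : ((Fin j → I × I) × I) × I => H q.2 (ψ' q.1)) (Q.prod volume) :=
    Integrable.of_bound hHm.aestronglyMeasurable N (.of_forall fun q => hN _ _)
  rw [hpre]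
  have h1 : ∫ ω in m ⁻¹' S', H (cA (ω j)) (ψ ω) ∂P =
      ∫ q in S', H q.2 (ψ' q.1) ∂(Q.prod volume) := by
    rw [← hQ, setIntegral_map hS'm hHm.aestronglyMeasurable hmm.aemeasurable]
    exact setIntegral_congr_fun (hmm hS'm) fun ω _ => by simp only [hψψ' ω, hm]
  have h2 : P.real (m ⁻¹' S') = Q.real (S ×ˢ univ) := by
    rw [Measure.real, ← Measure.map_apply hmm hS'm, hQ, hS', Measure.prod_prod, measure_univ,
      mul_one, Measure.real]
  rw [h1, h2, hS', setIntegral_prod _ h_int.integrableOn]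
  simp only [Measure.restrict_univ]
  calc c * Q.real (S ×ˢ univ) = ∫ q in S ×ˢ univ, c ∂Q := by
        rw [setIntegral_const, smul_eq_mul, mul_comm]
    _ ≤ _ := by
        refine integral_mono (integrable_const _) ?_ fun q => hcH _
        exact h_int.integral_prod_left.integrableOn

end Coordinates

section Partitions

variable {T : ℝ} (π : Partition T)

theorem Partition.t_le {i j : ℕ} (hij : i ≤ j) (hj : j ≤ π.n) : π.t i ≤ π.t j := by
  induction j, hij using Nat.le_induction with
  | base => exact le_rfl
  | succ j hij ih => exact (ih (by omega)).trans (π.mono j (by omega)).le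

theorem Partition.t_mem {i : ℕ} (hi : i ≤ π.n) : π.t i ∈ Icc 0 T :=
  ⟨π.map_zero ▸ π.t_le (Nat.zero_le i) hi, by simpa [π.map_last] using π.t_le hi le_rfl⟩

theorem Partition.idx_lt (s : ℝ) : π.idx s < π.n :=
  (Nat.findGreatest_le _).trans_lt (Nat.sub_lt π.npos one_pos)

theorem Partition.t_idx_le {s : ℝ} (hs : 0 ≤ s) : π.t (π.idx s) ≤ s := by
  classical
  exact Nat.findGreatest_spec (P := fun i => π.t i ≤ s) (Nat.zero_le _)
    (by simpa [π.map_zero] using hs)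

theorem Partition.idx_eq {j : ℕ} (hj : j < π.n) {s : ℝ} (hs : s ∈ Ico (π.t j) (π.t (j + 1))) :
    π.idx s = j := by
  classical
  refine le_antisymm ?_ (Nat.le_findGreatest (by omega) hs.1)
  by_contra! h
  have h1 : π.t (π.idx s) ≤ s := π.t_idx_le ((π.t_mem hj.le).1.trans hs.1)
  have h2 := π.t_le (Nat.succ_le_of_lt h) (π.idx_lt s).le
  exact absurd hs.2 (not_lt.2 (h2.trans h1))

theorem Partition.idx_mono {s s' : ℝ} (h : s ≤ s') : π.idx s ≤ π.idx s' := by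
  classical
  exact Nat.findGreatest_mono_left (fun i hi => le_trans hi h) _

theorem Partition.measurable_idx : Measurable π.idx :=
  Monotone.measurable fun _ _ h => π.idx_mono h

theorem Partition.idx_le_of_lt {j : ℕ} {s : ℝ} (hs0 : 0 ≤ s)
    (hs : s < π.t (j + 1)) : π.idx s ≤ j := by
  by_contra! h
  exact absurd hs (not_lt.2 ((π.t_le (Nat.succ_le_of_lt h) (π.idx_lt s).le).trans (π.t_idx_le hs0)))

theorem Partition.sub_le_mesh {i : ℕ} (hi : i < π.n) : π.t (i + 1) - π.t i ≤ π.mesh :=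
  Finset.le_sup' (fun i => π.t (i + 1) - π.t i) (Finset.mem_range.2 hi)

theorem Partition.mesh_nonneg : 0 ≤ π.mesh :=
  (sub_nonneg.2 (π.mono 0 π.npos).le).trans (π.sub_le_mesh π.npos)

/-- The partition of `[t,T]` induced by `π`, with the points before `t` moved to `t`. -/
def Partition.node (t : ℝ) (j : ℕ) : ℝ := max (π.t j) t

theorem Partition.node_le_succ (t : ℝ) {j : ℕ} (hj : j < π.n) : π.node t j ≤ π.node t (j + 1) :=
  max_le_max (π.mono j hj).le le_rfl

theorem Partition.le_node (t : ℝ) (j : ℕ) : t ≤ π.node t j := le_max_right _ _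

theorem Partition.node_mem {t : ℝ} (ht : t ∈ Icc 0 T) {j : ℕ} (hj : j ≤ π.n) :
    π.node t j ∈ Icc t T :=
  ⟨le_max_right _ _, max_le (π.t_mem hj).2 ht.2⟩

theorem Partition.node_zero {t : ℝ} (ht : 0 ≤ t) : π.node t 0 = t := by
  rw [Partition.node, π.map_zero, max_eq_right ht]

theorem Partition.node_last {t : ℝ} (ht : t ≤ T) : π.node t π.n = T := by
  rw [Partition.node, π.map_last, max_eq_left ht]

theorem Partition.node_sub_le_mesh (t : ℝ) {j : ℕ} (hj : j < π.n) :
    π.node t (j + 1) - π.node t j ≤ π.mesh := by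
  have h1 := π.sub_le_mesh hj
  have h2 := π.mesh_nonneg
  have h3 := le_max_left (π.t j) t
  have h4 := le_max_right (π.t j) t
  have h5 : π.node t (j + 1) ≤ π.node t j + π.mesh :=
    max_le (by unfold Partition.node; linarith) (by unfold Partition.node; linarith)
  linarith

theorem Partition.Ico_node_subset (t : ℝ) (j : ℕ) :
    Ico (π.node t j) (π.node t (j + 1)) ⊆ Ico (π.t j) (π.t (j + 1)) := by
  rintro r ⟨h1, h2⟩
  refine ⟨(le_max_left _ _).trans h1, ?_⟩
  rcases lt_max_iff.1 h2 with h | h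
  · exact h
  · exact absurd ((le_max_right _ _).trans h1) (not_le.2 h)

end Partitions

section Strategies

variable {T : ℝ}

/-- Admissible controls along a partition for a player who observes the coordinate `c` of the
current sample. -/
def Adm (c : I × I → I) (A : Type) [MeasurableSpace A] (π : Partition T) : Set (ℝ → Omega → A) :=
  {u | Measurable (Function.uncurry u) ∧
    ∀ j < π.n, ∃ (Γ : ℕ → Set Omega) (w : ℕ → ℝ → Omega → A),
      (∀ k, MeasurableSet[Fsig j] (Γ k)) ∧
      Pairwise (Function.onFun Disjoint Γ) ∧
      (⋃ k, Γ k) = univ ∧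
      (∀ k s, Measurable[MeasurableSpace.comap (fun ω : Omega => c (ω j)) inferInstance] (w k s)) ∧
      (∀ k, ∀ ω ∈ Γ k, ∀ s ∈ Ico (π.t j) (π.t (j + 1)), u s ω = w k s ω)}

/-- Nonanticipative strategies with delay, with both players treated symmetrically. -/
def NAD (cA cB : I × I → I) {A B : Type} [MeasurableSpace A] [MeasurableSpace B]
    (P : Measure Omega) (π : Partition T) (t : ℝ) (α : (ℝ → Omega → B) → (ℝ → Omega → A)) : Prop :=
  (∀ v ∈ Adm cB B π, α v ∈ Adm cA A π) ∧
  ∀ τ : Omega → ℕ, IsStoppingIdx π τ →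
    ∀ v v', v ∈ Adm cB B π → v' ∈ Adm cB B π →
      aeStEq P t (fun ω => π.t (τ ω)) v v' →
      aeStEq P t (fun ω => π.t (τ ω + 1)) (α v) (α v')

variable {d : ℕ} {A B : Type} [MetricSpace A] [CompactSpace A] [MeasurableSpace A] [BorelSpace A]
  [MetricSpace B] [CompactSpace B] [MeasurableSpace B] [BorelSpace B]
  [Nonempty A] [Nonempty B]

theorem apply_eq_of_measurable_comap {Ψ : Type*} [MeasurableSpace Ψ] {h : Omega → Ψ} {w : Omega → A}
    (hw : Measurable[MeasurableSpace.comap h inferInstance] w) {ω ω' : Omega} (hh : h ω = h ω') :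
    w ω = w ω' := by
  obtain ⟨S, -, hS⟩ := hw (measurableSet_singleton (w ω))
  have h1 : ω ∈ h ⁻¹' S := hS ▸ rfl
  have h2 : ω' ∈ h ⁻¹' S := by rwa [mem_preimage, ← hh]
  rw [hS] at h2
  exact h2.symm

/-- On the `j`-th interval an admissible control only depends on the first `j` samples and on the
own coordinate of the current sample. -/
theorem Adm.eq_of_agree {c : I × I → I} {π : Partition T} {u : ℝ → Omega → A} (hu : u ∈ Adm c A π)
    {j : ℕ} (hj : j < π.n) {s : ℝ} (hs : s ∈ Ico (π.t j) (π.t (j + 1))) {ω ω' : Omega}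
    (h : ∀ i < j, ω i = ω' i) (hc : c (ω j) = c (ω' j)) : u s ω = u s ω' := by
  obtain ⟨Γ, w, hΓ, -, hU, hw, huw⟩ := hu.2 j hj
  obtain ⟨k, hk⟩ := mem_iUnion.1 (hU ▸ mem_univ ω)
  rw [huw k ω hk s hs, huw k ω' ((mem_iff_of_Fsig (hΓ k) h).1 hk) s hs]
  exact apply_eq_of_measurable_comap (hw k s) hc

/-- The explicit Euler state driven by a feedback law: on the `j`-th interval the maximizer plays
`φ j k`, evaluated at his fresh sample, when the state is in the cell `k`. -/
def euler (f : ℝ → Euc d → A → B → Euc d) (π : Partition T) (cA : I × I → I) (cell : Euc d → ℕ)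
    (φ : ℕ → ℕ → I → A) (t : ℝ) (x : Euc d) (v : ℝ → Omega → B) : ℕ → Omega → Euc d
  | 0, _ => x
  | j + 1, ω => euler f π cA cell φ t x v j ω + ∫ r in Ico (π.node t j) (π.node t (j + 1)),
      clampDyn f T r (euler f π cA cell φ t x v j ω)
        (φ j (cell (euler f π cA cell φ t x v j ω)) (cA (ω j))) (v r ω)

/-- The strategy given by a feedback law. -/
def feedback (f : ℝ → Euc d → A → B → Euc d) (π : Partition T) (cA : I × I → I) (cell : Euc d → ℕ)
    (φ : ℕ → ℕ → I → A) (t : ℝ) (x : Euc d) (v : ℝ → Omega → B) : ℝ → Omega → A :=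
  fun s ω => φ (π.idx s) (cell (euler f π cA cell φ t x v (π.idx s) ω)) (cA (ω (π.idx s)))

variable {f : ℝ → Euc d → A → B → Euc d} {C : ℝ} {K : ℝ≥0} {π : Partition T} {cA cB : I × I → I}
  {cell : Euc d → ℕ} {φ : ℕ → ℕ → I → A} {t : ℝ} {x : Euc d}

theorem euler_congr {v v' : ℝ → Omega → B} {ω ω' : Omega} (j : ℕ)
    (h : ∀ i < j, cA (ω i) = cA (ω' i))
    (hv : ∀ i < j, ∀ᵐ r, r ∈ Ico (π.node t i) (π.node t (i + 1)) → v r ω = v' r ω') :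
    euler f π cA cell φ t x v j ω = euler f π cA cell φ t x v' j ω' := by
  induction j with
  | zero => rfl
  | succ j ih =>
    have h1 := ih (fun i hi => h i (by omega)) fun i hi => hv i (by omega)
    simp only [euler]
    rw [h1, h j (by omega)]
    congr 1
    refine setIntegral_congr_ae measurableSet_Ico ?_
    filter_upwards [hv j (by omega)] with r hr hr'
    rw [hr hr']

theorem euler_eq_of_agree {v : ℝ → Omega → B} (hv : v ∈ Adm cB B π) {j : ℕ} (hj : j ≤ π.n)
    {ω ω' : Omega} (h : ∀ i < j, ω i = ω' i) :
    euler f π cA cell φ t x v j ω = euler f π cA cell φ t x v j ω' :=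
  euler_congr j (fun i hi => congrArg cA (h i hi)) fun i hi => ae_of_all _ fun r hr =>
    Adm.eq_of_agree hv (by omega) (π.Ico_node_subset t i hr) (fun k hk => h k (by omega))
      (congrArg cB (h i hi))

theorem measurable_euler (hf : Dyn f T C K) (hcA : Measurable cA) (hcell : Measurable cell)
    (hφ : ∀ j k, Measurable (φ j k)) {v : ℝ → Omega → B} (hv : Measurable (Function.uncurry v))
    (j : ℕ) : Measurable (euler f π cA cell φ t x v j) := by
  induction j with
  | zero => exact measurable_const
  | succ j ih =>
    have h1 : Measurable fun q : Omega × ℝ => clampDyn f T q.2 (euler f π cA cell φ t x v j q.1)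
        (φ j (cell (euler f π cA cell φ t x v j q.1)) (cA (q.1 j))) (v q.2 q.1) := by
      have h2 : Measurable fun p : ℕ × I => φ j p.1 p.2 :=
        measurable_from_prod_countable_right fun k => hφ j k
      have h3 : Measurable fun q : Omega × ℝ => euler f π cA cell φ t x v j q.1 :=
        ih.comp measurable_fst
      refine hf.continuous_clampDyn.measurable.comp (measurable_snd.prodMk (h3.prodMk
        ((h2.comp ((hcell.comp h3).prodMk (hcA.comp ((measurable_pi_apply j).comp
          measurable_fst)))).prodMk (hv.comp measurable_swap))))
    exact ih.add (h1.stronglyMeasurable.integral_prod_right'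
      (ν := volume.restrict (Ico (π.node t j) (π.node t (j + 1))))).measurable

theorem measurable_feedback (hf : Dyn f T C K) (hcA : Measurable cA) (hcell : Measurable cell)
    (hφ : ∀ j k, Measurable (φ j k)) {v : ℝ → Omega → B} (hv : Measurable (Function.uncurry v)) :
    Measurable (Function.uncurry (feedback f π cA cell φ t x v)) := by
  have h1 : Measurable fun p : ℕ × Omega =>
      φ p.1 (cell (euler f π cA cell φ t x v p.1 p.2)) (cA (p.2 p.1)) :=
    measurable_from_prod_countable_right fun j => by
      have h2 : Measurable fun p : ℕ × I => φ j p.1 p.2 :=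
        measurable_from_prod_countable_right fun k => hφ j k
      exact h2.comp ((hcell.comp (measurable_euler hf hcA hcell hφ hv j)).prodMk
        (hcA.comp (measurable_pi_apply j)))
  exact h1.comp (f := fun p : ℝ × Omega => (π.idx p.1, p.2))
    ((π.measurable_idx.comp measurable_fst).prodMk measurable_snd)

theorem feedback_mem (hf : Dyn f T C K) (hcA : Measurable cA) (hcell : Measurable cell)
    (hφ : ∀ j k, Measurable (φ j k)) {v : ℝ → Omega → B} (hv : v ∈ Adm cB B π) :
    feedback f π cA cell φ t x v ∈ Adm cA A π := by
  refine ⟨measurable_feedback hf hcA hcell hφ hv.1, fun j hj =>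
    ⟨fun k => {ω | cell (euler f π cA cell φ t x v j ω) = k}, fun k _ ω => φ j k (cA (ω j)),
      fun k => ?_, fun k k' hkk' => ?_, ?_, fun k s => ?_, fun k ω hω s hs => ?_⟩⟩
  · have h1 : Measurable[Fsig j] (euler f π cA cell φ t x v j) :=
      measurable_Fsig (measurable_euler hf hcA hcell hφ hv.1 j) fun ω ω' h =>
        euler_eq_of_agree hv hj.le h
    exact (hcell.comp h1) (measurableSet_singleton k)
  · exact disjoint_left.2 fun ω h1 h2 => hkk' (h1.symm.trans h2)
  · exact eq_univ_of_forall fun ω => mem_iUnion.2 ⟨_, rfl⟩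
  · exact (hφ j k).comp (comap_measurable _)
  · simp only [feedback, π.idx_eq hj hs]
    rw [show cell (euler f π cA cell φ t x v j ω) = k from hω]

theorem ae_ae_of_ae_prod' {P : Measure Omega} [SFinite P] {R : ℝ → Omega → Prop}
    (h : ∀ᵐ p ∂((volume : Measure ℝ).prod P), R p.1 p.2) : ∀ᵐ ω ∂P, ∀ᵐ s, R s ω :=
  Measure.ae_ae_of_ae_prod (Measure.measurePreserving_swap.quasiMeasurePreserving.ae h)

theorem Partition.ae_ne (π : Partition T) : ∀ᵐ s : ℝ, ∀ i, s ≠ π.t i :=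
  ae_all_iff.2 fun i => (measure_singleton (π.t i) : volume {π.t i} = 0) |> fun h =>
    compl_mem_ae_iff.2 h

theorem feedback_nad (hf : Dyn f T C K) (hcA : Measurable cA) (hcell : Measurable cell)
    (hφ : ∀ j k, Measurable (φ j k)) (P : Measure Omega) [SFinite P] (ht : 0 ≤ t) :
    NAD cA cB P π t (feedback f π cA cell φ t x : (ℝ → Omega → B) → ℝ → Omega → A) := by
  refine ⟨fun v hv => feedback_mem hf hcA hcell hφ hv, fun τ hτ v v' _ _ h => ?_⟩
  have h1 := (Measure.quasiMeasurePreserving_snd (μ := (volume : Measure ℝ)) (ν := P)).ae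
    (ae_ae_of_ae_prod' (R := fun s ω => t ≤ s → s ≤ π.t (τ ω) → v s ω = v' s ω) h)
  have h2 := (Measure.quasiMeasurePreserving_fst (μ := (volume : Measure ℝ)) (ν := P)).ae π.ae_ne
  filter_upwards [h1, h2] with p hp1 hp2 hp3 hp4
  have hlt : p.1 < π.t (τ p.2 + 1) := lt_of_le_of_ne hp4 (hp2 _)
  have hle : π.idx p.1 ≤ τ p.2 := π.idx_le_of_lt (ht.trans hp3) hlt
  simp only [feedback]
  rw [euler_congr (v := v) (v' := v') (ω := p.2) (ω' := p.2) (π.idx p.1) (fun _ _ => rfl)]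
  intro i hi
  filter_upwards [hp1] with r hr hri
  refine hr ((π.le_node t i).trans hri.1) ?_
  exact (π.Ico_node_subset t i hri).2.le.trans (π.t_le (by omega) (hτ.1 p.2).le)

end Strategies

section Tracking

variable {T : ℝ} {d : ℕ} {A B : Type} [MetricSpace A] [CompactSpace A] [MeasurableSpace A]
  [BorelSpace A] [MetricSpace B] [CompactSpace B] [MeasurableSpace B] [BorelSpace B]
  [Nonempty A] [Nonempty B]

variable {f : ℝ → Euc d → A → B → Euc d} {C : ℝ} {K : ℝ≥0} {π : Partition T} {cA cB : I × I → I}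
  {cell : Euc d → ℕ} {φ : ℕ → ℕ → I → A} {t : ℝ} {x : Euc d}

theorem IsSol.sub_eq (hf : Dyn f T C K) (ht : 0 ≤ t) {u : ℝ → A} {v : ℝ → B} (hu : Measurable u)
    (hv : Measurable v) {X : ℝ → Euc d} (hX : IsSol f T t x u v X) {r s : ℝ} (hr : r ∈ Icc t T)
    (hs : s ∈ Icc r T) : X s = X r + ∫ w in r..s, f w (X w) (u w) (v w) := by
  have hi := hX.intervalIntegrable hf ht (hr.1.trans hr.2) hu hv
  rw [hX.2 s ⟨hr.1.trans hs.1, hs.2⟩, hX.2 r hr, add_assoc,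
    intervalIntegral.integral_add_adjacent_intervals]
  · exact hi.mono_set (by
      rw [uIcc_of_le hr.1, uIcc_of_le (hr.1.trans hr.2)]; exact Icc_subset_Icc_right hr.2)
  · exact hi.mono_set (by
      rw [uIcc_of_le hs.1, uIcc_of_le (hr.1.trans hr.2)]; exact Icc_subset_Icc hr.1 hs.2)

theorem IsSol.norm_sub_le (hf : Dyn f T C K) (ht : 0 ≤ t) {u : ℝ → A} {v : ℝ → B}
    (hu : Measurable u) (hv : Measurable v) {X : ℝ → Euc d} (hX : IsSol f T t x u v X) {r s : ℝ}
    (hr : r ∈ Icc t T) (hs : s ∈ Icc r T) : ‖X s - X r‖ ≤ C * (s - r) := by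
  rw [hX.sub_eq hf ht hu hv hr hs, add_sub_cancel_left]
  refine (intervalIntegral.norm_integral_le_of_norm_le_const fun w _ => hf.bdd _ _ _ _).trans ?_
  rw [abs_of_nonneg (sub_nonneg.2 hs.1)]

theorem norm_euler_succ_sub_le (hf : Dyn f T C K) (v : ℝ → Omega → B) {j : ℕ} (hj : j < π.n)
    (ω : Omega) :
    ‖euler f π cA cell φ t x v (j + 1) ω - euler f π cA cell φ t x v j ω‖ ≤
      C * (π.node t (j + 1) - π.node t j) := by
  simp only [euler]
  rw [add_sub_cancel_left]
  refine (norm_setIntegral_le_of_norm_le_const measure_Ico_lt_top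
    fun r _ => hf.bdd _ _ _ _).trans ?_
  rw [Real.volume_real_Ico_of_le (π.node_le_succ t hj)]

theorem norm_euler_sub_le (hf : Dyn f T C K) (ht : 0 ≤ t) (v : ℝ → Omega → B) {j : ℕ}
    (hj : j ≤ π.n) (ω : Omega) :
    ‖euler f π cA cell φ t x v j ω - x‖ ≤ C * (π.node t j - t) := by
  induction j with
  | zero => simp [euler, π.node_zero ht]
  | succ j ih =>
    have h1 := ih (by omega)
    have h2 := norm_euler_succ_sub_le (cA := cA) (cell := cell) (φ := φ) (t := t) (x := x) hf v
      (show j < π.n by omega) ω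
    have h3 := norm_sub_le_norm_sub_add_norm_sub (euler f π cA cell φ t x v (j + 1) ω)
      (euler f π cA cell φ t x v j ω) x
    linarith

/-- The explicit Euler state tracks the controlled state. -/
theorem norm_sub_euler_le (hf : Dyn f T C K) (ht : t ∈ Icc 0 T) (hcA : Measurable cA)
    (hcell : Measurable cell) (hφ : ∀ j k, Measurable (φ j k)) {v : ℝ → Omega → B}
    (hv : Measurable (Function.uncurry v)) {ω : Omega} {X : ℝ → Euc d}
    (hX : IsSol f T t x (fun s => feedback f π cA cell φ t x v s ω) (fun s => v s ω) X) {j : ℕ}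
    (hj : j ≤ π.n) :
    ‖X (π.node t j) - euler f π cA cell φ t x v j ω‖ + C * π.mesh ≤
      C * π.mesh * Real.exp (K * (π.node t j - t)) := by
  have hum : Measurable fun s => feedback f π cA cell φ t x v s ω :=
    (measurable_feedback hf hcA hcell hφ hv).comp (measurable_id.prodMk measurable_const)
  have hvm : Measurable fun s => v s ω := hv.comp (measurable_id.prodMk measurable_const)
  have hC := hf.nonneg
  have hm := π.mesh_nonneg
  induction j with
  | zero =>
    have h1 : X t = x := by rw [hX.2 t ⟨le_rfl, ht.2⟩]; simp
    simp [π.node_zero ht.1, h1, euler]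
  | succ j ih =>
    have hj' : j < π.n := by omega
    have h1 := ih hj'.le
    set r := π.node t j with hr
    set s := π.node t (j + 1) with hs
    set Y := euler f π cA cell φ t x v j ω with hY
    have hrs : r ≤ s := π.node_le_succ t hj'
    have hrm : r ∈ Icc t T := π.node_mem ht hj'.le
    have hsm : s ∈ Icc t T := π.node_mem ht hj
    set E := ‖X r - Y‖ with hE
    have hXs := hX.sub_eq hf ht.1 hum hvm hrm ⟨hrs, hsm.2⟩
    have hYs : euler f π cA cell φ t x v (j + 1) ω = Y + ∫ w in r..s,
        clampDyn f T w Y (φ j (cell Y) (cA (ω j))) (v w ω) := by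
      simp only [euler]
      rw [intervalIntegral.integral_of_le hrs, integral_Ico_eq_integral_Ioc]
    have hi1 : IntervalIntegrable (fun w => f w (X w) (feedback f π cA cell φ t x v w ω) (v w ω))
        volume r s :=
      (hX.intervalIntegrable hf ht.1 ht.2 hum hvm).mono_set (by
        rw [uIcc_of_le hrs, uIcc_of_le ht.2]; exact Icc_subset_Icc hrm.1 hsm.2)
    have hi2 : IntervalIntegrable (fun w => clampDyn f T w Y (φ j (cell Y) (cA (ω j))) (v w ω))
        volume r s := by
      rw [intervalIntegrable_iff_integrableOn_Ioc_of_le hrs]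
      refine Integrable.of_bound ?_ C (ae_of_all _ fun w => hf.bdd _ _ _ _)
      exact (hf.continuous_clampDyn.measurable.comp (measurable_id.prodMk (measurable_const.prodMk
        (measurable_const.prodMk hvm)))).aestronglyMeasurable
    have h2 : ‖(∫ w in r..s, f w (X w) (feedback f π cA cell φ t x v w ω) (v w ω)) -
        ∫ w in r..s, clampDyn f T w Y (φ j (cell Y) (cA (ω j))) (v w ω)‖ ≤
        K * (E + C * π.mesh) * (s - r) := by
      rw [← intervalIntegral.integral_sub hi1 hi2]
      refine (intervalIntegral.norm_integral_le_of_norm_le_const_ae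
        (C := K * (E + C * π.mesh)) ?_).trans (by rw [abs_of_nonneg (sub_nonneg.2 hrs)])
      filter_upwards [(measure_singleton s : volume {s} = 0) |> compl_mem_ae_iff.2] with w hws hw
      rw [uIoc_of_le hrs] at hw
      have hwI : w ∈ Ico r s := ⟨hw.1.le, lt_of_le_of_ne hw.2 hws⟩
      have hidx : π.idx w = j := π.idx_eq hj' (π.Ico_node_subset t j hwI)
      have hfb : feedback f π cA cell φ t x v w ω = φ j (cell Y) (cA (ω j)) := by
        simp only [feedback, hidx, hY]
      rw [hfb, clampDyn_of_mem ⟨ht.1.trans (hrm.1.trans hw.1.le), hw.2.trans hsm.2⟩]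
      refine (hf.norm_sub_le _ _ _ _ _).trans ?_
      gcongr
      have h3 := hX.norm_sub_le hf ht.1 hum hvm hrm (s := w) ⟨hw.1.le, hw.2.trans hsm.2⟩
      have h4 := norm_sub_le_norm_sub_add_norm_sub (X w) (X r) Y
      have h5 : C * (w - r) ≤ C * π.mesh := by
        gcongr
        linarith [hw.2, π.node_sub_le_mesh t hj']
      linarith
    have h3 : ‖X s - euler f π cA cell φ t x v (j + 1) ω‖ ≤ E + K * (E + C * π.mesh) * (s - r) := by
      rw [hXs, hYs, add_sub_add_comm]
      exact (norm_add_le _ _).trans (by gcongr)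
    have h4 : (1 : ℝ) + K * (s - r) ≤ Real.exp (K * (s - r)) := by
      rw [add_comm]; exact Real.add_one_le_exp _
    calc ‖X s - euler f π cA cell φ t x v (j + 1) ω‖ + C * π.mesh
        ≤ (E + C * π.mesh) * (1 + K * (s - r)) := by linarith
      _ ≤ (C * π.mesh * Real.exp (K * (r - t))) * Real.exp (K * (s - r)) := by
        gcongr
      _ = C * π.mesh * Real.exp (K * (s - t)) := by
        rw [mul_assoc, ← Real.exp_add]; congr 2; ring

end Tracking

section OneStep

variable {T : ℝ} {d : ℕ} {A B : Type} [MetricSpace A] [CompactSpace A] [MeasurableSpace A]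
  [BorelSpace A] [MetricSpace B] [CompactSpace B] [MeasurableSpace B] [BorelSpace B]
  [Nonempty A] [Nonempty B]

variable {f : ℝ → Euc d → A → B → Euc d} {C : ℝ} {K : ℝ≥0} {π : Partition T} {cA cB : I × I → I}
  {cell : Euc d → ℕ} {t : ℝ} {x : Euc d}

/-- The quadratic function of slope `(q, p)` and curvature `-2Λ` touching `Z` at `(s, c)` stays
below `Z`. -/
def LowerTangent (T : ℝ) (Z : ℝ → Euc d → ℝ) (Λ : ℝ) (s : ℝ) (c : Euc d) (q : ℝ) (p : Euc d) :
    Prop :=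
  ∀ t' ∈ Icc 0 T, ∀ x', Z s c + q * (t' - s) + ⟪p, x' - c⟫
    - Λ * ((t' - s) ^ 2 + ‖x' - c‖ ^ 2) ≤ Z t' x'

theorem exists_feedback_data (hf : Dyn f T C K) {Z : ℝ → Euc d → ℝ} {Λ η R κ : ℝ} (hΛ : 0 ≤ Λ)
    (hκ : 0 < κ)
    (hZ : ∀ s ∈ Icc 0 T, ∀ c, ∃ (q : ℝ) (p : Euc d), |q| ≤ Λ ∧ ‖p‖ ≤ Λ ∧
      LowerTangent T Z Λ s c q p ∧ (s < T - η → ‖c‖ ≤ R → -κ ≤ q + ham A B f s c p))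
    (s : ℝ) (c : Euc d) :
    ∃ (q : ℝ) (p : Euc d) (φ : I → A), |q| ≤ Λ ∧ ‖p‖ ≤ Λ ∧ Measurable φ ∧
      (∀ b, -(2 * κ) ≤ ∫ z, (q + ⟪clampDyn f T s c (φ z) b, p⟫)) ∧
      (s ∈ Icc 0 T → s < T - η → ‖c‖ ≤ R → LowerTangent T Z Λ s c q p) := by
  by_cases h : s ∈ Icc 0 T ∧ s < T - η ∧ ‖c‖ ≤ R
  · obtain ⟨hs, hsη, hc⟩ := h
    obtain ⟨q, p, hq, hp, ht, hh⟩ := hZ s hs c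
    have hh' := hh hsη hc
    rw [ham_eq_gval hf hs] at hh'
    have hcont := hf.continuous_inner hs c p
    obtain ⟨μ, hμ⟩ := exists_lower_optimal hcont hκ
    obtain ⟨φ, hφ, hφμ⟩ := Measure.exists_measurable_map_eq (μ : Measure A)
    refine ⟨q, p, φ, hq, hp, hφ, fun b => ?_, fun _ _ _ => ht⟩
    have hcb : Continuous fun a => ⟪f s c a b, p⟫ :=
      hcont.comp (continuous_id.prodMk continuous_const)
    have h1 := hμ b
    have h2 : Integrable (fun z => ⟪f s c (φ z) b, p⟫) (volume : Measure I) := by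
      refine Integrable.of_bound (hcb.measurable.comp hφ).aestronglyMeasurable (C * ‖p‖)
        (ae_of_all _ fun z => ?_)
      exact (norm_inner_le_norm _ _).trans (by gcongr; exact hf.bdd _ _ _ _)
    rw [← hφμ, integral_map hφ.aemeasurable hcb.measurable.aestronglyMeasurable] at h1
    rw [clampDyn_of_mem hs, integral_add (integrable_const _) h2]
    simp only [integral_const, probReal_univ, one_smul]
    linarith
  · refine ⟨0, 0, fun _ => Classical.arbitrary A, by simpa, by simpa, measurable_const,
      fun b => ?_, fun h1 h2 h3 => absurd ⟨h1, h2, h3⟩ h⟩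
    simp only [inner_zero_right, add_zero, integral_zero]
    linarith

theorem lipschitz_of_lowerTangent {Z : ℝ → Euc d → ℝ} {Λ s : ℝ} (hs : s ∈ Icc 0 T)
    (hZ : ∀ c, ∃ (q : ℝ) (p : Euc d), ‖p‖ ≤ Λ ∧ LowerTangent T Z Λ s c q p) (y c : Euc d) :
    Z s y - Λ * ‖c - y‖ - Λ * ‖c - y‖ ^ 2 ≤ Z s c := by
  obtain ⟨q, p, hp, h⟩ := hZ y
  have h1 := h s hs c
  have h2 := (abs_le.1 (abs_real_inner_le_norm p (c - y))).1
  have h3 : ‖p‖ * ‖c - y‖ ≤ Λ * ‖c - y‖ := by gcongr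
  simp only [sub_self, mul_zero, add_zero, ne_eq, OfNat.ofNat_ne_zero, not_false_eq_true,
    zero_pow, zero_add] at h1
  linarith

theorem continuous_of_lowerTangent {Z : ℝ → Euc d → ℝ} {Λ s : ℝ} (hs : s ∈ Icc 0 T)
    (hZ : ∀ c, ∃ (q : ℝ) (p : Euc d), ‖p‖ ≤ Λ ∧ LowerTangent T Z Λ s c q p) :
    Continuous (Z s) := by
  refine continuous_iff_continuousAt.2 fun y => ?_
  have hF : Tendsto (fun c : Euc d => Λ * ‖c - y‖ + Λ * ‖c - y‖ ^ 2) (𝓝 y) (𝓝 0) := by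
    have hc : Continuous fun c : Euc d => Λ * ‖c - y‖ + Λ * ‖c - y‖ ^ 2 := by fun_prop
    simpa using hc.tendsto y
  refine tendsto_iff_dist_tendsto_zero.2 (squeeze_zero (fun _ => dist_nonneg) (fun c => ?_) hF)
  have h1 := lipschitz_of_lowerTangent hs hZ y c
  have h2 := lipschitz_of_lowerTangent hs hZ c y
  rw [norm_sub_rev y c] at h2
  rw [Real.dist_eq, abs_le]
  constructor <;> linarith

/-- One step of the feedback dynamics, along a path. -/
theorem le_one_step (hf : Dyn f T C K) {Z : ℝ → Euc d → ℝ} {Λ κ ρ : ℝ} (hΛ : 0 ≤ Λ)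
    (hρ : 0 ≤ ρ) (hρ1 : ρ ≤ 1) {s s' : ℝ} (hs : s ∈ Icc 0 T) (hs' : s' ∈ Icc s T)
    (hZ : ∀ c, ∃ (q : ℝ) (p : Euc d), ‖p‖ ≤ Λ ∧ LowerTangent T Z Λ s c q p)
    {y c : Euc d} (hyc : ‖y - c‖ ≤ ρ) {q : ℝ} {p : Euc d} (hp : ‖p‖ ≤ Λ)
    (hqp : LowerTangent T Z Λ s c q p) (a : A) {v : ℝ → B} (hv : Measurable v)
    (hmod : ∀ r ∈ Ico s s', ∀ b, ‖f r c a b - f s c a b‖ ≤ κ) :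
    Z s y + (∫ r in Ico s s', (q + ⟪clampDyn f T s c a (v r), p⟫)) -
      (ρ * (5 * Λ + T * Λ * K) + (s' - s) * (Λ * κ + Λ * (s' - s) * (1 + 2 * C ^ 2))) ≤
    Z s' (y + ∫ r in Ico s s', clampDyn f T r y a (v r)) := by
  set J := ∫ r in Ico s s', clampDyn f T r y a (v r) with hJ
  have hC := hf.nonneg
  have hΔ : 0 ≤ s' - s := sub_nonneg.2 hs'.1
  have hΔT : s' - s ≤ T := by linarith [hs'.2, hs.1]
  have hs'T : s' ∈ Icc 0 T := ⟨hs.1.trans hs'.1, hs'.2⟩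
  have hJn : ‖J‖ ≤ C * (s' - s) := by
    refine (norm_setIntegral_le_of_norm_le_const measure_Ico_lt_top
      fun r _ => hf.bdd _ _ _ _).trans ?_
    rw [Real.volume_real_Ico_of_le hs'.1]
  have h1 := hqp s' hs'T (y + J)
  have h2 := lipschitz_of_lowerTangent hs hZ y c
  rw [norm_sub_rev] at h2
  have h3 : Λ * ‖y - c‖ ≤ Λ * ρ := by gcongr
  have h4 : Λ * ‖y - c‖ ^ 2 ≤ Λ * ρ := by
    have : ‖y - c‖ ^ 2 ≤ ρ := by nlinarith [norm_nonneg (y - c)]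
    gcongr
  have h5 : y + J - c = (y - c) + J := by abel
  have h6 : ‖y + J - c‖ ^ 2 ≤ 2 * ρ + 2 * C ^ 2 * (s' - s) ^ 2 := by
    have h7 : ‖y + J - c‖ ≤ ρ + C * (s' - s) := by
      rw [h5]; exact (norm_add_le _ _).trans (add_le_add hyc hJn)
    have h8 : ‖y + J - c‖ ^ 2 ≤ (ρ + C * (s' - s)) ^ 2 := by gcongr
    nlinarith [sq_nonneg (ρ - C * (s' - s))]
  have h7 : -(Λ * ρ) ≤ ⟪p, y - c⟫ := by
    have h8 := (abs_le.1 (abs_real_inner_le_norm p (y - c))).1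
    have h9 : ‖p‖ * ‖y - c‖ ≤ Λ * ρ := by gcongr
    linarith
  have hm1 : Measurable fun r => clampDyn f T r y a (v r) :=
    hf.continuous_clampDyn.measurable.comp
      (measurable_id.prodMk (measurable_const.prodMk (measurable_const.prodMk hv)))
  have hm2 : Measurable fun r => clampDyn f T s c a (v r) :=
    hf.continuous_clampDyn.measurable.comp
      (measurable_const.prodMk (measurable_const.prodMk (measurable_const.prodMk hv)))
  have hi0 : IntegrableOn (fun r => clampDyn f T r y a (v r)) (Ico s s') :=
    Integrable.of_bound hm1.aestronglyMeasurable C (ae_of_all _ fun r => hf.bdd _ _ _ _)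
  have hi1 : IntegrableOn (fun r => ⟪p, clampDyn f T r y a (v r)⟫) (Ico s s') :=
    hi0.const_inner p
  have hi2' : IntegrableOn (fun r => clampDyn f T s c a (v r)) (Ico s s') :=
    Integrable.of_bound hm2.aestronglyMeasurable C (ae_of_all _ fun r => hf.bdd _ _ _ _)
  have hi2 : IntegrableOn (fun r => ⟪clampDyn f T s c a (v r), p⟫) (Ico s s') :=
    Integrable.inner_const (𝕜 := ℝ) hi2' p
  have h8 : ⟪p, J⟫ = ∫ r in Ico s s', ⟪p, clampDyn f T r y a (v r)⟫ := (integral_inner hi0 p).symm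
  have h9 : (∫ r in Ico s s', (q + ⟪clampDyn f T s c a (v r), p⟫)) - (s' - s) * (Λ * (K * ρ + κ)) ≤
      q * (s' - s) + ⟪p, J⟫ := by
    have e1 : ∫ _ in Ico s s', Λ * (K * ρ + κ) = (s' - s) * (Λ * (K * ρ + κ)) := by
      rw [setIntegral_const, Real.volume_real_Ico_of_le hs'.1, smul_eq_mul]
    have e2 : ∫ _ in Ico s s', q = q * (s' - s) := by
      rw [setIntegral_const, Real.volume_real_Ico_of_le hs'.1, smul_eq_mul, mul_comm]
    have iq : IntegrableOn (fun _ => q) (Ico s s') := integrableOn_const (by simp)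
    have ic : IntegrableOn (fun _ => Λ * (K * ρ + κ)) (Ico s s') := integrableOn_const (by simp)
    have iq1 : IntegrableOn (fun r => q + ⟪p, clampDyn f T r y a (v r)⟫) (Ico s s') := iq.add hi1
    have iq2 : IntegrableOn (fun r => q + ⟪clampDyn f T s c a (v r), p⟫) (Ico s s') := iq.add hi2
    rw [← e1, ← e2, h8, ← integral_sub iq2 ic, ← integral_add iq hi1]
    refine setIntegral_mono_on (iq2.sub ic) iq1 measurableSet_Ico fun r hr => ?_
    have hrT : r ∈ Icc 0 T := ⟨hs.1.trans hr.1, hr.2.le.trans hs'.2⟩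
    rw [clampDyn_of_mem hrT, clampDyn_of_mem hs, real_inner_comm]
    have e3 : ‖f r y a (v r) - f s c a (v r)‖ ≤ K * ρ + κ := by
      refine (norm_sub_le_norm_sub_add_norm_sub _ (f r c a (v r)) _).trans
        (add_le_add ((hf.norm_sub_le _ _ _ _ _).trans (by gcongr)) (hmod r hr _))
    have e4 := (abs_le.1 (abs_real_inner_le_norm p (f r y a (v r) - f s c a (v r)))).1
    have e5 : ‖p‖ * ‖f r y a (v r) - f s c a (v r)‖ ≤ Λ * (K * ρ + κ) := by gcongr
    rw [inner_sub_right] at e4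
    linarith
  rw [h5, inner_add_right, ← h5] at h1
  have h10 : Λ * ‖y + J - c‖ ^ 2 ≤ Λ * (2 * ρ + 2 * C ^ 2 * (s' - s) ^ 2) := by gcongr
  have h11 : (s' - s) * (Λ * (K * ρ)) ≤ T * (Λ * (K * ρ)) := by gcongr
  linarith

end OneStep

section ExpectedStep

variable {T : ℝ} {d : ℕ} {A B : Type} [MetricSpace A] [CompactSpace A] [MeasurableSpace A]
  [BorelSpace A] [MetricSpace B] [CompactSpace B] [MeasurableSpace B] [BorelSpace B]
  [Nonempty A] [Nonempty B]

variable {f : ℝ → Euc d → A → B → Euc d} {C : ℝ} {K : ℝ≥0} {π : Partition T} {cA cB : I × I → I}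
  {cell : Euc d → ℕ} {t : ℝ} {x : Euc d} {P : Measure Omega} [IsProbabilityMeasure P]

/-- One step of the feedback dynamics, in expectation. -/
theorem setIntegral_one_step (hf : Dyn f T C K) (hP : IsProductMeasure P) (hc : Coord cA cB)
    {v : ℝ → Omega → B} (hv : v ∈ Adm cB B π) (ht : t ∈ Icc 0 T) {Z : ℝ → Euc d → ℝ}
    {Λ M κ κ' ρ : ℝ} (hΛ : 0 ≤ Λ) (hρ : 0 ≤ ρ) (hρ1 : ρ ≤ 1)
    (hZM : ∀ s ∈ Icc 0 T, ∀ y, |Z s y| ≤ M)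
    (hZ : ∀ s ∈ Icc 0 T, ∀ c, ∃ (q : ℝ) (p : Euc d), ‖p‖ ≤ Λ ∧ LowerTangent T Z Λ s c q p)
    (hcell : Measurable cell) {φ : ℕ → ℕ → I → A} (hφ : ∀ j k, Measurable (φ j k))
    {ctr : ℕ → Euc d} (hctr : ∀ y, ‖y - ctr (cell y)‖ ≤ ρ) {j : ℕ} (hj : j < π.n)
    {q : ℕ → ℝ} {p : ℕ → Euc d} (hq : ∀ k, |q k| ≤ Λ) (hp : ∀ k, ‖p k‖ ≤ Λ)
    (hval : ∀ k b, -(2 * κ) ≤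
      ∫ z, (q k + ⟪clampDyn f T (π.node t j) (ctr k) (φ j k z) b, p k⟫))
    (htan : ∀ ω, LowerTangent T Z Λ (π.node t j) (ctr (cell (euler f π cA cell φ t x v j ω)))
      (q (cell (euler f π cA cell φ t x v j ω))) (p (cell (euler f π cA cell φ t x v j ω))))
    (hmod : ∀ ω, ∀ r ∈ Ico (π.node t j) (π.node t (j + 1)), ∀ a b,
      ‖f r (ctr (cell (euler f π cA cell φ t x v j ω))) a b -
        f (π.node t j) (ctr (cell (euler f π cA cell φ t x v j ω))) a b‖ ≤ κ')
    {S : Set Omega} (hS : MeasurableSet[Fsig (π.idx t)] S) :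
    ∫ ω in S, Z (π.node t j) (euler f π cA cell φ t x v j ω) ∂P -
      P.real S * (ρ * (5 * Λ + T * Λ * K) + (π.node t (j + 1) - π.node t j) * (2 * κ + (Λ * κ' +
        Λ * (π.node t (j + 1) - π.node t j) * (1 + 2 * C ^ 2)))) ≤
    ∫ ω in S, Z (π.node t (j + 1)) (euler f π cA cell φ t x v (j + 1) ω) ∂P := by
  set s := π.node t j with hs_def
  set s' := π.node t (j + 1) with hs'_def
  set Y := euler f π cA cell φ t x v j with hY
  have hss' : s ≤ s' := π.node_le_succ t hj
  have hs := π.node_mem ht hj.le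
  have hs' := π.node_mem ht (j := j + 1) hj
  have hs0 : s ∈ Icc 0 T := ⟨ht.1.trans hs.1, hs.2⟩
  have hs0' : s' ∈ Icc 0 T := ⟨ht.1.trans hs'.1, hs'.2⟩
  have hS' : MeasurableSet S := Fsig_le _ _ hS
  have hYm : Measurable Y := measurable_euler hf hc.measurable_left hcell hφ hv.1 j
  have hYm' := measurable_euler (π := π) (t := t) (x := x) hf hc.measurable_left hcell hφ hv.1 (j + 1)
  set H : I → B × ℕ → ℝ :=
    fun z y => q y.2 + ⟪clampDyn f T s (ctr y.2) (φ j y.2 z) y.1, p y.2⟫ with hH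
  have hHm : Measurable (Function.uncurry H) := by
    have h1 : Measurable fun y : (I × B) × ℕ =>
        q y.2 + ⟪clampDyn f T s (ctr y.2) (φ j y.2 y.1.1) y.1.2, p y.2⟫ :=
      measurable_from_prod_countable_left fun k => by
        have h2 : Measurable fun y : I × B => clampDyn f T s (ctr k) (φ j k y.1) y.2 :=
          hf.continuous_clampDyn.measurable.comp (measurable_const.prodMk
            (measurable_const.prodMk (((hφ j k).comp measurable_fst).prodMk measurable_snd)))
        have h3 : Measurable fun y : I × B => ⟪clampDyn f T s (ctr k) (φ j k y.1) y.2, p k⟫ :=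
          Measurable.inner (𝕜 := ℝ) h2 measurable_const
        exact h3.const_add (q k)
    exact h1.comp (f := fun y : I × B × ℕ => ((y.1, y.2.1), y.2.2)) (by fun_prop)
  have hHN : ∀ z y, |H z y| ≤ Λ + C * Λ := fun z y => by
    refine (abs_add_le _ _).trans (add_le_add (hq _) ((abs_real_inner_le_norm _ _).trans ?_))
    exact mul_le_mul (hf.bdd _ _ _ _) (hp _) (norm_nonneg _) hf.nonneg
  set G : Omega → ℝ → ℝ := fun ω r => H (cA (ω j)) (v r ω, cell (Y ω)) with hG
  have hGm : Measurable (Function.uncurry G) :=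
    hHm.comp (f := fun y : Omega × ℝ => (cA (y.1 j), v y.2 y.1, cell (Y y.1)))
      ((hc.measurable_left.comp ((measurable_pi_apply j).comp measurable_fst)).prodMk
        ((hv.1.comp measurable_swap).prodMk (hcell.comp (hYm.comp measurable_fst))))
  have hGi : Integrable (Function.uncurry G) ((P.restrict S).prod (volume.restrict (Ico s s'))) :=
    Integrable.of_bound hGm.aestronglyMeasurable (Λ + C * Λ) (ae_of_all _ fun y => hHN _ _)
  have hfub : -(2 * κ) * P.real S * (s' - s) ≤ ∫ ω in S, (∫ r in Ico s s', G ω r) ∂P := by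
    rw [integral_integral_swap hGi]
    have e1 : -(2 * κ) * P.real S * (s' - s) = ∫ _ in Ico s s', -(2 * κ) * P.real S := by
      rw [setIntegral_const, Real.volume_real_Ico_of_le hss', smul_eq_mul, mul_comm]
    rw [e1]
    refine setIntegral_mono_on (integrableOn_const (by simp)) hGi.integral_prod_right
      measurableSet_Ico fun r hr => ?_
    have hr' := π.Ico_node_subset t j hr
    have hidx : π.idx t ≤ j := π.idx_le_of_lt ht.1 (hs.1.trans_lt (hr.1.trans_lt hr'.2))
    refine le_setIntegral_of_fresh hP hc (Fsig_mono hidx _ hS)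
      (ψ := fun ω => (v r ω, cell (Y ω)))
      ((hv.1.comp (measurable_const.prodMk measurable_id)).prodMk (hcell.comp hYm))
      (fun ω ω' h h' => ?_) hHm hHN fun y => hval y.2 y.1
    rw [Adm.eq_of_agree hv hj hr' h h', hY, euler_eq_of_agree hv hj.le h]
  set E := ρ * (5 * Λ + T * Λ * K) + (s' - s) * (Λ * κ' + Λ * (s' - s) * (1 + 2 * C ^ 2)) with hE
  have hpath : ∀ ω, Z s (Y ω) + (∫ r in Ico s s', G ω r) - E ≤
      Z s' (euler f π cA cell φ t x v (j + 1) ω) := fun ω => by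
    have e1 : euler f π cA cell φ t x v (j + 1) ω = Y ω + ∫ r in Ico s s',
        clampDyn f T r (Y ω) (φ j (cell (Y ω)) (cA (ω j))) (v r ω) := by
      simp only [euler, hY, hs_def, hs'_def]
    have h1 := le_one_step (q := q (cell (Y ω))) (p := p (cell (Y ω))) (v := fun r => v r ω) hf hΛ
      hρ hρ1 hs0 ⟨hss', hs'.2⟩ (hZ s hs0) (hctr (Y ω)) (hp _) (htan ω)
      (φ j (cell (Y ω)) (cA (ω j))) (hv.1.comp (measurable_id.prodMk measurable_const))
      (fun r hr b => hmod ω r hr _ b)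
    rw [e1]
    exact h1
  have i1 : IntegrableOn (fun ω => Z s (Y ω)) S P :=
    Integrable.of_bound ((continuous_of_lowerTangent hs0 (hZ s hs0)).measurable.comp
      hYm).aestronglyMeasurable M (ae_of_all _ fun ω => hZM _ hs0 _)
  have i2 : IntegrableOn (fun ω => Z s' (euler f π cA cell φ t x v (j + 1) ω)) S P :=
    Integrable.of_bound ((continuous_of_lowerTangent hs0' (hZ s' hs0')).measurable.comp
      hYm').aestronglyMeasurable M (ae_of_all _ fun ω => hZM _ hs0' _)
  have i3 : IntegrableOn (fun ω => ∫ r in Ico s s', G ω r) S P := hGi.integral_prod_left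
  have i4 : IntegrableOn (fun _ => E) S P := integrableOn_const (by simp)
  have i5 : IntegrableOn (fun ω => Z s (Y ω) + ∫ r in Ico s s', G ω r) S P := i1.add i3
  have h1 := setIntegral_mono (i5.sub i4) i2 hpath
  simp only [Pi.sub_apply] at h1
  rw [integral_sub i5 i4, integral_add i1 i3, setIntegral_const, smul_eq_mul] at h1
  linarith

end ExpectedStep

section SecuredPayoff

variable {T : ℝ} {d : ℕ} {A B : Type} [MetricSpace A] [CompactSpace A] [MeasurableSpace A]
  [BorelSpace A] [MetricSpace B] [CompactSpace B] [MeasurableSpace B] [BorelSpace B]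
  [Nonempty A] [Nonempty B]

variable {f : ℝ → Euc d → A → B → Euc d} {C : ℝ} {K : ℝ≥0} {cA cB : I × I → I}
  {P : Measure Omega} [IsProbabilityMeasure P]

theorem exists_measurable_cell (d : ℕ) {ρ : ℝ} (hρ : 0 < ρ) :
    ∃ (cell : Euc d → ℕ) (ctr : ℕ → Euc d), Measurable cell ∧ ∀ y, ‖y - ctr (cell y)‖ ≤ ρ := by
  have h : ∀ y : Euc d, ∃ k, dist y (TopologicalSpace.denseSeq (Euc d) k) < ρ := fun y =>
    (TopologicalSpace.denseRange_denseSeq (Euc d)).exists_dist_lt y hρ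
  classical
  refine ⟨fun y => Nat.find (h y), TopologicalSpace.denseSeq (Euc d),
    measurable_find h fun k => Metric.isOpen_ball.measurableSet, fun y => ?_⟩
  rw [← dist_eq_norm]
  exact (Nat.find_spec (h y)).le

/-- Chaining the expected steps of the feedback dynamics. -/
theorem setIntegral_chain {π : Partition T} {t : ℝ} {x : Euc d} {cell : Euc d → ℕ}
    (hf : Dyn f T C K) (hP : IsProductMeasure P) (hc : Coord cA cB)
    {v : ℝ → Omega → B} (hv : v ∈ Adm cB B π) (ht : t ∈ Icc 0 T) {Z : ℝ → Euc d → ℝ}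
    {Λ M κ κ' ρ R η c : ℝ} (hΛ : 0 ≤ Λ) (hρ : 0 ≤ ρ) (hρ1 : ρ ≤ 1)
    (hZM : ∀ s ∈ Icc 0 T, ∀ y, |Z s y| ≤ M)
    (hZ : ∀ s ∈ Icc 0 T, ∀ c, ∃ (q : ℝ) (p : Euc d), ‖p‖ ≤ Λ ∧ LowerTangent T Z Λ s c q p)
    (hcell : Measurable cell) {φ : ℕ → ℕ → I → A} (hφ : ∀ j k, Measurable (φ j k))
    {ctr : ℕ → Euc d} (hctr : ∀ y, ‖y - ctr (cell y)‖ ≤ ρ) (hx : ‖x‖ + C * T + 1 ≤ R)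
    {q : ℕ → ℕ → ℝ} {p : ℕ → ℕ → Euc d} (hq : ∀ j k, |q j k| ≤ Λ) (hp : ∀ j k, ‖p j k‖ ≤ Λ)
    (hval : ∀ j k b, -(2 * κ) ≤
      ∫ z, (q j k + ⟪clampDyn f T (π.node t j) (ctr k) (φ j k z) b, p j k⟫))
    (htan : ∀ j k, π.node t j ∈ Icc 0 T → π.node t j < T - η → ‖ctr k‖ ≤ R →
      LowerTangent T Z Λ (π.node t j) (ctr k) (q j k) (p j k))
    {θ : ℝ} (hmod : ∀ s ∈ Icc 0 T, ∀ s' ∈ Icc 0 T, |s - s'| < θ → ∀ y, ‖y‖ ≤ R → ∀ a b,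
      ‖f s y a b - f s' y a b‖ ≤ κ') (hθ : π.mesh < θ)
    (hmc : 2 * κ + (Λ * κ' + Λ * π.mesh * (1 + 2 * C ^ 2)) ≤ c)
    {S : Set Omega} (hS : MeasurableSet[Fsig (π.idx t)] S) {j : ℕ} (hj : j ≤ π.n)
    (hjη : ∀ i < j, π.node t i < T - η) :
    (Z t x - (j * (ρ * (5 * Λ + T * Λ * K)) + (π.node t j - t) * c)) * P.real S ≤
    ∫ ω in S, Z (π.node t j) (euler f π cA cell φ t x v j ω) ∂P := by
  induction j with
  | zero =>
    simp [euler, π.node_zero ht.1, mul_comm]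
  | succ j ih =>
    have hj' : j < π.n := hj
    have h1 := ih hj'.le fun i hi => hjη i (by omega)
    have hs := π.node_mem ht hj'.le
    have hs' := π.node_mem ht hj
    have hs0 : π.node t j ∈ Icc 0 T := ⟨ht.1.trans hs.1, hs.2⟩
    have hss' := π.node_le_succ t hj'
    have hR : ∀ ω, ‖ctr (cell (euler f π cA cell φ t x v j ω))‖ ≤ R := fun ω => by
      have e1 := norm_euler_sub_le (cA := cA) (cell := cell) (φ := φ) (x := x) hf ht.1 v hj'.le ω
      have e2 := hctr (euler f π cA cell φ t x v j ω)
      have e3 := norm_sub_norm_le (ctr (cell (euler f π cA cell φ t x v j ω)))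
        (euler f π cA cell φ t x v j ω)
      have e4 := norm_sub_norm_le (euler f π cA cell φ t x v j ω) x
      have e5 : C * (π.node t j - t) ≤ C * T := by
        have := hf.nonneg
        gcongr
        linarith [hs.2, ht.1]
      rw [norm_sub_rev] at e3
      linarith
    have h2 := setIntegral_one_step hf hP hc hv ht hΛ hρ hρ1 hZM hZ hcell hφ hctr hj' (hq j)
      (hp j) (hval j) (κ' := κ') (x := x)
      (fun ω => htan _ _ hs0 (hjη j (by omega)) (hR ω)) (fun ω r hr a b => by
        refine hmod r ⟨hs0.1.trans hr.1, hr.2.le.trans hs'.2⟩ _ hs0 ?_ _ (hR ω) a b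
        rw [abs_of_nonneg (sub_nonneg.2 hr.1)]
        linarith [hr.2, π.node_sub_le_mesh t hj']) hS
    have h3 : (π.node t (j + 1) - π.node t j) * (2 * κ + (Λ * κ' +
        Λ * (π.node t (j + 1) - π.node t j) * (1 + 2 * C ^ 2))) ≤
        (π.node t (j + 1) - π.node t j) * c := by
      refine mul_le_mul_of_nonneg_left (le_trans ?_ hmc) (sub_nonneg.2 hss')
      have := π.node_sub_le_mesh t hj'
      gcongr
    have h4 := mul_le_mul_of_nonneg_left h3 (measureReal_nonneg (μ := P) (s := S))
    push_cast
    linarith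

/-- A bounded continuous viscosity subsolution is a payoff that the maximizer can secure along all
partitions with small mesh. -/
theorem exists_securing_strategy (hf : Dyn f T C K) (hP : IsProductMeasure P) (hc : Coord cA cB)
    {g : Euc d → ℝ} {L : ℝ≥0} (hgL : LipschitzWith L g) {M : ℝ} (hgM : ∀ x, |g x| ≤ M)
    {W : ℝ → Euc d → ℝ}
    (hWc : ContinuousOn (fun q : ℝ × Euc d => W q.1 q.2) (Icc (0 : ℝ) T ×ˢ univ))
    (hWM : ∃ M : ℝ, ∀ t ∈ Icc (0 : ℝ) T, ∀ x, |W t x| ≤ M) (hW : IsViscSubsol A B f g T W)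
    (R : ℝ) {κ : ℝ} (hκ : 0 < κ) :
    ∃ δ > 0, ∀ π : Partition T, π.mesh < δ → ∀ t ∈ Icc 0 T, ∀ x, ‖x‖ ≤ R →
      ∃ α : (ℝ → Omega → B) → ℝ → Omega → A, NAD cA cB P π t α ∧ ∀ v ∈ Adm cB B π,
        ∀ X : Omega → ℝ → Euc d, (∀ᵐ ω ∂P, IsSol f T t x (fun s => α v s ω) (fun s => v s ω) (X ω)) →
        AEMeasurable (fun ω => X ω T) P → ∀ S, MeasurableSet[Fsig (π.idx t)] S →
        (W t x - κ) * P.real S ≤ ∫ ω in S, g (X ω T) ∂P := by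
  have hT := hf.pos
  have hC := hf.nonneg
  obtain ⟨M', hM'⟩ := hWM
  have hM'0 : 0 < |M'| + 1 := by positivity
  obtain ⟨κ₁, hκ₁0, hκ₁e⟩ : ∃ κ₁ > 0,
      κ₁ * (2 + 4 * T + L * C + L * (C * Real.exp (K * T))) = κ :=
    ⟨κ / (2 + 4 * T + L * C + L * (C * Real.exp (K * T))), by positivity, by field_simp⟩
  obtain ⟨Z, Λ, η, hΛ, hη, hηκ, hWZ, hZg, hZ⟩ := exists_semiconvex_approx hf hWc hM'0
    (fun t ht x => (hM' t ht x).trans (by linarith [le_abs_self M'])) hW (R + C * T + 1) hκ₁0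
  obtain ⟨θ, hθ, hmod⟩ := hf.exists_time_modulus (R + C * T + 1) (κ := κ₁ / Λ) (by positivity)
  have hZ' : ∀ s ∈ Icc 0 T, ∀ c, ∃ (q : ℝ) (p : Euc d), ‖p‖ ≤ Λ ∧ LowerTangent T Z Λ s c q p :=
    fun s hs c => by
      obtain ⟨q, p, -, h2, h3, -⟩ := hZ s hs c
      exact ⟨q, p, h2, h3⟩
  have hZM : ∀ s ∈ Icc 0 T, ∀ y, |Z s y| ≤ |M'| + 1 := fun s hs y => by
    have h1 := hWZ s hs y
    have h2 := (abs_le.1 (hM' s hs y)).1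
    exact abs_le.2 ⟨by linarith [le_abs_self M'], h1.2⟩
  refine ⟨min θ (min κ₁ (κ₁ / (Λ * (1 + 2 * C ^ 2)))), by positivity, fun π hπ t ht x hx => ?_⟩
  rw [lt_min_iff, lt_min_iff, lt_div_iff₀ (by positivity)] at hπ
  obtain ⟨hπθ, hπκ, hπΛ⟩ := hπ
  set D := 5 * Λ + T * Λ * K with hD
  have hD0 : 0 < D := by positivity
  have hn : (0 : ℝ) < π.n := by exact_mod_cast π.npos
  obtain ⟨ρ, hρ, hρ1, hρκ⟩ : ∃ ρ : ℝ, 0 < ρ ∧ ρ ≤ 1 ∧ π.n * (ρ * D) ≤ κ₁ := by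
    refine ⟨min 1 (κ₁ / (π.n * D)), by positivity, min_le_left _ _, ?_⟩
    have h1 : min 1 (κ₁ / (π.n * D)) ≤ κ₁ / (π.n * D) := min_le_right _ _
    rw [le_div_iff₀ (by positivity)] at h1
    linarith
  obtain ⟨cell, ctr, hcell, hctr⟩ := exists_measurable_cell d hρ
  choose q p φ hq hp hφ hval htan using fun j k =>
    exists_feedback_data hf hΛ.le hκ₁0 hZ (π.node t j) (ctr k)
  refine ⟨feedback f π cA cell φ t x, feedback_nad hf hc.measurable_left hcell hφ P ht.1,
    fun v hv X hX hXm S hS => ?_⟩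
  have hex : ∃ j, T - η ≤ π.node t j := ⟨π.n, by rw [π.node_last ht.2]; linarith⟩
  classical
  obtain ⟨J, hJ, hJmin⟩ : ∃ J, T - η ≤ π.node t J ∧ ∀ i < J, π.node t i < T - η :=
    ⟨Nat.find hex, Nat.find_spec hex, fun i hi => not_le.1 (Nat.find_min hex hi)⟩
  have hJn : J ≤ π.n := by
    by_contra! h
    have := hJmin _ h
    rw [π.node_last ht.2] at this
    linarith
  have hm := π.mesh_nonneg
  have hchain := setIntegral_chain hf hP hc hv ht hΛ.le hρ.le hρ1 hZM hZ' hcell hφ hctr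
    (R := R + C * T + 1) (by linarith) hq hp hval htan hmod hπθ (κ := κ₁) (c := 4 * κ₁)
    (by rw [mul_div_cancel₀ _ hΛ.ne']; nlinarith) hS hJn hJmin
  have hs := π.node_mem ht hJn
  have hs0 : π.node t J ∈ Icc 0 T := ⟨ht.1.trans hs.1, hs.2⟩
  have hYm := measurable_euler (π := π) (t := t) (x := x) hf hc.measurable_left hcell hφ hv.1 J
  set E := κ₁ + L * (C * κ₁ + C * κ₁ * Real.exp (K * T)) with hE
  have hpath : ∀ᵐ ω ∂P, Z (π.node t J) (euler f π cA cell φ t x v J ω) - E ≤ g (X ω T) := by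
    filter_upwards [hX] with ω hω
    set Y := euler f π cA cell φ t x v J ω with hY
    have hYR : ‖Y‖ ≤ R + C * T + 1 := by
      have e1 := norm_euler_sub_le (cA := cA) (cell := cell) (φ := φ) (x := x) hf ht.1 v hJn ω
      have e2 := norm_sub_norm_le Y x
      have e3 : C * (π.node t J - t) ≤ C * T := by
        gcongr
        linarith [hs.2, ht.1]
      linarith
    have h1 := hZg _ hs0 hJ Y hYR
    have h2 := norm_sub_euler_le hf ht hc.measurable_left hcell hφ hv.1 hω hJn
    have h3 := hω.norm_sub_le hf ht.1
      ((measurable_feedback hf hc.measurable_left hcell hφ hv.1).comp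
        (measurable_id.prodMk measurable_const)) (hv.1.comp (measurable_id.prodMk measurable_const))
      hs ⟨hs.2, le_rfl⟩
    have h4 : C * (T - π.node t J) ≤ C * κ₁ := by gcongr; linarith
    have h5 : C * π.mesh * Real.exp (K * (π.node t J - t)) ≤ C * κ₁ * Real.exp (K * T) := by
      gcongr
      linarith [hs.2, ht.1]
    have h6 := norm_sub_le_norm_sub_add_norm_sub (X ω T) (X ω (π.node t J)) Y
    have h7 : ‖X ω T - Y‖ ≤ C * κ₁ + C * κ₁ * Real.exp (K * T) := by
      have : 0 ≤ C * π.mesh := by positivity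
      linarith
    have h8 := hgL.dist_le_mul (X ω T) Y
    rw [Real.dist_eq, dist_eq_norm] at h8
    have h9 : L * ‖X ω T - Y‖ ≤ L * (C * κ₁ + C * κ₁ * Real.exp (K * T)) := by gcongr
    have h10 := (abs_le.1 h8).1
    linarith
  have i1 : IntegrableOn (fun ω => Z (π.node t J) (euler f π cA cell φ t x v J ω)) S P :=
    Integrable.of_bound ((continuous_of_lowerTangent hs0 (hZ' _ hs0)).measurable.comp
      hYm).aestronglyMeasurable (|M'| + 1) (ae_of_all _ fun ω => hZM _ hs0 _)
  have i2 : IntegrableOn (fun ω => g (X ω T)) S P :=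
    (Integrable.of_bound (hgL.continuous.measurable.comp_aemeasurable hXm).aestronglyMeasurable M
      (ae_of_all _ fun ω => hgM _)).integrableOn
  have i3 : IntegrableOn (fun _ => E) S P := integrableOn_const (by simp)
  have h1 := setIntegral_mono_ae (i1.sub i3) i2 hpath
  simp only [Pi.sub_apply] at h1
  rw [integral_sub i1 i3, setIntegral_const, smul_eq_mul] at h1
  have h2 : W t x - κ ≤ Z t x - (J * (ρ * D) + (π.node t J - t) * (4 * κ₁)) - E := by
    have e1 := (hWZ t ht x).1
    have e2 : (J : ℝ) * (ρ * D) ≤ π.n * (ρ * D) := by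
      have : (J : ℝ) ≤ π.n := by exact_mod_cast hJn
      gcongr
    have e3 : (π.node t J - t) * (4 * κ₁) ≤ T * (4 * κ₁) := by
      gcongr
      linarith [hs.2, ht.1]
    linarith
  have h3 := mul_le_mul_of_nonneg_right h2 (measureReal_nonneg (μ := P) (s := S))
  linarith

end SecuredPayoff

section FixedPair

variable {T : ℝ} {d : ℕ} {A B : Type} [MetricSpace A] [CompactSpace A] [MeasurableSpace A]
  [BorelSpace A] [MetricSpace B] [CompactSpace B] [MeasurableSpace B] [BorelSpace B]
  [Nonempty A] [Nonempty B]

variable {f : ℝ → Euc d → A → B → Euc d} {C : ℝ} {K : ℝ≥0} {g : Euc d → ℝ}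
  {P : Measure Omega} [IsProbabilityMeasure P] {π : Partition T} {t : ℝ} {x : Euc d}
  {α : (ℝ → Omega → B) → ℝ → Omega → A} {β : (ℝ → Omega → A) → ℝ → Omega → B}

theorem const_mem_adm (c : I × I → I) (π : Partition T) (a : A) :
    (fun _ _ => a : ℝ → Omega → A) ∈ Adm c A π := by
  refine ⟨measurable_const, fun j _ => ⟨fun k => if k = 0 then univ else ∅, fun _ _ _ => a,
    fun k => ?_, fun k k' hkk' => ?_, ?_, fun _ _ => measurable_const, fun _ _ _ _ _ => rfl⟩⟩
  · dsimp only
    split_ifs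
    exacts [@MeasurableSet.univ _ (Fsig _), @MeasurableSet.empty _ (Fsig _)]
  · simp only [Function.onFun]
    by_cases hk : k = 0
    · have hk' : k' ≠ 0 := fun h => hkk' (hk.trans h.symm)
      rw [if_neg hk']
      exact disjoint_empty _
    · rw [if_neg hk]
      exact empty_disjoint _
  · exact eq_univ_of_forall fun ω => mem_iUnion.2 ⟨0, by simp⟩

theorem isStoppingIdx_const {j : ℕ} (hj : j < π.n) : IsStoppingIdx π fun _ => j :=
  ⟨fun _ => hj, fun i => by
    by_cases h : j = i
    · simpa only [h, ofPred_true] using @MeasurableSet.univ _ (Fsig i)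
    · simpa only [h, ofPred_false] using @MeasurableSet.empty _ (Fsig i)⟩

theorem exists_isFixPair (ht : t ∈ Icc 0 T) (hα : NAD Prod.fst Prod.snd P π t α)
    (hβ : NAD Prod.snd Prod.fst P π t β) : ∃ u v, IsFixPair P π t T α β u v := by
  let w : ℕ → (ℝ → Omega → A) × (ℝ → Omega → B) := fun k =>
    Nat.rec (fun _ _ => Classical.arbitrary A, fun _ _ => Classical.arbitrary B)
      (fun _ p => (α p.2, β p.1)) k
  have hw : ∀ k, (w k).1 ∈ Adm Prod.fst A π ∧ (w k).2 ∈ Adm Prod.snd B π := fun k => by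
    induction k with
    | zero => exact ⟨const_mem_adm _ _ _, const_mem_adm _ _ _⟩
    | succ k ih => exact ⟨hα.1 _ ih.2, hβ.1 _ ih.1⟩
  have hi := π.idx_lt t
  have hagree : ∀ k, π.idx t + k ≤ π.n →
      aeStEq P t (fun _ => π.t (π.idx t + k)) (w (k + 1)).1 (w k).1 ∧
      aeStEq P t (fun _ => π.t (π.idx t + k)) (w (k + 1)).2 (w k).2 := fun k => by
    induction k with
    | zero =>
      intro _
      have h1 := (Measure.quasiMeasurePreserving_fst (μ := (volume : Measure ℝ)) (ν := P)).ae
        ((measure_singleton t : volume {t} = 0) |> compl_mem_ae_iff.2)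
      have h2 := π.t_idx_le ht.1
      constructor <;>
      · filter_upwards [h1] with p hp h3 h4
        exact absurd (le_antisymm (h4.trans h2) h3) hp
    | succ k ih =>
      intro hk
      have h1 := ih (by omega)
      have hs := isStoppingIdx_const (π := π) (j := π.idx t + k) (by omega)
      exact ⟨hα.2 _ hs _ _ (hw (k + 1)).2 (hw k).2 h1.2,
        hβ.2 _ hs _ _ (hw (k + 1)).1 (hw k).1 h1.1⟩
  have hfin := hagree (π.n - π.idx t) (by omega)
  rw [show π.idx t + (π.n - π.idx t) = π.n by omega, π.map_last] at hfin
  refine ⟨(w (π.n - π.idx t)).1, (w (π.n - π.idx t)).2, (hw _).1, (hw _).2, ?_, ?_⟩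
  · filter_upwards [hfin.1] with p hp hp'
    exact hp hp'.1 hp'.2
  · filter_upwards [hfin.2] with p hp hmem
    exact hp hmem.1 hmem.2

/-- The payoff of a couple of strategies comes from a state process that is generated by each
strategy against an admissible control. -/
theorem payoff_spec (hf : Dyn f T C K) (ht : t ∈ Icc 0 T) (hα : NAD Prod.fst Prod.snd P π t α)
    (hβ : NAD Prod.snd Prod.fst P π t β) :
    ∃ (u : ℝ → Omega → A) (v : ℝ → Omega → B) (X : Omega → ℝ → Euc d),
      u ∈ Adm Prod.fst A π ∧ v ∈ Adm Prod.snd B π ∧ Measurable (fun ω => X ω T) ∧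
      payoff f g P π t x α β = (fun ω => g (X ω T)) ∧
      (∀ᵐ ω ∂P, IsSol f T t x (fun s => α v s ω) (fun s => v s ω) (X ω)) ∧
      ∀ᵐ ω ∂P, IsSol f T t x (fun s => u s ω) (fun s => β u s ω) (X ω) := by
  have hfix : IsFixPair P π t T α β (fixPair P π t T α β).1 (fixPair P π t T α β).2 := by
    obtain ⟨u, v, h⟩ := exists_isFixPair ht hα hβ
    exact Classical.epsilon_spec (p := fun p : (ℝ → Omega → A) × (ℝ → Omega → B) =>
      IsFixPair P π t T α β p.1 p.2) ⟨(u, v), h⟩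
  obtain ⟨hu, hv, h1, h2⟩ := hfix
  obtain ⟨h3, h4⟩ := isSol_sol_and_measurable hf hu.1 hv.1 ht x
  refine ⟨_, _, fun ω => sol f T t x (fun r => (fixPair P π t T α β).1 r ω)
    (fun r => (fixPair P π t T α β).2 r ω), hu, hv, h4, rfl, ?_, ?_⟩
  · filter_upwards [ae_ae_of_ae_prod' (R := fun s ω => s ∈ Icc t T → _ = _) h1] with ω hω
    refine (h3 ω).congr_ae ?_ (ae_of_all _ fun _ _ => rfl)
    filter_upwards [hω] with s hs hs'
    exact (hs hs').symm
  · filter_upwards [ae_ae_of_ae_prod' (R := fun s ω => s ∈ Icc t T → _ = _) h2] with ω hω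
    refine (h3 ω).congr_ae (ae_of_all _ fun _ _ => rfl) ?_
    filter_upwards [hω] with s hs hs'
    exact (hs hs').symm

theorem le_condExp_of_le_setIntegral {m m0 : MeasurableSpace Omega} {Q : Measure[m0] Omega}
    [IsProbabilityMeasure Q] (hm : m ≤ m0) {Y : Omega → ℝ} (hY : Integrable Y Q) {c : ℝ}
    (h : ∀ S, MeasurableSet[m] S → c * Q.real S ≤ ∫ ω in S, Y ω ∂Q) :
    ∀ᵐ ω ∂Q, c ≤ (Q[Y | m]) ω := by
  refine ae_of_ae_trim hm (μ := Q) (P := fun ω => c ≤ (Q[Y | m]) ω) ?_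
  refine ae_le_of_forall_setIntegral_le (f := fun _ => c) (integrable_const c)
    (integrable_condExp.trim hm stronglyMeasurable_condExp) fun S hS _ => ?_
  rw [← setIntegral_trim hm stronglyMeasurable_condExp hS, setIntegral_condExp hm hY hS,
    setIntegral_const, smul_eq_mul, mul_comm, measureReal_def, trim_measurableSet_eq hm hS]
  exact h S hS

end FixedPair

section EssentialBounds

variable {P : Measure Omega} [IsProbabilityMeasure P] {ι κ : Type*} {ξ : ι → Omega → ℝ}
  {S S' : Omega → ℝ} {M : ℝ}

theorem isEssInfFam_iff_neg : IsEssInfFam P ξ S ↔ IsEssSupFam P (fun i ω => - ξ i ω)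
    fun ω => - S ω := by
  constructor
  · refine fun h => ⟨fun i => ?_, fun W hW => ?_⟩
    · filter_upwards [h.1 i] with ω hω using neg_le_neg hω
    · have h1 := h.2 (fun ω => - W ω) fun i => by
        filter_upwards [hW i] with ω hω using neg_le.1 hω
      filter_upwards [h1] with ω hω using neg_le.1 hω
  · refine fun h => ⟨fun i => ?_, fun W hW => ?_⟩
    · filter_upwards [h.1 i] with ω hω using neg_le_neg_iff.1 hω
    · have h1 := h.2 (fun ω => - W ω) fun i => by
        filter_upwards [hW i] with ω hω using neg_le_neg hω
      filter_upwards [h1] with ω hω using neg_le_neg_iff.1 hω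

theorem IsEssSupFam.ae_eq (h : IsEssSupFam P ξ S) (h' : IsEssSupFam P ξ S') : S =ᵐ[P] S' := by
  filter_upwards [h.2 _ h'.1, h'.2 _ h.1] with ω h1 h2 using le_antisymm h1 h2

theorem exists_isEssSupFam_of_measurable [Nonempty ι] (hm : ∀ i, Measurable (ξ i))
    (hM : ∀ i ω, |ξ i ω| ≤ M) :
    ∃ S, Measurable S ∧ (∀ ω, |S ω| ≤ M) ∧ IsEssSupFam P ξ S := by
  have hbdd : ∀ (s : ℕ → ι) ω, BddAbove (range fun n => ξ (s n) ω) := fun s ω =>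
    ⟨M, by rintro _ ⟨n, rfl⟩; exact (abs_le.1 (hM _ _)).2⟩
  have hsm : ∀ s : ℕ → ι, Measurable fun ω => ⨆ n, ξ (s n) ω := fun s =>
    Measurable.iSup fun n => hm (s n)
  have hsM : ∀ (s : ℕ → ι) ω, |⨆ n, ξ (s n) ω| ≤ M := fun s ω =>
    abs_le.2 ⟨(abs_le.1 (hM (s 0) ω)).1.trans (le_ciSup (hbdd s ω) 0),
      ciSup_le fun n => (abs_le.1 (hM _ _)).2⟩
  have h_int : ∀ s : ℕ → ι, Integrable (fun ω => ⨆ n, ξ (s n) ω) P := fun s =>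
    Integrable.of_bound (hsm s).aestronglyMeasurable M (ae_of_all _ (hsM s))
  have hΦ : BddAbove (range fun s : ℕ → ι => ∫ ω, (⨆ n, ξ (s n) ω) ∂P) := by
    refine ⟨M, ?_⟩
    rintro _ ⟨s, rfl⟩
    refine (integral_mono (h_int s) (integrable_const M) fun ω => (abs_le.1 (hsM s ω)).2).trans ?_
    simp
  have hs : ∀ k : ℕ, ∃ s : ℕ → ι, (⨆ s : ℕ → ι, ∫ ω, (⨆ n, ξ (s n) ω) ∂P) - 1 / ((k : ℝ) + 1) <
      ∫ ω, (⨆ n, ξ (s n) ω) ∂P := fun k =>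
    exists_lt_of_lt_ciSup (sub_lt_self _ (by positivity))
  choose s hs using hs
  set r : ℕ → ι := fun n => s n.unpair.1 n.unpair.2 with hr
  have hr1 : ∀ k, ∫ ω, (⨆ n, ξ (s k n) ω) ∂P ≤ ∫ ω, (⨆ n, ξ (r n) ω) ∂P := fun k =>
    integral_mono (h_int _) (h_int _) fun ω => ciSup_le fun n => by
      have := le_ciSup (hbdd r ω) (Nat.pair k n)
      simpa [hr] using this
  have hr2 : (⨆ s : ℕ → ι, ∫ ω, (⨆ n, ξ (s n) ω) ∂P) ≤ ∫ ω, (⨆ n, ξ (r n) ω) ∂P := by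
    refine le_of_forall_pos_lt_add fun ε hε => ?_
    obtain ⟨k, hk⟩ := exists_nat_one_div_lt hε
    linarith [hs k, hr1 k]
  refine ⟨fun ω => ⨆ n, ξ (r n) ω, hsm r, hsM r, fun i => ?_, fun W hW => ?_⟩
  · set q : ℕ → ι := fun n => Nat.casesOn n i r
    have hle : ∀ ω, (⨆ n, ξ (r n) ω) ≤ ⨆ n, ξ (q n) ω := fun ω =>
      ciSup_le fun n => le_ciSup (hbdd q ω) (n + 1)
    have heq : ∫ ω, (⨆ n, ξ (r n) ω) ∂P = ∫ ω, (⨆ n, ξ (q n) ω) ∂P :=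
      le_antisymm (integral_mono (h_int r) (h_int q) hle) ((le_ciSup hΦ q).trans hr2)
    have hae := (integral_eq_iff_of_ae_le (h_int r) (h_int q) (ae_of_all _ hle)).1 heq
    filter_upwards [hae] with ω hω
    exact (le_ciSup (hbdd q ω) 0).trans hω.ge
  · filter_upwards [ae_all_iff.2 fun n => hW (r n)] with ω hω using ciSup_le hω

/-- A uniformly bounded family of random variables has an essential supremum. -/
theorem exists_isEssSupFam [Nonempty ι] (hm : ∀ i, AEMeasurable (ξ i) P)
    (hM : ∀ i, ∀ᵐ ω ∂P, |ξ i ω| ≤ M) :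
    ∃ S, Measurable S ∧ (∀ ω, |S ω| ≤ M) ∧ IsEssSupFam P ξ S := by
  have hM0 : 0 ≤ M := by
    obtain ⟨ω, hω⟩ := (hM (Classical.arbitrary ι)).exists
    exact (abs_nonneg _).trans hω
  set η : ι → Omega → ℝ := fun i ω => max (-M) (min M ((hm i).mk _ ω))
  have hη : ∀ i, ξ i =ᵐ[P] η i := fun i => by
    filter_upwards [(hm i).ae_eq_mk, hM i] with ω h1 h2
    rw [abs_le] at h2
    simp only [η, ← h1, min_eq_right h2.2, max_eq_right h2.1]
  obtain ⟨S, h1, h2, h3, h4⟩ := exists_isEssSupFam_of_measurable (P := P) (ξ := η) (M := M)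
    (fun i => measurable_const.max (measurable_const.min (hm i).measurable_mk)) fun i ω =>
      abs_le.2 ⟨le_max_left _ _, max_le (by linarith) (min_le_left _ _)⟩
  exact ⟨S, h1, h2, fun i => (hη i).le.trans (h3 i), fun W hW => h4 W fun i =>
    (hη i).symm.le.trans (hW i)⟩

theorem exists_isEssInfFam [Nonempty ι] (hm : ∀ i, AEMeasurable (ξ i) P)
    (hM : ∀ i, ∀ᵐ ω ∂P, |ξ i ω| ≤ M) : ∃ S, IsEssInfFam P ξ S := by
  obtain ⟨S, -, -, h⟩ := exists_isEssSupFam (P := P) (ξ := fun i ω => - ξ i ω) (M := M)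
    (fun i => (hm i).neg) fun i => by simpa only [abs_neg] using hM i
  exact ⟨fun ω => - S ω, isEssInfFam_iff_neg.2 (by simpa only [neg_neg] using h)⟩

theorem IsEssSupFam.aemeasurable_and_bound [Nonempty ι] (h : IsEssSupFam P ξ S)
    (hm : ∀ i, AEMeasurable (ξ i) P) (hM : ∀ i, ∀ᵐ ω ∂P, |ξ i ω| ≤ M) :
    AEMeasurable S P ∧ ∀ᵐ ω ∂P, |S ω| ≤ M := by
  obtain ⟨S', h1, h2, h3⟩ := exists_isEssSupFam hm hM
  refine ⟨⟨S', h1, h.ae_eq h3⟩, ?_⟩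
  filter_upwards [h.ae_eq h3] with ω hω
  rw [hω]
  exact h2 ω

theorem IsEssInfFam.aemeasurable_and_bound [Nonempty ι] (h : IsEssInfFam P ξ S)
    (hm : ∀ i, AEMeasurable (ξ i) P) (hM : ∀ i, ∀ᵐ ω ∂P, |ξ i ω| ≤ M) :
    AEMeasurable S P ∧ ∀ᵐ ω ∂P, |S ω| ≤ M := by
  obtain ⟨h1, h2⟩ := (isEssInfFam_iff_neg.1 h).aemeasurable_and_bound (M := M)
    (fun i => (hm i).neg) fun i => by simpa only [abs_neg] using hM i
  have h3 : AEMeasurable (fun ω => - - S ω) P := h1.neg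
  exact ⟨by simpa only [neg_neg] using h3, by simpa only [abs_neg] using h2⟩

variable {Y : ι → κ → Omega → ℝ}

theorem exists_essSup_essInf [Nonempty ι] [Nonempty κ] (hm : ∀ i k, AEMeasurable (Y i k) P)
    (hM : ∀ i k, ∀ᵐ ω ∂P, |Y i k ω| ≤ M) :
    ∃ (S : Omega → ℝ) (J : ι → Omega → ℝ), (∀ i, IsEssInfFam P (Y i) (J i)) ∧
      IsEssSupFam P J S := by
  choose J hJ using fun i => exists_isEssInfFam (hm i) (hM i)
  obtain ⟨S, -, -, hS⟩ := exists_isEssSupFam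
    (fun i => ((hJ i).aemeasurable_and_bound (hm i) (hM i)).1)
    fun i => ((hJ i).aemeasurable_and_bound (hm i) (hM i)).2
  exact ⟨S, J, hJ, hS⟩

theorem exists_essInf_essSup [Nonempty ι] [Nonempty κ] (hm : ∀ i k, AEMeasurable (Y i k) P)
    (hM : ∀ i k, ∀ᵐ ω ∂P, |Y i k ω| ≤ M) :
    ∃ (S : Omega → ℝ) (J : κ → Omega → ℝ), (∀ k, IsEssSupFam P (fun i => Y i k) (J k)) ∧
      IsEssInfFam P J S := by
  choose J hJm hJM hJ using fun k => exists_isEssSupFam (fun i => hm i k) fun i => hM i k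
  obtain ⟨S, hS⟩ := exists_isEssInfFam (P := P) (fun i => (hJm i).aemeasurable)
    fun i => ae_of_all _ (hJM i)
  exact ⟨S, J, hJ, hS⟩

/-- Bounds for the expectations of the two iterated essential bounds, when some `i` secures `a`
and some `k` secures `b`. -/
theorem integral_essSup_essInf_bounds [Nonempty ι] [Nonempty κ]
    (hm : ∀ i k, AEMeasurable (Y i k) P) (hM : ∀ i k, ∀ᵐ ω ∂P, |Y i k ω| ≤ M)
    {J : ι → Omega → ℝ} {J' : κ → Omega → ℝ}
    (hJ : ∀ i, IsEssInfFam P (Y i) (J i)) (hS : IsEssSupFam P J S)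
    (hJ' : ∀ k, IsEssSupFam P (fun i => Y i k) (J' k)) (hS' : IsEssInfFam P J' S')
    {a b : ℝ} (ha : ∃ i, ∀ k, ∀ᵐ ω ∂P, a ≤ Y i k ω) (hb : ∃ k, ∀ i, ∀ᵐ ω ∂P, Y i k ω ≤ b) :
    a ≤ ∫ ω, S ω ∂P ∧ ∫ ω, S ω ∂P ≤ ∫ ω, S' ω ∂P ∧ ∫ ω, S' ω ∂P ≤ b := by
  obtain ⟨i, hi⟩ := ha
  obtain ⟨k, hk⟩ := hb
  have hSi : Integrable S P := by
    obtain ⟨h1, h2⟩ := hS.aemeasurable_and_bound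
      (fun i => ((hJ i).aemeasurable_and_bound (hm i) (hM i)).1)
      fun i => ((hJ i).aemeasurable_and_bound (hm i) (hM i)).2
    exact Integrable.of_bound h1.aestronglyMeasurable M h2
  have hSi' : Integrable S' P := by
    obtain ⟨h1, h2⟩ := hS'.aemeasurable_and_bound
      (fun k => ((hJ' k).aemeasurable_and_bound (fun i => hm i k) fun i => hM i k).1)
      fun k => ((hJ' k).aemeasurable_and_bound (fun i => hm i k) fun i => hM i k).2
    exact Integrable.of_bound h1.aestronglyMeasurable M h2
  have h1 : (fun _ => a) ≤ᵐ[P] S := ((hJ i).2 _ hi).trans (hS.1 i)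
  have h2 : S' ≤ᵐ[P] fun _ => b := (hS'.1 k).trans ((hJ' k).2 _ hk)
  have h3 : S ≤ᵐ[P] S' := hS.2 _ fun i => hS'.2 _ fun k => ((hJ i).1 k).trans ((hJ' k).1 i)
  refine ⟨?_, integral_mono_ae hSi hSi' h3, ?_⟩
  · simpa using integral_mono_ae (integrable_const a) hSi h1
  · simpa using integral_mono_ae hSi' (integrable_const b) h2

end EssentialBounds

section ValueBounds

variable {T : ℝ} {d : ℕ} {A B : Type} [MetricSpace A] [CompactSpace A] [MeasurableSpace A]
  [BorelSpace A] [MetricSpace B] [CompactSpace B] [MeasurableSpace B] [BorelSpace B]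
  [Nonempty A] [Nonempty B]

variable {f : ℝ → Euc d → A → B → Euc d} {C : ℝ} {K L : ℝ≥0} {g : Euc d → ℝ} {M : ℝ}
  {P : Measure Omega} [IsProbabilityMeasure P] {W₁ W₂ : ℝ → Euc d → ℝ}

/-- On fine partitions, both value functions lie between every subsolution and every supersolution,
up to a small error. -/
theorem value_bounds (hf : Dyn f T C K) (hP : IsProductMeasure P) (hgL : LipschitzWith L g)
    (hgM : ∀ x, |g x| ≤ M)
    (hWc₁ : ContinuousOn (fun q : ℝ × Euc d => W₁ q.1 q.2) (Icc 0 T ×ˢ univ))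
    (hWM₁ : ∃ M, ∀ t ∈ Icc 0 T, ∀ x, |W₁ t x| ≤ M) (hW₁ : IsViscSubsol A B f g T W₁)
    (hWc₂ : ContinuousOn (fun q : ℝ × Euc d => W₂ q.1 q.2) (Icc 0 T ×ˢ univ))
    (hWM₂ : ∃ M, ∀ t ∈ Icc 0 T, ∀ x, |W₂ t x| ≤ M) (hW₂ : IsViscSupersol A B f g T W₂)
    (R : ℝ) {κ : ℝ} (hκ : 0 < κ) :
    ∃ δ > 0, ∀ π : Partition T, π.mesh < δ → ∀ t ∈ Icc 0 T, ∀ x, ‖x‖ ≤ R →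
      W₁ t x - κ ≤ lowerValD A B f g P π t x ∧
      lowerValD A B f g P π t x ≤ upperValD A B f g P π t x ∧
      upperValD A B f g P π t x ≤ W₂ t x + κ := by
  obtain ⟨δ₁, hδ₁, h₁⟩ := exists_securing_strategy hf hP coord_fst_snd hgL hgM hWc₁ hWM₁ hW₁ R hκ
  have hgM' : ∀ x, |- g x| ≤ M := fun x => by simpa only [abs_neg] using hgM x
  have hgL' : LipschitzWith L fun x => - g x := hgL.neg
  have hWM₂' : ∃ M, ∀ t ∈ Icc 0 T, ∀ x, |- W₂ t x| ≤ M := by simpa only [abs_neg] using hWM₂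
  obtain ⟨δ₂, hδ₂, h₂⟩ := exists_securing_strategy hf.swap hP coord_snd_fst hgL' hgM'
    hWc₂.neg hWM₂' (hW₂.neg_swap hf) R hκ
  refine ⟨min δ₁ δ₂, lt_min hδ₁ hδ₂, fun π hπ t ht x hx => ?_⟩
  obtain ⟨α, hα, hαS⟩ := h₁ π (hπ.trans_le (min_le_left _ _)) t ht x hx
  obtain ⟨β, hβ, hβS⟩ := h₂ π (hπ.trans_le (min_le_right _ _)) t ht x hx
  have : Nonempty {α // IsNAD1 A B P π t α} := ⟨⟨α, hα⟩⟩
  have : Nonempty {β // IsNAD2 A B P π t β} := ⟨⟨β, hβ⟩⟩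
  set Y : {α // IsNAD1 A B P π t α} → {β // IsNAD2 A B P π t β} → Omega → ℝ :=
    fun α β => P[payoff f g P π t x α.1 β.1 | Fsig (π.idx t)] with hY
  have hm : ∀ α β, AEMeasurable (Y α β) P := fun α β =>
    (stronglyMeasurable_condExp.mono (Fsig_le _)).measurable.aemeasurable
  have hM : ∀ α β, ∀ᵐ ω ∂P, |Y α β ω| ≤ M := fun α β =>
    ae_bdd_abs_condExp_of_ae_bdd_abs (ae_of_all _ fun ω => hgM _)
  have h_int : ∀ X : Omega → ℝ → Euc d, Measurable (fun ω => X ω T) →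
      Integrable (fun ω => g (X ω T)) P := fun X hX =>
    Integrable.of_bound (hgL.continuous.measurable.comp hX).aestronglyMeasurable M
      (ae_of_all _ fun ω => hgM _)
  obtain ⟨J, hJ, hS⟩ : IsLowerVal A B f g P π t x (lowerVal A B f g P π t x) :=
    Classical.epsilon_spec (exists_essSup_essInf hm hM)
  obtain ⟨J', hJ', hS'⟩ : IsUpperVal A B f g P π t x (upperVal A B f g P π t x) :=
    Classical.epsilon_spec (exists_essInf_essSup hm hM)
  refine integral_essSup_essInf_bounds hm hM hJ hS hJ' hS' ⟨⟨α, hα⟩, fun β' => ?_⟩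
    ⟨⟨β, hβ⟩, fun α' => ?_⟩
  · obtain ⟨u, v, X, -, hv, hX, heq, hsol, -⟩ := payoff_spec (g := g) (x := x) hf ht hα β'.2
    simp only [hY, heq]
    exact le_condExp_of_le_setIntegral (Fsig_le _) (h_int X hX)
      (hαS v hv X hsol hX.aemeasurable)
  · obtain ⟨u, v, X, hu, -, hX, heq, -, hsol⟩ := payoff_spec (g := g) (x := x) hf ht α'.2 hβ
    have h := le_condExp_of_le_setIntegral (Fsig_le (π.idx t)) (h_int X hX).neg
      (hβS u hu X hsol hX.aemeasurable)
    simp only [hY, heq]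
    filter_upwards [h, condExp_neg (μ := P) (fun ω => g (X ω T)) (Fsig (π.idx t))] with ω h3 h4
    rw [h4, Pi.neg_apply] at h3
    linarith

/-- The partition of `[0,T]` into `n + 1` intervals of equal length. -/
def uniformPartition (hT : 0 < T) (n : ℕ) : Partition T where
  n := n + 1
  npos := n.succ_pos
  t i := i * (T / (n + 1))
  map_zero := by simp
  map_last := by push_cast; field_simp
  mono i _ := by
    have : 0 < T / ((n : ℝ) + 1) := by positivity
    push_cast
    linarith

theorem uniformPartition_mesh (hT : 0 < T) (n : ℕ) :
    (uniformPartition hT n).mesh = T / (n + 1) := by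
  refine (Finset.sup'_congr _ rfl fun i _ => ?_).trans (Finset.sup'_const _ _)
  change ((i + 1 : ℕ) : ℝ) * (T / ((n : ℝ) + 1)) - i * (T / ((n : ℝ) + 1)) = T / ((n : ℝ) + 1)
  push_cast
  ring

theorem exists_partition_mesh_lt (hT : 0 < T) {δ : ℝ} (hδ : 0 < δ) :
    ∃ π : Partition T, π.mesh < δ := by
  obtain ⟨n, hn⟩ := exists_nat_one_div_lt (div_pos hδ hT)
  refine ⟨uniformPartition hT n, ?_⟩
  rw [uniformPartition_mesh]
  calc T / ((n : ℝ) + 1) = T * (1 / (n + 1)) := by ring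
    _ < T * (δ / T) := by gcongr
    _ = δ := by field_simp

/-- Comparison principle: every bounded continuous subsolution lies below every bounded continuous
supersolution. -/
theorem comparison (hf : Dyn f T C K) (hP : IsProductMeasure P) (hgL : LipschitzWith L g)
    (hgM : ∀ x, |g x| ≤ M)
    (hWc₁ : ContinuousOn (fun q : ℝ × Euc d => W₁ q.1 q.2) (Icc 0 T ×ˢ univ))
    (hWM₁ : ∃ M, ∀ t ∈ Icc 0 T, ∀ x, |W₁ t x| ≤ M) (hW₁ : IsViscSubsol A B f g T W₁)
    (hWc₂ : ContinuousOn (fun q : ℝ × Euc d => W₂ q.1 q.2) (Icc 0 T ×ˢ univ))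
    (hWM₂ : ∃ M, ∀ t ∈ Icc 0 T, ∀ x, |W₂ t x| ≤ M) (hW₂ : IsViscSupersol A B f g T W₂)
    {t : ℝ} (ht : t ∈ Icc 0 T) (x : Euc d) : W₁ t x ≤ W₂ t x := by
  refine le_of_forall_pos_le_add fun ε hε => ?_
  obtain ⟨δ, hδ, h⟩ := value_bounds hf hP hgL hgM hWc₁ hWM₁ hW₁ hWc₂ hWM₂ hW₂ ‖x‖ (half_pos hε)
  obtain ⟨π, hπ⟩ := exists_partition_mesh_lt hf.pos hδ
  obtain ⟨h1, h2, h3⟩ := h π hπ t ht x le_rfl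
  linarith

end ValueBounds

/-- **Theorem 4.1, main result.** The Hamilton–Jacobi–Isaacs equation
`∂_t W + sup_{μ ∈ ΔU} inf_{ν ∈ ΔV} f̃(t,x,μ,ν)·∇W = 0` on `[0,T] × ℝ^d`, `W(T,·) = g`, possesses
a unique bounded continuous viscosity solution `W`, and for any sequence of partitions with mesh
tending to `0`, both the lower and the upper value functions along the partitions converge to `W`
uniformly on compact subsets of `[0,T] × ℝ^d`. -/
theorem statement_17
    {d : ℕ} {U V : Type} [MetricSpace U] [CompactSpace U] [MetricSpace V] [CompactSpace V]
    [MeasurableSpace U] [BorelSpace U] [MeasurableSpace V] [BorelSpace V]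
    [Nonempty U] [Nonempty V]
    (T : ℝ) (hT : 0 < T)
    (f : ℝ → EuclideanSpace ℝ (Fin d) → U → V → EuclideanSpace ℝ (Fin d))
    (hf_bdd : ∃ C : ℝ, ∀ t x u v, ‖f t x u v‖ ≤ C)
    (hf_cont : ContinuousOn
      (fun q : ℝ × EuclideanSpace ℝ (Fin d) × U × V => f q.1 q.2.1 q.2.2.1 q.2.2.2)
      (Icc (0 : ℝ) T ×ˢ univ))
    (hf_lip : ∃ K : ℝ≥0, ∀ t u v, LipschitzWith K fun x => f t x u v)
    (g : EuclideanSpace ℝ (Fin d) → ℝ)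
    (hg_bdd : ∃ C : ℝ, ∀ x, |g x| ≤ C)
    (hg_lip : ∃ K : ℝ≥0, LipschitzWith K g)
    (P : Measure Omega) [IsProbabilityMeasure P] (hP : IsProductMeasure P)
    :
    ∃ W : ℝ → EuclideanSpace ℝ (Fin d) → ℝ,
      ContinuousOn (fun q : ℝ × EuclideanSpace ℝ (Fin d) => W q.1 q.2)
        (Icc (0 : ℝ) T ×ˢ univ) ∧
      (∃ M : ℝ, ∀ t ∈ Icc (0 : ℝ) T, ∀ x, |W t x| ≤ M) ∧
      IsViscSubsol U V f g T W ∧ IsViscSupersol U V f g T W ∧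
      (∀ W' : ℝ → EuclideanSpace ℝ (Fin d) → ℝ,
        ContinuousOn (fun q : ℝ × EuclideanSpace ℝ (Fin d) => W' q.1 q.2)
          (Icc (0 : ℝ) T ×ˢ univ) →
        (∃ M : ℝ, ∀ t ∈ Icc (0 : ℝ) T, ∀ x, |W' t x| ≤ M) →
        IsViscSubsol U V f g T W' → IsViscSupersol U V f g T W' →
        ∀ t ∈ Icc (0 : ℝ) T, ∀ x, W' t x = W t x) ∧
      (∀ prt : ℕ → Partition T, Tendsto (fun n => (prt n).mesh) atTop (𝓝 0) →
        ∀ K : Set (ℝ × EuclideanSpace ℝ (Fin d)),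
          IsCompact K → K ⊆ Icc (0 : ℝ) T ×ˢ univ →
          TendstoUniformlyOn (fun n q => lowerValD U V f g P (prt n) q.1 q.2)
            (fun q => W q.1 q.2) atTop K ∧
          TendstoUniformlyOn (fun n q => upperValD U V f g P (prt n) q.1 q.2)
            (fun q => W q.1 q.2) atTop K) := by
  obtain ⟨C, hC⟩ := hf_bdd
  obtain ⟨K, hK⟩ := hf_lip
  obtain ⟨M, hM⟩ := hg_bdd
  obtain ⟨L, hL⟩ := hg_lip
  have hf : Dyn f T C K := ⟨hT, hC, hf_cont, hK⟩
  obtain ⟨W, hWc, hWM, hsub, hsup⟩ := exists_viscosity_solution hf hM hL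
  refine ⟨W, hWc, ⟨M, hWM⟩, hsub, hsup, fun W' hWc' hWM' hsub' hsup' t ht x => ?_,
    fun prt hprt Q hQ hQT => ?_⟩
  · exact le_antisymm (comparison hf hP hL hM hWc' hWM' hsub' hWc ⟨M, hWM⟩ hsup ht x)
      (comparison hf hP hL hM hWc ⟨M, hWM⟩ hsub hWc' hWM' hsup' ht x)
  · obtain ⟨R, hR⟩ := hQ.isBounded.exists_norm_le
    have hclose : ∀ ε > 0, ∀ᶠ n in atTop, ∀ q ∈ Q,
        |W q.1 q.2 - lowerValD U V f g P (prt n) q.1 q.2| < ε ∧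
        |W q.1 q.2 - upperValD U V f g P (prt n) q.1 q.2| < ε := fun ε hε => by
      obtain ⟨δ, hδ, h⟩ := value_bounds hf hP hL hM hWc ⟨M, hWM⟩ hsub hWc ⟨M, hWM⟩ hsup R
        (half_pos hε)
      filter_upwards [hprt.eventually_lt_const hδ] with n hn q hq
      obtain ⟨h1, h2, h3⟩ := h (prt n) hn q.1 (hQT hq).1 q.2 ((norm_snd_le q).trans (hR q hq))
      constructor <;> rw [abs_lt] <;> constructor <;> linarith
    constructor <;> refine Metric.tendstoUniformlyOn_iff.2 fun ε hε => ?_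
    · filter_upwards [hclose ε hε] with n hn q hq using (hn q hq).1
    · filter_upwards [hclose ε hε] with n hn q hq using (hn q hq).2

end DGameFormal
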